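/- arXiv:2503.01796 — 3 statements merged into one kernel-verified Lean document; each statement's English description precedes it below -/
import Mathlib

section
/- Let (R, m) be the perfection of a noetherian local F_p-algebra (R₀, m₀), and let M₀ be an R₀[φ]-module that is Artinian as an R₀-module (co-finite). Then M₀^perf has finite length as an R[φ]-module. -/
/-- An `R[φ]`-module structure on an `R`-module `M` over an `𝔽_p`-algebra `R`:
an additive map `φ : M → M` satisfying `φ (a • m) = a ^ p • φ m`. -/
structure FrobMod (p : ℕ) (R : Type) [CommRing R] (M : Type) [AddCommGroup M] [Module R M] where
  φ : M →+ M
  semilinear : ∀ (a : R) (m : M), φ (a • m) = a ^ p • φ m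

namespace FrobMod

variable {p : ℕ} {R : Type} [CommRing R] {M : Type} [AddCommGroup M] [Module R M]

/-- An `R[φ]`-module is nilpotent if some power of `φ` is zero. -/
def IsNilpotentMod (F : FrobMod p R M) : Prop :=
  ∃ e : ℕ, ∀ m : M, F.φ^[e] m = 0

/-- A submodule is an `R[φ]`-submodule if it is stable under `φ`. -/
def IsStable (F : FrobMod p R M) (N : Submodule R M) : Prop :=
  ∀ m ∈ N, F.φ m ∈ N

/-- An `R[φ]`-module is simple if it is nonzero and has no nontrivial `φ`-stable submodules. -/
def IsSimpleMod (F : FrobMod p R M) : Prop :=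
  (∃ m : M, m ≠ 0) ∧ ∀ N : Submodule R M, F.IsStable N → N = ⊥ ∨ N = ⊤

/-- An `R[φ]`-module has finite length if there is a uniform bound on the lengths of
strictly increasing chains of `φ`-stable submodules. -/
def HasFiniteLength (F : FrobMod p R M) : Prop :=
  ∃ n : ℕ, ∀ (m : ℕ) (c : Fin m → Submodule R M),
    (∀ i, F.IsStable (c i)) → StrictMono c → m ≤ n

end FrobMod

/-- `g : R₀ →+* R` exhibits `R` as the (direct limit) perfection of `R₀`:
`R` is perfect, every element of `R` has a `p`-power landing in the image of `R₀`, and the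
kernel of `g` consists exactly of the nilpotent elements. -/
structure IsRingPerfection (p : ℕ) {R₀ R : Type} [CommRing R₀] [CommRing R]
    (g : R₀ →+* R) : Prop where
  perfect : Function.Bijective fun x : R => x ^ p
  colim : ∀ x : R, ∃ (n : ℕ) (y : R₀), x ^ p ^ n = g y
  ker : ∀ y : R₀, g y = 0 ↔ ∃ n : ℕ, y ^ p ^ n = 0

/-- `ι : M →ₗ[R] P` exhibits `(P, F)` as the Frobenius perfection
`colim (M → φ_*M → φ_*²M → ⋯)` of the `R[φ]`-module `(M, F₀)`, within `R[φ]`-modules. -/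
structure IsFrobPerfection (p : ℕ) {R : Type} [CommRing R] {M P : Type}
    [AddCommGroup M] [Module R M] [AddCommGroup P] [Module R P]
    (F₀ : FrobMod p R M) (F : FrobMod p R P) (ι : M →ₗ[R] P) : Prop where
  bijective : Function.Bijective F.φ
  comm : ∀ m, ι (F₀.φ m) = F.φ (ι m)
  surj : ∀ x : P, ∃ (e : ℕ) (m : M), F.φ^[e] x = ι m
  ker : ∀ m, ι m = 0 ↔ ∃ e : ℕ, F₀.φ^[e] m = 0

/-- `ι : M₀ →+ P` exhibits `(P, F)`, an `R[φ]`-module over the perfection `g : R₀ →+* R`,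
as the Frobenius perfection `M₀^perf = colim φ_*^e M₀` of the `R₀[φ]`-module `(M₀, F₀)`. -/
structure IsModPerfection (p : ℕ) {R₀ R : Type} [CommRing R₀] [CommRing R] (g : R₀ →+* R)
    {M₀ : Type} [AddCommGroup M₀] [Module R₀ M₀] (F₀ : FrobMod p R₀ M₀)
    {P : Type} [AddCommGroup P] [Module R P] (F : FrobMod p R P)
    (ι : M₀ →+ P) : Prop where
  bijective : Function.Bijective F.φ
  semilinear : ∀ (a : R₀) (m : M₀), ι (a • m) = g a • ι m
  comm : ∀ m, ι (F₀.φ m) = F.φ (ι m)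
  surj : ∀ x : P, ∃ (e : ℕ) (m : M₀), F.φ^[e] x = ι m
  ker : ∀ m, ι m = 0 ↔ ∃ e : ℕ, F₀.φ^[e] m = 0

namespace FPerf

section Art
variable {S M : Type} [CommRing S] [AddCommGroup M] [Module S M]

def artL (x : S) (n : ℕ) (Q : Submodule S M) : Submodule S (Submodule.torsionBy S M x) :=
  (Q.map (LinearMap.lsmul S M (x ^ n))).comap (Submodule.torsionBy S M x).subtype

lemma mem_artL (x : S) (n : ℕ) (Q : Submodule S M) (u : Submodule.torsionBy S M x) :
    u ∈ artL x n Q ↔ ∃ z ∈ Q, x ^ n • z = (u : M) := by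
  simp [artL]

lemma artL_mono (x : S) {m n : ℕ} (h : m ≤ n) {Q Q' : Submodule S M} (hQ : Q ≤ Q') :
    artL x n Q ≤ artL x m Q' := by
  intro u hu
  rw [mem_artL] at *
  obtain ⟨z, hz, e⟩ := hu
  obtain ⟨k, rfl⟩ := Nat.exists_eq_add_of_le h
  exact ⟨x ^ k • z, hQ (Q.smul_mem _ hz), by rw [← mul_smul, ← pow_add, e]⟩

lemma artL_le (x : S) (tors : ∀ z : M, ∃ n : ℕ, x ^ n • z = 0) {Q Q' : Submodule S M} (hQ : Q ≤ Q')
    (h : ∀ n, artL x n Q' ≤ artL x n Q) : Q' ≤ Q := by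
  have key : ∀ n : ℕ, ∀ z ∈ Q', x ^ n • z = 0 → z ∈ Q := by
    intro n
    induction n with
    | zero => intro z _ h0; simp at h0; simp [h0]
    | succ n ih =>
      intro z hz h0
      have hu : x ^ n • z ∈ Submodule.torsionBy S M x := by
        rw [Submodule.mem_torsionBy_iff, ← mul_smul, ← pow_succ', h0]
      have := h n ((mem_artL x n Q' ⟨_, hu⟩).2 ⟨z, hz, rfl⟩)
      rw [mem_artL] at this
      obtain ⟨z', hz', e⟩ := this
      have h1 : z - z' ∈ Q := ih _ (Q'.sub_mem hz (hQ hz')) (by rw [smul_sub, e]; simp)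
      simpa using Q.add_mem h1 hz'
  intro z hz
  obtain ⟨n, hn⟩ := tors z
  exact key n z hz hn

theorem isArtinian_of_torsionBy (x : S) (tors : ∀ z : M, ∃ n : ℕ, x ^ n • z = 0)
    [hA : IsArtinian S (Submodule.torsionBy S M x)] : IsArtinian S M := by
  have hst := (monotone_stabilizes_iff_artinian (R := S)
    (M := Submodule.torsionBy S M x)).2 hA
  rw [← monotone_stabilizes_iff_artinian]
  intro f
  obtain ⟨n0, h0⟩ := hst ⟨fun n => OrderDual.toDual (artL x n (OrderDual.ofDual (f n))),
    fun i j hij => artL_mono x hij (f.2 hij)⟩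
  have h1 : ∀ n, ∃ i, ∀ j, i ≤ j → artL x n (OrderDual.ofDual (f i)) =
      artL x n (OrderDual.ofDual (f j)) := by
    intro n
    obtain ⟨i, hi⟩ := hst ⟨fun i => OrderDual.toDual (artL x n (OrderDual.ofDual (f i))),
      fun i j hij => artL_mono x le_rfl (f.2 hij)⟩
    exact ⟨i, fun j hj => hi j hj⟩
  choose i hi using h1
  refine ⟨n0 + ∑ n ∈ Finset.range n0, i n, fun j hj => ?_⟩
  set N := n0 + ∑ n ∈ Finset.range n0, i n with hN
  apply le_antisymm (f.2 hj)
  change OrderDual.ofDual (f N) ≤ OrderDual.ofDual (f j)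
  apply artL_le x tors (f.2 hj)
  intro n
  by_cases hn : n < n0
  · have : i n ≤ ∑ n ∈ Finset.range n0, i n :=
      Finset.single_le_sum (f := i) (fun _ _ => Nat.zero_le _) (Finset.mem_range.2 hn)
    exact ((hi n N (by omega)).symm.trans (hi n j (by omega))).le
  · have h2 : artL x n (OrderDual.ofDual (f N)) ≤ artL x n0 (OrderDual.ofDual (f n0)) :=
      artL_mono x (by omega) (f.2 (by omega))
    have h3 : artL x n0 (OrderDual.ofDual (f n0)) = artL x (max n j) (OrderDual.ofDual (f (max n j))) :=
      h0 (max n j) (by omega)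
    rw [h3] at h2
    exact h2.trans (artL_mono x (by omega) (f.2 (by omega)))

end Art
end FPerf

namespace FPerf
open MvPowerSeries

abbrev PS (d : ℕ) (k : Type) [Field k] : Type := MvPowerSeries (Fin d) k

def HO {d : ℕ} {k : Type} [Field k] (n : ℕ) (a : PS d k) : Prop := (n : ℕ∞) ≤ a.order

section HOsec
variable {d : ℕ} {k : Type} [Field k]

lemma HO_iff {n : ℕ} {a : PS d k} : HO n a ↔ ∀ α : Fin d →₀ ℕ, α.degree < n → coeff α a = 0 := by
  constructor
  · intro h α hα
    exact coeff_of_lt_order (lt_of_lt_of_le (by exact_mod_cast hα) h)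
  · intro h
    exact nat_le_order h

lemma HO.mono {m n : ℕ} (h : m ≤ n) {a : PS d k} (ha : HO n a) : HO m a :=
  le_trans (by exact_mod_cast h) ha

lemma HO.add {n : ℕ} {a b : PS d k} (ha : HO n a) (hb : HO n b) : HO n (a + b) := by
  rw [HO_iff] at *
  intro α hα; simp [ha α hα, hb α hα]

lemma HO.sub {n : ℕ} {a b : PS d k} (ha : HO n a) (hb : HO n b) : HO n (a - b) := by
  rw [HO_iff] at *
  intro α hα; simp [ha α hα, hb α hα]

lemma HO.mul {m n : ℕ} {a b : PS d k} (ha : HO m a) (hb : HO n b) : HO (m + n) (a * b) := by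
  refine le_trans ?_ le_order_mul
  push_cast
  exact add_le_add ha hb

lemma HO_zero (a : PS d k) : HO 0 a := by simp [HO]

lemma HO.mul_left {n : ℕ} {a : PS d k} (ha : HO n a) (b : PS d k) : HO n (b * a) := by
  simpa using (HO_zero b).mul ha

lemma HO.mul_right {n : ℕ} {a : PS d k} (ha : HO n a) (b : PS d k) : HO n (a * b) := by
  simpa using ha.mul (HO_zero b)

lemma HO.pow {n : ℕ} {a : PS d k} (ha : HO n a) (q : ℕ) : HO (q * n) (a ^ q) := by
  induction q with
  | zero => simpa using HO_zero _
  | succ q ih => rw [pow_succ, add_mul, one_mul]; exact ih.mul ha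

lemma HO_monomial {n : ℕ} {α : Fin d →₀ ℕ} (h : n ≤ α.degree) (s : k) :
    HO n (monomial α s : PS d k) := by
  classical
  rw [HO_iff]
  intro β hβ
  rw [coeff_monomial, if_neg]
  rintro rfl; omega

lemma HO_sub_trunc (n : ℕ) (a : PS d k) : HO n (a - ((truncTotal n a).toMvPowerSeries : PS d k)) := by
  rw [HO_iff]
  intro α hα
  rw [map_sub, MvPolynomial.coeff_coe, coeff_truncTotal _ hα, sub_self]

lemma HO_induction {P : PS d k → Prop} (n : ℕ) (hm : ∀ α s, P (monomial α s))
    (hadd : ∀ a b, P a → P b → P (a + b)) (hHO : ∀ a, HO n a → P a) (a : PS d k) : P a := by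
  have h1 : ∀ f : MvPolynomial (Fin d) k, P (f : PS d k) := by
    intro f
    induction f using MvPolynomial.induction_on' with
    | monomial u a => rw [MvPolynomial.coe_monomial]; exact hm u a
    | add p q hp hq => rw [MvPolynomial.coe_add]; exact hadd _ _ hp hq
  have := hadd _ _ (h1 (truncTotal n a)) (hHO _ (HO_sub_trunc n a))
  rwa [add_sub_cancel] at this

end HOsec

/-- the injective hull of the residue field, as continuous functionals -/
def EE (d : ℕ) (k : Type) [Field k] : Submodule k (PS d k →ₗ[k] k) where
  carrier := {f | ∃ n, ∀ a, HO n a → f a = 0}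
  add_mem' := by
    rintro f g ⟨m, hm⟩ ⟨n, hn⟩
    refine ⟨m + n, fun a ha => ?_⟩
    simp [hm a (ha.mono (by omega)), hn a (ha.mono (by omega))]
  zero_mem' := ⟨0, by simp⟩
  smul_mem' := by
    rintro c f ⟨n, hn⟩
    exact ⟨n, fun a ha => by simp [hn a ha]⟩

namespace EE
variable {d : ℕ} {k : Type} [Field k]

noncomputable instance : SMul (PS d k) (EE d k) where
  smul a w := ⟨w.1 ∘ₗ LinearMap.mulLeft k a, by
    obtain ⟨n, hn⟩ := w.2
    exact ⟨n, fun b hb => hn _ (hb.mul_left a)⟩⟩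

lemma smul_apply (a : PS d k) (w : EE d k) (b : PS d k) : (a • w).1 b = w.1 (a * b) := rfl

lemma ext' {w w' : EE d k} (h : ∀ b, w.1 b = w'.1 b) : w = w' := Subtype.ext (LinearMap.ext h)

lemma add_apply (w w' : EE d k) (b : PS d k) : (w + w').1 b = w.1 b + w'.1 b := rfl
lemma zero_apply (b : PS d k) : (0 : EE d k).1 b = 0 := rfl
lemma ksmul_apply (c : k) (w : EE d k) (b : PS d k) : (c • w).1 b = c * w.1 b := rfl

noncomputable instance : Module (PS d k) (EE d k) where
  one_smul w := ext' fun b => by rw [smul_apply, one_mul]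
  mul_smul a a' w := ext' fun b => by rw [smul_apply, smul_apply, smul_apply]; congr 1; ring
  smul_zero a := rfl
  smul_add a w w' := rfl
  add_smul a a' w := ext' fun b => by rw [smul_apply, add_apply, smul_apply, smul_apply, add_mul, map_add]
  zero_smul w := ext' fun b => by rw [smul_apply, zero_mul, map_zero, zero_apply]

instance : IsScalarTower k (PS d k) (EE d k) where
  smul_assoc c a w := ext' fun b => by
    rw [smul_apply, ksmul_apply, smul_apply, smul_mul_assoc, map_smul, smul_eq_mul]

lemma ext_mono {w w' : EE d k} (h : ∀ γ, w.1 (monomial γ 1) = w'.1 (monomial γ 1)) : w = w' := by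
  obtain ⟨n, hn⟩ := w.2
  obtain ⟨n', hn'⟩ := w'.2
  refine ext' fun b => ?_
  induction b using HO_induction (n + n') with
  | hm α s =>
    have : (monomial α s : PS d k) = s • monomial α 1 := by rw [← map_smul]; simp
    rw [this, map_smul, map_smul, h]
  | hadd a b ha hb => rw [map_add, map_add, ha, hb]
  | hHO a ha => rw [hn _ (ha.mono (by omega)), hn' _ (ha.mono (by omega))]

lemma C_smul (c : k) (w : EE d k) : (C c : PS d k) • w = c • w := by
  have h : (C c : PS d k) = c • 1 := by rw [smul_eq_C_mul, mul_one]
  rw [h, smul_assoc, one_smul]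

/-- the inverse monomials -/
noncomputable def Xi (γ : Fin d →₀ ℕ) : EE d k :=
  ⟨(coeff γ : PS d k →ₗ[k] k), γ.degree + 1, fun (a : PS d k) (ha : HO _ a) => by
    rw [HO_iff] at ha; exact ha _ (by omega)⟩

lemma Xi_apply (γ : Fin d →₀ ℕ) (b : PS d k) : (Xi γ : EE d k).1 b = coeff γ b := rfl

lemma tors (w : EE d k) : ∃ n, ∀ a : PS d k, HO n a → a • w = 0 := by
  obtain ⟨n, hn⟩ := w.2
  exact ⟨n, fun a ha => ext' fun b => hn _ (ha.mul_right b)⟩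

lemma eq_sum (w : EE d k) : ∃ s : Finset (Fin d →₀ ℕ),
    w = ∑ γ ∈ s, w.1 (monomial γ 1) • Xi γ := by
  classical
  obtain ⟨n, hn⟩ := w.2
  have hf : {γ : Fin d →₀ ℕ | γ.degree < n}.Finite := by
    exact Finsupp.finite_of_degree_lt n
  refine ⟨hf.toFinset, ext_mono fun γ => ?_⟩
  have : ∀ b, (∑ γ ∈ hf.toFinset, w.1 (monomial γ 1) • (Xi γ : EE d k)).1 b =
      ∑ γ ∈ hf.toFinset, w.1 (monomial γ 1) * coeff γ b := by
    intro b
    rw [AddSubmonoidClass.coe_finsetSum, LinearMap.sum_apply]; rfl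
  rw [this]
  by_cases hγ : γ.degree < n
  · rw [Finset.sum_eq_single γ]
    · simp
    · intro β _ hβ; rw [coeff_monomial, if_neg hβ, mul_zero]
    · intro h; simp [hγ] at h
  · rw [hn _ (HO_monomial (by omega) _), Finset.sum_eq_zero]
    intro β hβ
    rw [coeff_monomial, if_neg, mul_zero]
    rintro rfl; simp at hβ; omega

lemma induct {P : EE d k → Prop} (h0 : P 0) (hadd : ∀ a b, P a → P b → P (a + b))
    (h : ∀ (c : k) γ, P (c • Xi γ)) (w : EE d k) : P w := by
  obtain ⟨s, hs⟩ := eq_sum w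
  rw [hs]
  exact Finset.sum_induction _ P hadd h0 fun γ _ => h _ γ

lemma monomial_smul_Xi (δ γ : Fin d →₀ ℕ) (s : k) :
    (monomial δ s : PS d k) • (Xi γ : EE d k) = if δ ≤ γ then s • Xi (γ - δ) else 0 := by
  refine ext' fun b => ?_
  rw [smul_apply, Xi_apply, coeff_monomial_mul]
  split_ifs <;> rfl

/-- power series from coefficients -/
def mkPS (f : (Fin d →₀ ℕ) → k) : PS d k := f

lemma coeff_mkPS (f : (Fin d →₀ ℕ) → k) (γ) : coeff γ (mkPS f) = f γ := rfl

/-- duality (D) -/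
lemma dual (l : EE d k →ₗ[k] k) : ∃ a : PS d k, ∀ w : EE d k, l w = w.1 a := by
  refine ⟨mkPS fun γ => l (Xi γ), fun w => ?_⟩
  induction w using induct with
  | h0 => rw [map_zero, zero_apply]
  | hadd a b ha hb => rw [map_add, ha, hb, add_apply]
  | h c γ => rw [map_smul, ksmul_apply, Xi_apply, coeff_mkPS]; rfl

lemma faithful {a : PS d k} (h : ∀ w : EE d k, a • w = 0) : a = 0 := by
  ext γ
  have := congrArg (fun w => w.1 1) (h (Xi γ))
  simpa [smul_apply, Xi_apply, zero_apply] using this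

lemma faithful_pi {r : ℕ} {v : Fin r → PS d k} (h : ∀ w : Fin r → EE d k, ∑ i, v i • w i = 0) :
    v = 0 := by
  classical
  funext i
  apply faithful
  intro w
  have := h (Pi.single i w)
  rw [Finset.sum_eq_single i] at this
  · simpa using this
  · intro j _ hj; simp [Pi.single_eq_of_ne hj]
  · simp

lemma exists_annihilator {r : ℕ} (Q : Submodule (PS d k) (Fin r → EE d k)) (hQ : Q ≠ ⊤) :
    ∃ v : Fin r → PS d k, v ≠ 0 ∧ ∀ w ∈ Q, ∑ i, v i • w i = 0 := by
  classical
  have h1 : Q.restrictScalars k < ⊤ := by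
    rw [lt_top_iff_ne_top]
    intro h; apply hQ
    rw [eq_top_iff]; intro x _
    have : x ∈ Q.restrictScalars k := by rw [h]; trivial
    exact this
  obtain ⟨l, hl, hle⟩ := Submodule.exists_le_ker_of_lt_top (K := k) (V := Fin r → EE d k) (Q.restrictScalars k) h1
  have h2 : ∀ i, ∃ a : PS d k, ∀ w : EE d k, l (Pi.single i w) = w.1 a := fun i =>
    dual (l ∘ₗ LinearMap.single k (fun _ => EE d k) i)
  choose v hv using h2
  have hlv : ∀ w, l w = ∑ i, (w i).1 (v i) := by
    intro w
    conv_lhs => rw [← Finset.univ_sum_single w]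
    rw [map_sum]
    exact Finset.sum_congr rfl fun i _ => hv i _
  refine ⟨v, ?_, ?_⟩
  · rintro rfl
    apply hl
    ext w
    simp [hlv]
  · intro w hw
    refine ext' fun b => ?_
    have h3 : l (b • w) = 0 := hle (show b • w ∈ Q from Q.smul_mem b hw)
    rw [hlv] at h3
    rw [AddSubmonoidClass.coe_finsetSum, LinearMap.sum_apply, zero_apply, ← h3]
    refine Finset.sum_congr rfl fun i _ => ?_
    rw [smul_apply, Pi.smul_apply, smul_apply, mul_comm]

lemma divisible {c : PS d k} (hc : c ≠ 0) (w : EE d k) : ∃ w', c • w' = w := by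
  set Q : Submodule (PS d k) (Fin 1 → EE d k) := LinearMap.range (LinearMap.lsmul (PS d k) (Fin 1 → EE d k) c)
  have : Q = ⊤ := by
    by_contra h
    obtain ⟨v, hv, h2⟩ := exists_annihilator Q h
    apply hv
    have : (fun i => v i * c) = 0 := faithful_pi fun w => by
      have := h2 (c • w) ⟨w, rfl⟩
      simpa [mul_smul] using this
    funext i
    have := congrFun this i
    simp only [Pi.zero_apply, mul_eq_zero, hc, or_false] at this
    exact this
  have hw : (fun _ : Fin 1 => w) ∈ Q := by rw [this]; trivial
  obtain ⟨w', h⟩ := hw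
  exact ⟨w' 0, congrFun h 0⟩

lemma endo (θ : EE d k →ₗ[PS d k] EE d k) : ∃ a : PS d k, ∀ w, θ w = a • w := by
  obtain ⟨a, ha⟩ := dual (d := d) (k := k)
    { toFun := fun w => (θ w).1 1, map_add' := fun w w' => by rw [map_add, add_apply],
      map_smul' := fun c w => by
        rw [← C_smul, map_smul, C_smul, ksmul_apply]; rfl }
  refine ⟨a, fun w => ext' fun b => ?_⟩
  have := ha (b • w)
  simp only [LinearMap.coe_mk, AddHom.coe_mk, map_smul, smul_apply, mul_one] at this
  rw [this, smul_apply, mul_comm]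

end EE
end FPerf

namespace FPerf
open MvPowerSeries

namespace EE
variable {d : ℕ} {k : Type} [Field k]

lemma finite_supp (w : EE d k) :
    (Function.support fun γ : Fin d →₀ ℕ => w.1 (monomial γ 1)).Finite := by
  obtain ⟨n, hn⟩ := w.2
  refine (Finsupp.finite_of_degree_lt (σ := Fin d) n).subset fun γ hγ => ?_
  by_contra h
  simp only [Set.mem_ofPred_eq, not_lt] at h
  exact hγ (hn _ (HO_monomial h 1))

noncomputable def rep : EE d k →+ ((Fin d →₀ ℕ) →₀ k) where
  toFun w := Finsupp.ofSupportFinite (fun γ => w.1 (monomial γ 1)) (finite_supp w)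
  map_zero' := by ext γ; rfl
  map_add' w w' := by ext γ; rfl

lemma rep_smul_Xi (c : k) (γ : Fin d →₀ ℕ) : rep (c • Xi γ : EE d k) = Finsupp.single γ c := by
  classical
  ext β
  change c * coeff γ (monomial β (1 : k)) = _
  rw [coeff_monomial, Finsupp.single_apply]
  split_ifs <;> simp

section
variable (p : ℕ) [hp : Fact p.Prime]

noncomputable def fr (γ : Fin d →₀ ℕ) : Fin d →₀ ℕ :=
  Finsupp.equivFunOnFinite.symm fun i => p * γ i + (p - 1)

lemma fr_apply (γ : Fin d →₀ ℕ) (i : Fin d) : fr p γ i = p * γ i + (p - 1) := rfl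

variable [CharP k p]

instance charPS : CharP (PS d k) p := charP_of_injective_algebraMap
  (FaithfulSMul.algebraMap_injective k (PS d k)) p

noncomputable def F : EE d k →+ EE d k :=
  (Finsupp.liftAddHom (fun γ : Fin d →₀ ℕ =>
    ((AddMonoidHom.flip (smulAddHom k (EE d k))) (Xi (fr p γ))).comp
      (frobenius k p : k →+* k).toAddMonoidHom)).comp rep

lemma F_smul_Xi (c : k) (γ : Fin d →₀ ℕ) : F p (c • Xi γ : EE d k) = c ^ p • Xi (fr p γ) := by
  unfold F
  rw [AddMonoidHom.comp_apply, rep_smul_Xi, Finsupp.liftAddHom_apply_single]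
  rfl

lemma F_Xi (γ : Fin d →₀ ℕ) : F p (Xi γ : EE d k) = Xi (fr p γ) := by
  simpa using F_smul_Xi p (1 : k) γ

lemma fr_sub {γ δ : Fin d →₀ ℕ} (h : δ ≤ γ) : fr p γ - p • δ = fr p (γ - δ) := by
  ext i
  have := h i
  simp only [Finsupp.tsub_apply, fr_apply, Finsupp.smul_apply, smul_eq_mul]
  rw [Nat.mul_sub]
  have : p * δ i ≤ p * γ i := Nat.mul_le_mul_left _ this
  omega

lemma le_fr {γ δ : Fin d →₀ ℕ} : p • δ ≤ fr p γ ↔ δ ≤ γ := by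
  have h0 := hp.out.pos
  constructor
  · intro h i
    have := h i
    simp only [fr_apply, Finsupp.smul_apply, smul_eq_mul] at this
    by_contra hlt
    have h2 : p * (γ i + 1) ≤ p * δ i := Nat.mul_le_mul_left _ (by omega)
    rw [Nat.mul_add] at h2
    omega
  · intro h i
    have := Nat.mul_le_mul_left p (h i)
    simp only [fr_apply, Finsupp.smul_apply, smul_eq_mul]
    omega

lemma degree_fr_lt (γ : Fin d →₀ ℕ) : (fr p γ).degree < p * (γ.degree + d + 1) := by
  have h0 := hp.out.pos
  have : (fr p γ).degree = p * γ.degree + d * (p - 1) := by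
    simp [Finsupp.degree_eq_sum, fr_apply, Finset.sum_add_distrib, Finset.mul_sum]
  rw [this]
  have : d * (p - 1) ≤ p * d := by rw [mul_comm p]; exact Nat.mul_le_mul_left _ (by omega)
  nlinarith

lemma F_smul (a : PS d k) (w : EE d k) : F p (a • w) = a ^ p • F p w := by
  induction w using induct with
  | h0 => simp
  | hadd w w' h h' => rw [smul_add, map_add, map_add, smul_add, h, h']
  | h c γ =>
    induction a using HO_induction (γ.degree + d + 1) with
    | hm δ s =>
      rw [smul_comm, monomial_smul_Xi, F_smul_Xi, monomial_pow, smul_comm, monomial_smul_Xi]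
      rw [if_congr (le_fr p) rfl rfl]
      split_ifs with h
      · rw [smul_smul, F_smul_Xi, fr_sub p h, smul_smul, mul_pow]
      · simp
    | hadd a b ha hb => rw [add_smul, map_add, ha, hb, ← add_smul, add_pow_char]
    | hHO a ha =>
      have h1 : a • (c • Xi γ : EE d k) = 0 := by
        rw [smul_comm, show a • (Xi γ : EE d k) = 0 from ?_, smul_zero]
        refine ext' fun b => ?_
        rw [smul_apply, Xi_apply, zero_apply]
        exact HO_iff.1 (ha.mul_right b) _ (by omega)
      rw [h1, map_zero, F_smul_Xi, smul_comm, show a ^ p • (Xi (fr p γ) : EE d k) = 0 from ?_, smul_zero]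
      refine ext' fun b => ?_
      rw [smul_apply, Xi_apply, zero_apply]
      exact HO_iff.1 ((ha.pow p).mul_right b) _ (degree_fr_lt p γ)

lemma F_iter_smul (e : ℕ) (a : PS d k) (w : EE d k) : (F p)^[e] (a • w) = a ^ p ^ e • (F p)^[e] w := by
  induction e with
  | zero => simp
  | succ e ih => rw [Function.iterate_succ_apply', ih, F_smul, Function.iterate_succ_apply',
      ← pow_mul, ← pow_succ]

lemma F_iter_smul_Xi0 (e : ℕ) (c : k) : ∃ c' : k, ∃ γ : Fin d →₀ ℕ, (c ≠ 0 → c' ≠ 0) ∧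
    (∀ i, γ i = p ^ e - 1) ∧ (F p)^[e] (c • Xi 0 : EE d k) = c' • Xi γ := by
  induction e with
  | zero => exact ⟨c, 0, id, by simp, rfl⟩
  | succ e ih =>
    obtain ⟨c', γ, h1, h2, h3⟩ := ih
    refine ⟨c' ^ p, fr p γ, fun h => pow_ne_zero _ (h1 h), fun i => ?_, ?_⟩
    · rw [fr_apply, h2, pow_succ, Nat.mul_sub, mul_comm p]
      have : 1 ≤ p ^ e := Nat.one_le_pow _ _ hp.out.pos
      have h4 : 1 * p ≤ p ^ e * p := Nat.mul_le_mul_right _ this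
      have := hp.out.pos
      omega
    · rw [Function.iterate_succ_apply', h3, F_smul_Xi]

lemma test {a : PS d k} (ha : a ≠ 0) {w : EE d k} (h : ∀ e, a • (F p)^[e] w = 0) : w = 0 := by
  classical
  by_contra hw
  -- choose a maximal monomial
  have hne : (finite_supp w).toFinset.Nonempty := by
    by_contra hem
    rw [Finset.not_nonempty_iff_eq_empty] at hem
    apply hw
    apply ext_mono
    intro γ
    by_contra hγ
    have : γ ∈ (finite_supp w).toFinset := by simpa using hγ
    rw [hem] at this; simp at this
  obtain ⟨δ, hδ, hmax⟩ := Finset.exists_max_image _ (fun γ : Fin d →₀ ℕ => γ.degree) hne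
  have hδ' : w.1 (monomial δ 1) ≠ 0 := by simpa using hδ
  have h1 : (monomial δ (1 : k) : PS d k) • w = w.1 (monomial δ 1) • Xi 0 := by
    apply ext_mono
    intro γ
    rw [smul_apply, monomial_mul_monomial, ksmul_apply, Xi_apply, coeff_monomial, one_mul]
    split_ifs with h0
    · subst h0; simp
    · rw [mul_zero]
      by_contra hne
      have := hmax (δ + γ) (by simpa using hne)
      rw [map_add] at this
      have h3 : γ.degree = 0 := by omega
      rw [Finsupp.degree_eq_zero_iff] at h3
      exact h0 h3.symm
  obtain ⟨η, hη⟩ := (ne_zero_iff_exists_coeff_ne_zero a).1 ha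
  set e := η.degree + 1 with he
  obtain ⟨c', γ, hc', hγ, hF⟩ := F_iter_smul_Xi0 (d := d) p e (w.1 (monomial δ 1))
  have h2 : a • (F p)^[e] ((monomial δ (1 : k) : PS d k) • w) = 0 := by
    rw [F_iter_smul, smul_comm, h, smul_zero]
  rw [h1, hF] at h2
  have hle : η ≤ γ := by
    intro i
    rw [hγ]
    have h5 : η i ≤ η.degree := Finsupp.le_degree i η
    have : e < p ^ e := Nat.lt_pow_self hp.out.one_lt
    omega
  have h3 := congrArg (fun w => w.1 (monomial (γ - η) 1)) h2
  simp only [smul_apply, ksmul_apply, Xi_apply, zero_apply] at h3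
  rw [coeff_mul_monomial, if_pos tsub_le_self, tsub_tsub_cancel_of_le hle] at h3
  simp [hc' hδ', hη] at h3

/-- classification of p-linear endomorphisms -/
lemma plin (Φ : EE d k →+ EE d k) (hΦ : ∀ (a : PS d k) w, Φ (a • w) = a ^ p • Φ w) :
    ∃ u : PS d k, ∀ w, Φ w = u • F p w := by
  classical
  have hp0 := hp.out.pos
  set dv : (Fin d →₀ ℕ) → (Fin d →₀ ℕ) := fun η =>
    Finsupp.equivFunOnFinite.symm fun i => η i / p with hdv
  set rm : (Fin d →₀ ℕ) → (Fin d →₀ ℕ) := fun η =>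
    Finsupp.equivFunOnFinite.symm fun i => p - 1 - η i % p with hrm
  set u : PS d k := mkPS fun η => (Φ (Xi (dv η))).1 (monomial (rm η) 1) with hu
  refine ⟨u, fun w => ?_⟩
  induction w using induct with
  | h0 => simp
  | hadd w w' h h' => rw [map_add, map_add, smul_add, h, h']
  | h c γ =>
    rw [← C_smul, hΦ, F_smul, smul_comm u]
    congr 1
    rw [F_Xi]
    apply ext_mono
    intro β
    rw [smul_apply, Xi_apply, coeff_mul_monomial]
    -- decompose β
    set β' := dv β with hβ'
    set ρ : Fin d →₀ ℕ := Finsupp.equivFunOnFinite.symm fun i => β i % p with hρ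
    have hβ : β = p • β' + ρ := by
      ext i
      simp only [hβ', hdv, hρ, Finsupp.add_apply, Finsupp.smul_apply,
        Finsupp.equivFunOnFinite_symm_apply_apply, smul_eq_mul]
      exact (Nat.div_add_mod _ _).symm
    have hρlt : ∀ i, ρ i < p := fun i => Nat.mod_lt _ hp0
    have h1 : (Φ (Xi γ)).1 (monomial β 1) = (Φ ((monomial β' (1 : k) : PS d k) • Xi γ)).1 (monomial ρ 1) := by
      rw [hΦ, smul_apply, monomial_pow, monomial_mul_monomial, one_pow, one_mul, ← hβ]
    have hiff : β ≤ fr p γ ↔ β' ≤ γ := by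
      constructor
      · intro h
        rw [← le_fr p]
        refine le_trans ?_ h
        rw [hβ]; exact le_self_add
      · intro h i
        have h2 := Nat.mul_le_mul_left p (h i)
        have h3 := congrArg (fun f => f i) hβ
        simp only [Finsupp.add_apply, Finsupp.smul_apply, smul_eq_mul] at h3
        rw [h3, fr_apply]
        have := hρlt i
        omega
    rw [h1, monomial_smul_Xi, if_congr hiff rfl rfl]
    split_ifs with h
    · rw [hu, coeff_mkPS, one_smul, mul_one]
      have key : ∀ i, (fr p γ - β) i = p * (γ i - β' i) + (p - 1 - ρ i) := by
        intro i
        have h2 := Nat.mul_le_mul_left p (h i)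
        have h3 := congrArg (fun f => f i) hβ
        simp only [Finsupp.add_apply, Finsupp.smul_apply, smul_eq_mul] at h3
        rw [Finsupp.tsub_apply, h3, fr_apply, Nat.mul_sub]
        have := hρlt i
        omega
      have h4 : dv (fr p γ - β) = γ - β' := by
        ext i
        simp only [hdv, Finsupp.equivFunOnFinite_symm_apply_apply]
        rw [key, Nat.mul_add_div hp0, Nat.div_eq_of_lt (by omega), Finsupp.tsub_apply, add_zero]
      have h5 : rm (fr p γ - β) = ρ := by
        ext i
        simp only [hrm, Finsupp.equivFunOnFinite_symm_apply_apply]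
        have := hρlt i
        rw [key, Nat.mul_add_mod, Nat.mod_eq_of_lt (by omega)]
        omega
      rw [h4, h5]
    · rw [map_zero, zero_apply]

end
end EE
end FPerf

namespace FPerf
open MvPowerSeries

def Tors (d : ℕ) (k : Type) [Field k] (M : Type) [AddCommGroup M] [Module (PS d k) M] : Prop :=
  ∀ z : M, ∃ n, ∀ a : PS d k, HO n a → a • z = 0

def FClosed {p : ℕ} {S M : Type} [CommRing S] [AddCommGroup M] [Module S M] (Φ : FrobMod p S M)
    (N : Submodule S M) : Prop := ∀ z, Φ.φ z ∈ N ↔ z ∈ N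

def ACCOn {p : ℕ} {S M : Type} [CommRing S] [AddCommGroup M] [Module S M] (Φ : FrobMod p S M) : Prop :=
  ∀ N : ℕ →o Submodule S M, (∀ i, FClosed Φ (N i)) → ∃ n, ∀ m, n ≤ m → N n = N m

def Core (p d : ℕ) (k : Type) [Field k] : Prop :=
  ∀ (M : Type) [AddCommGroup M] [Module (PS d k) M] [IsArtinian (PS d k) M],
    Tors d k M → ∀ Φ : FrobMod p (PS d k) M, ACCOn Φ

def TorsCase (p d : ℕ) (k : Type) [Field k] : Prop :=
  ∀ (M : Type) [AddCommGroup M] [Module (PS d k) M] [IsArtinian (PS d k) M],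
    Tors d k M → ∀ c : PS d k, c ≠ 0 → (∀ z : M, c • z = 0) → ∀ Φ : FrobMod p (PS d k) M, ACCOn Φ

def HasCorank (d : ℕ) (k : Type) [Field k] (r : ℕ) (M : Type) [AddCommGroup M]
    [Module (PS d k) M] : Prop :=
  ∃ c : PS d k, c ≠ 0 ∧ ∃ π : M →ₗ[PS d k] (Fin r → EE d k), ∀ z, π z = 0 → c • z = 0

section emb
variable {d : ℕ} {k : Type} [Field k] {M : Type} [AddCommGroup M] [Module (PS d k) M]

noncomputable def toE [Module k M] [IsScalarTower k (PS d k) M] (hT : Tors d k M) (f : M →ₗ[k] k) :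
    M →ₗ[PS d k] EE d k where
  toFun z := ⟨{ toFun := fun a => f (a • z)
                map_add' := fun a b => by rw [add_smul, map_add]
                map_smul' := fun c a => by rw [smul_assoc, map_smul]; rfl }, by
              obtain ⟨n, hn⟩ := hT z
              exact ⟨n, fun a ha => by simp [hn a ha]⟩⟩
  map_add' z z' := EE.ext' fun b => by
    change f _ = f _ + f _
    rw [smul_add, map_add]
  map_smul' a z := EE.ext' fun b => by
    change f (b • a • z) = f ((a * b) • z)
    rw [smul_smul, mul_comm]

lemma exists_hom (hT : Tors d k M) {z : M} (hz : z ≠ 0) :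
    ∃ θ : M →ₗ[PS d k] EE d k, θ z ≠ 0 := by
  let _ : Module k M := Module.compHom M (C : k →+* PS d k)
  have _ : IsScalarTower k (PS d k) M := ⟨fun c a z => by
    change (c • a) • z = (C c : PS d k) • a • z
    rw [smul_smul, smul_eq_C_mul]⟩
  obtain ⟨f, hf⟩ : ∃ f : M →ₗ[k] k, f z ≠ 0 := by
    by_contra! h
    exact hz ((Module.forall_dual_apply_eq_zero_iff k z).1 h)
  refine ⟨toE hT f, fun h => hf ?_⟩
  have := congrArg (fun w => w.1 1) h
  change f ((1 : PS d k) • z) = 0 at this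
  simpa using this

lemma exists_embedding [IsArtinian (PS d k) M] (hT : Tors d k M) :
    ∃ s, ∃ π : M →ₗ[PS d k] (Fin s → EE d k), ∀ z, π z = 0 → z = 0 := by
  let S : Set (Submodule (PS d k) M) :=
    {N | ∃ s, ∃ π : M →ₗ[PS d k] (Fin s → EE d k), N = LinearMap.ker π}
  obtain ⟨N, ⟨s, π, rfl⟩, hmin⟩ := IsArtinian.set_has_minimal S ⟨_, 0, 0, rfl⟩
  refine ⟨s, π, fun z hz => ?_⟩
  by_contra hne
  obtain ⟨θ, hθ⟩ := exists_hom hT hne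
  let π' : M →ₗ[PS d k] (Fin (s + 1) → EE d k) :=
    LinearMap.pi (Fin.cons θ fun i => LinearMap.proj i ∘ₗ π)
  have h0 : ∀ x, π' x 0 = θ x := fun x => rfl
  have h1 : ∀ x i, π' x (Fin.succ i) = π x i := fun x i => rfl
  refine hmin (LinearMap.ker π') ⟨_, π', rfl⟩ ?_
  refine lt_of_le_of_ne ?_ ?_
  · intro x hx
    rw [LinearMap.mem_ker] at *
    funext i
    rw [← h1, hx]; rfl
  · intro heq
    have : z ∈ LinearMap.ker π' := by rw [heq]; exact hz
    rw [LinearMap.mem_ker] at this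
    apply hθ; rw [← h0, this]; rfl

lemma exists_corank [IsArtinian (PS d k) M] (hT : Tors d k M) : ∃ r, HasCorank d k r M := by
  obtain ⟨s, π, h⟩ := exists_embedding hT
  exact ⟨s, 1, one_ne_zero, π, fun z hz => by rw [h z hz, smul_zero]⟩

/-- drop lemma -/
lemma drop {r : ℕ} {c : PS d k} (hc : c ≠ 0) (π : M →ₗ[PS d k] (Fin r → EE d k))
    (h : ∀ z, π z = 0 → c • z = 0) (v : Fin r → PS d k) (hv : v ≠ 0)
    (hvπ : ∀ z, ∑ i, v i • π z i = 0) : ∃ r' < r, HasCorank d k r' M := by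
  obtain ⟨j, hj⟩ := Function.ne_iff.1 hv
  obtain _ | r := r
  · exact j.elim0
  refine ⟨r, Nat.lt_succ_self r, c * v j, mul_ne_zero hc hj,
    LinearMap.pi fun i => LinearMap.proj (j.succAbove i) ∘ₗ π, fun z hz => ?_⟩
  rw [mul_smul]
  apply h
  rw [map_smul]
  have h1 : ∀ i, π z (j.succAbove i) = 0 := fun i => congrFun hz i
  have h2 := hvπ z
  rw [Fin.sum_univ_succAbove _ j] at h2
  simp only [h1, smul_zero, Finset.sum_const_zero, add_zero] at h2
  funext i
  rcases Fin.eq_self_or_eq_succAbove j i with rfl | ⟨i', rfl⟩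
  · exact h2
  · simp [h1]

lemma exists_surj [IsArtinian (PS d k) M] (hT : Tors d k M) :
    ∃ r, (∀ r', HasCorank d k r' M → r ≤ r') ∧ ∃ c : PS d k, c ≠ 0 ∧
      ∃ π : M →ₗ[PS d k] (Fin r → EE d k), (∀ z, π z = 0 → c • z = 0) ∧ Function.Surjective π := by
  classical
  have hex := exists_corank hT
  refine ⟨Nat.find hex, fun r' h => Nat.find_min' hex h, ?_⟩
  obtain ⟨c, hc, π, hπ⟩ := Nat.find_spec hex
  refine ⟨c, hc, π, hπ, ?_⟩
  rw [← LinearMap.range_eq_top]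
  by_contra hne
  obtain ⟨v, hv, h⟩ := EE.exists_annihilator _ hne
  obtain ⟨r', hr', h'⟩ := drop hc π hπ v hv fun z => h _ ⟨z, rfl⟩
  exact Nat.find_min hex hr' h'

lemma exists_section {r : ℕ} {c : PS d k} (π : M →ₗ[PS d k] (Fin r → EE d k))
    (h : ∀ z, π z = 0 → c • z = 0) (hs : Function.Surjective π) :
    ∃ β : (Fin r → EE d k) →ₗ[PS d k] M, (∀ z, β (π z) = c • z) ∧ ∀ w, π (β w) = c • w := by
  let e := LinearMap.quotKerEquivOfSurjective (M₂ := Fin r → EE d k) π hs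
  let l : (M ⧸ LinearMap.ker π) →ₗ[PS d k] M :=
    (LinearMap.ker π).liftQ (LinearMap.lsmul (PS d k) M c) (fun z hz => h z hz)
  have h1 : ∀ z, (l ∘ₗ e.symm.toLinearMap) (π z) = c • z := by
    intro z
    have : e.symm (π z) = (LinearMap.ker π).mkQ z := by
      rw [LinearEquiv.symm_apply_eq]; rfl
    change l (e.symm (π z)) = _
    rw [this]; rfl
  refine ⟨l ∘ₗ e.symm.toLinearMap, h1, fun w => ?_⟩
  obtain ⟨z, rfl⟩ := hs w
  rw [h1, map_smul]

lemma matrix_of {r t : ℕ} (θ : (Fin r → EE d k) →ₗ[PS d k] (Fin t → EE d k)) :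
    ∃ h : Matrix (Fin t) (Fin r) (PS d k), ∀ w i, θ w i = ∑ j, h i j • w j := by
  classical
  have h2 : ∀ i j, ∃ a : PS d k, ∀ w : EE d k, θ (Pi.single j w) i = a • w := fun i j =>
    EE.endo (LinearMap.proj i ∘ₗ θ ∘ₗ LinearMap.single (PS d k) (fun _ => EE d k) j)
  choose h hh using h2
  refine ⟨h, fun w i => ?_⟩
  conv_lhs => rw [← Finset.univ_sum_single w]
  rw [map_sum, Finset.sum_apply]
  exact Finset.sum_congr rfl fun j _ => hh i j _

lemma pmatrix_of (p : ℕ) [Fact p.Prime] [CharP k p] {r t : ℕ} (θ : (Fin r → EE d k) →+ (Fin t → EE d k))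
    (hθ : ∀ (a : PS d k) w, θ (a • w) = a ^ p • θ w) :
    ∃ h : Matrix (Fin t) (Fin r) (PS d k), ∀ w i, θ w i = ∑ j, h i j • EE.F p (w j) := by
  classical
  have h2 : ∀ i j, ∃ a : PS d k, ∀ w : EE d k, θ (Pi.single j w) i = a • EE.F p w := fun i j =>
    EE.plin p ((Pi.evalAddMonoidHom _ i).comp (θ.comp (AddMonoidHom.single (fun _ => EE d k) j)))
      (fun a w => by
        change θ (Pi.single j (a • w)) i = a ^ p • θ (Pi.single j w) i
        rw [Pi.single_smul, hθ]; rfl)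
  choose h hh using h2
  refine ⟨h, fun w i => ?_⟩
  conv_lhs => rw [← Finset.univ_sum_single w]
  rw [map_sum, Finset.sum_apply]
  exact Finset.sum_congr rfl fun j _ => hh i j _

/-- if `g` acts on `E^r` and `g w = 0` then `det g • w = 0` -/
lemma det_smul_eq_zero {r : ℕ} (g : Matrix (Fin r) (Fin r) (PS d k)) (w : Fin r → EE d k)
    (h : ∀ i, ∑ j, g i j • w j = 0) : g.det • w = 0 := by
  funext l
  have h1 : ∑ i, g.adjugate l i • ∑ j, g i j • w j = 0 := by simp [h]
  simp only [Finset.smul_sum, smul_smul] at h1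
  rw [Finset.sum_comm] at h1
  simp only [← Finset.sum_smul, ← Matrix.mul_apply, Matrix.adjugate_mul] at h1
  rw [Finset.sum_eq_single l] at h1
  · simpa using h1
  · intro j _ hj; simp [Matrix.one_apply_ne hj.symm]
  · simp

end emb

end FPerf

namespace FPerf
open MvPowerSeries

instance (d : ℕ) (k : Type) [Field k] : IsDomain (PS d k) := NoZeroDivisors.to_isDomain _

section gen
variable {p : ℕ} {S M : Type} [CommRing S] [AddCommGroup M] [Module S M]

def restr (Φ : FrobMod p S M) (N : Submodule S M) (h : ∀ z ∈ N, Φ.φ z ∈ N) : FrobMod p S N where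
  φ := { toFun := fun z => ⟨Φ.φ z, h z z.2⟩
         map_zero' := by ext; simp
         map_add' := fun x y => by ext; simp }
  semilinear a m := by ext; exact Φ.semilinear a m

lemma restr_φ (Φ : FrobMod p S M) (N : Submodule S M) (h : ∀ z ∈ N, Φ.φ z ∈ N) (z : N) :
    (((restr Φ N h).φ z : N) : M) = Φ.φ z := rfl

def quo (Φ : FrobMod p S M) (N : Submodule S M) (h : ∀ z ∈ N, Φ.φ z ∈ N) : FrobMod p S (M ⧸ N) where
  φ := QuotientAddGroup.map N.toAddSubgroup N.toAddSubgroup Φ.φ h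
  semilinear a m := by
    obtain ⟨z, rfl⟩ := N.mkQ_surjective m
    change N.mkQ (Φ.φ (a • z)) = a ^ p • N.mkQ (Φ.φ z)
    rw [Φ.semilinear, map_smul]

lemma quo_φ (Φ : FrobMod p S M) (N : Submodule S M) (h : ∀ z ∈ N, Φ.φ z ∈ N) (z : M) :
    (quo Φ N h).φ (N.mkQ z) = N.mkQ (Φ.φ z) := rfl

end gen

section
variable {d : ℕ} {k : Type} [Field k] {M : Type} [AddCommGroup M] [Module (PS d k) M]

lemma Tors.sub (hT : Tors d k M) (N : Submodule (PS d k) M) : Tors d k N := by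
  intro z
  obtain ⟨n, hn⟩ := hT z
  exact ⟨n, fun a ha => Subtype.ext (hn a ha)⟩

lemma Tors.quo (hT : Tors d k M) (N : Submodule (PS d k) M) : Tors d k (M ⧸ N) := by
  intro z
  obtain ⟨z, rfl⟩ := N.mkQ_surjective z
  obtain ⟨n, hn⟩ := hT z
  exact ⟨n, fun a ha => by rw [← map_smul, hn a ha, map_zero]⟩

lemma F_iter_sum (p : ℕ) [Fact p.Prime] [CharP k p] (e : ℕ) {r : ℕ} (w : Fin r → EE d k) :
    (EE.F p)^[e] (∑ j, w j) = ∑ j, (EE.F p)^[e] (w j) := by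
  induction e with
  | zero => rfl
  | succ e ih => simp only [Function.iterate_succ_apply', ih, map_sum]

lemma iter_kill (p : ℕ) [hp : Fact p.Prime] [CharP k p] {r : ℕ}
    (Ψ : (Fin r → EE d k) → (Fin r → EE d k)) (U : Matrix (Fin r) (Fin r) (PS d k))
    (hU : ∀ w i, Ψ w i = ∑ j, U i j • EE.F p (w j)) (e : ℕ) :
    ∃ m, m ≤ p ^ e ∧ ∀ (b : PS d k) w, b • Ψ^[e] w = 0 →
      ∀ i, (b * U.det ^ m) • (EE.F p)^[e] (w i) = 0 := by
  induction e with
  | zero => exact ⟨0, Nat.zero_le _, fun b w h i => by simpa using congrFun h i⟩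
  | succ e ih =>
    obtain ⟨m, hm, ih⟩ := ih
    refine ⟨m + p ^ e, ?_, fun b w h => ?_⟩
    · have := hp.out.two_le
      have h2 := Nat.mul_le_mul_left (p ^ e) this
      rw [pow_succ]; omega
    · rw [Function.iterate_succ_apply] at h
      have h1 := ih b _ h
      set g : Matrix (Fin r) (Fin r) (PS d k) := U.map (iterateFrobenius (PS d k) p e) with hg
      have h2 := det_smul_eq_zero g (fun j => (b * U.det ^ m) • (EE.F p)^[e + 1] (w j)) (fun i => by
        rw [← h1 i, hU, F_iter_sum, Finset.smul_sum]
        refine Finset.sum_congr rfl fun j _ => ?_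
        rw [EE.F_iter_smul, smul_comm, Function.iterate_succ_apply]
        rfl)
      have h3 : g.det = U.det ^ p ^ e := by
        have := (RingHom.map_det (iterateFrobenius (PS d k) p e) U).symm
        rw [iterateFrobenius_def] at this
        exact this
      intro i
      have h4 := congrFun h2 i
      rw [h3, Pi.smul_apply, smul_smul] at h4
      rw [pow_add, ← mul_assoc, mul_comm]
      exact h4

theorem stab_step {p : ℕ} [hp : Fact p.Prime] [CharP k p] (hTC : TorsCase p d k) (r : ℕ)
    (IH : ∀ r' < r, ∀ (M : Type) [AddCommGroup M] [Module (PS d k) M] [IsArtinian (PS d k) M],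
      Tors d k M → HasCorank d k r' M → ∀ Φ : FrobMod p (PS d k) M, ACCOn Φ)
    [IsArtinian (PS d k) M] (hT : Tors d k M) (hr : HasCorank d k r M) (Φ : FrobMod p (PS d k) M)
    (N : ℕ →o Submodule (PS d k) M) (hN : ∀ i, FClosed Φ (N i)) (hcov : ∀ z, ∃ i, z ∈ N i) :
    ∃ n, ∀ m, n ≤ m → N n = N m := by
  classical
  by_cases hsm : ∃ r' < r, HasCorank d k r' M
  · obtain ⟨r', hr', h⟩ := hsm
    exact IH r' hr' M hT h Φ N hN
  push Not at hsm
  obtain ⟨r0, hmin, c, hc, π, hπ, hs⟩ := exists_surj hT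
  have hr0 : r0 = r := by
    apply le_antisymm (hmin r hr)
    by_contra hlt
    exact hsm r0 (by omega) ⟨c, hc, π, hπ⟩
  subst hr0
  by_contra hns
  have hrpos : 0 < r0 := by
    rw [Nat.pos_iff_ne_zero]
    rintro rfl
    exact hns (hTC M hT c hc (fun z => hπ z (Subsingleton.elim _ _)) Φ N hN)
  obtain ⟨β, hβπ, hπβ⟩ := exists_section π hπ hs
  have htor : ∀ i, ∃ a : PS d k, a ≠ 0 ∧ ∀ z ∈ N i, a • z = 0 := by
    intro i
    have hst : ∀ z ∈ N i, Φ.φ z ∈ N i := fun z hz => (hN i z).2 hz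
    obtain ⟨t, -, c', hc', π', hπ', hs'⟩ := exists_surj (hT.quo (N i))
    by_cases ht : t < r0
    · exfalso
      have hle : ∀ j, N i ≤ N (i + j) := fun j => N.2 (by omega)
      have hcm : ∀ j, ((N (i + j)).map (N i).mkQ).comap (N i).mkQ = N (i + j) := by
        intro j
        rw [Submodule.comap_map_mkQ, sup_eq_right.2 (hle j)]
      have hmem : ∀ j z, (N i).mkQ z ∈ (N (i + j)).map (N i).mkQ ↔ z ∈ N (i + j) := by
        intro j z
        conv_rhs => rw [← hcm j]
        rfl
      obtain ⟨n, hn⟩ := IH t ht _ (hT.quo (N i)) ⟨c', hc', π', hπ'⟩ (quo Φ (N i) hst)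
        ⟨fun j => (N (i + j)).map (N i).mkQ, fun a b hab => Submodule.map_mono (N.2 (by omega))⟩
        (by
          intro j z
          obtain ⟨z, rfl⟩ := (N i).mkQ_surjective z
          rw [quo_φ]
          exact (hmem j _).trans ((hN _ _).trans (hmem j _).symm))
      apply hns
      refine ⟨i + n, fun m hm => ?_⟩
      obtain ⟨q, rfl⟩ := Nat.exists_eq_add_of_le hm
      have := hn (n + q) (by omega)
      change (N (i + n)).map (N i).mkQ = (N (i + (n + q))).map (N i).mkQ at this
      rw [add_assoc, ← hcm n, this, hcm]
    · obtain ⟨h, hh⟩ := matrix_of (π' ∘ₗ (N i).mkQ ∘ₗ β)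
      have hh' : ∀ z l, ∑ j, h l j • π z j = c • π' ((N i).mkQ z) l := by
        intro z l
        rw [← hh]
        simp only [LinearMap.comp_apply, hβπ, map_smul, Pi.smul_apply]
      have hinj : ∀ v : Fin t → PS d k, Matrix.vecMul v h = 0 → v = 0 := by
        intro v hv
        apply EE.faithful_pi
        intro w
        have : ∃ w' : Fin t → EE d k, ∀ l, c • w' l = w l := by
          choose w' hw' using fun l => EE.divisible hc (w l)
          exact ⟨w', hw'⟩
        obtain ⟨w', hw'⟩ := this
        obtain ⟨y, rfl⟩ := hs' w'
        obtain ⟨z, rfl⟩ := (N i).mkQ_surjective y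
        simp only [← hw', ← hh', Finset.smul_sum, smul_smul]
        rw [Finset.sum_comm]
        simp only [← Finset.sum_smul]
        refine Finset.sum_eq_zero fun j _ => ?_
        have := congrFun hv j
        simp only [Matrix.vecMul, dotProduct, Pi.zero_apply] at this
        rw [this, zero_smul]
      have htr : t ≤ r0 := le_of_fin_injective (PS d k) (Matrix.vecMulLinear h)
        ((injective_iff_map_eq_zero _).2 fun v hv => hinj v hv)
      have : t = r0 := by omega
      subst this
      have hdet : h.det ≠ 0 := by
        intro h0
        obtain ⟨v, hv, hv'⟩ := Matrix.exists_vecMul_eq_zero_iff.2 h0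
        exact hv (hinj v hv')
      refine ⟨c * h.det, mul_ne_zero hc hdet, fun z hz => ?_⟩
      rw [mul_smul]
      apply hπ
      rw [map_smul]
      apply det_smul_eq_zero
      intro l
      rw [hh', show (N i).mkQ z = 0 from by simpa using hz, map_zero]
      simp
  let Ψ : (Fin r0 → EE d k) →+ (Fin r0 → EE d k) :=
    (π.toAddMonoidHom.comp Φ.φ).comp β.toAddMonoidHom
  have hΨ : ∀ w, Ψ w = π (Φ.φ (β w)) := fun w => rfl
  obtain ⟨U, hU⟩ := pmatrix_of p Ψ (fun a w => by
    rw [hΨ, hΨ, map_smul, Φ.semilinear, map_smul])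
  by_cases hdet : U.det = 0
  · obtain ⟨v, hv, hvU⟩ := Matrix.exists_vecMul_eq_zero_iff.2 hdet
    have hvΨ : ∀ w, ∑ i, v i • Ψ w i = 0 := by
      intro w
      simp only [hU, Finset.smul_sum, smul_smul]
      rw [Finset.sum_comm]
      simp only [← Finset.sum_smul]
      refine Finset.sum_eq_zero fun j _ => ?_
      have := congrFun hvU j
      simp only [Matrix.vecMul, dotProduct, Pi.zero_apply] at this
      rw [this, zero_smul]
    let M' : Submodule (PS d k) M := Submodule.span (PS d k) (Set.range Φ.φ)
    have hM' : ∀ z, Φ.φ z ∈ M' := fun z => Submodule.subset_span ⟨z, rfl⟩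
    have hvM' : ∀ z ∈ M', ∑ i, (c ^ p * v i) • π z i = 0 := by
      intro z hz
      induction hz using Submodule.span_induction with
      | mem x hx =>
        obtain ⟨z, rfl⟩ := hx
        have := hvΨ (π z)
        rw [hΨ, hβπ, Φ.semilinear, map_smul] at this
        rw [← this]
        refine Finset.sum_congr rfl fun j _ => ?_
        rw [Pi.smul_apply, smul_smul, mul_comm]
      | zero => simp
      | add x y _ _ hx hy => simp [hx, hy, Finset.sum_add_distrib]
      | smul a x _ hx =>
        simp only [map_smul, Pi.smul_apply]
        simp only [smul_comm _ a, ← Finset.smul_sum, hx, smul_zero]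
    obtain ⟨r', hr', hcr⟩ := drop hc (π ∘ₗ M'.subtype) (fun z hz => Subtype.ext (hπ z hz))
      (fun i => c ^ p * v i) (by
        intro h0
        apply hv
        funext i
        have := congrFun h0 i
        simpa [hc] using this) (fun z => hvM' z z.2)
    obtain ⟨n, hn⟩ := IH r' hr' M' (hT.sub M') hcr (restr Φ M' fun z _ => hM' z)
      ⟨fun i => (N i).comap M'.subtype, fun a b hab => Submodule.comap_mono (N.2 hab)⟩
      (fun i z => hN i z)
    apply hns
    refine ⟨n, fun m hm => le_antisymm (N.2 hm) fun z hz => ?_⟩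
    have h1 : (⟨Φ.φ z, hM' z⟩ : M') ∈ (N m).comap M'.subtype := (hN m z).2 hz
    have h2 : (N n).comap M'.subtype = (N m).comap M'.subtype := hn m hm
    rw [← h2] at h1
    exact (hN n z).1 h1
  · have hkill : ∀ (w : Fin r0 → EE d k) (i : Fin r0), U.det • w i = 0 := by
      intro w l
      obtain ⟨i, hi⟩ := hcov (β w)
      obtain ⟨a, ha, haN⟩ := htor i
      have hst : ∀ e, β (Ψ^[e] w) ∈ N i := by
        intro e
        induction e with
        | zero => exact hi
        | succ e ih =>
          rw [Function.iterate_succ_apply', hΨ, hβπ]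
          exact (N i).smul_mem _ ((hN i _).2 ih)
      apply EE.test p (mul_ne_zero ha hc)
      intro e
      obtain ⟨m, hm, hk⟩ := iter_kill p Ψ U hU e
      have h1 : (a * c) • Ψ^[e] w = 0 := by
        rw [mul_smul, ← hπβ, ← map_smul, haN _ (hst e), map_zero]
      have h2 := hk _ w h1 l
      rw [EE.F_iter_smul, smul_smul, ← Nat.sub_add_cancel hm, pow_add, mul_left_comm, mul_smul, h2,
        smul_zero]
    apply hdet
    apply EE.faithful
    intro w
    exact hkill (fun _ => w) ⟨0, hrpos⟩

theorem core_of_torsCase {p : ℕ} [hp : Fact p.Prime] [CharP k p] (hTC : TorsCase p d k) :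
    Core p d k := by
  suffices H : ∀ r : ℕ, ∀ (M : Type) [AddCommGroup M] [Module (PS d k) M] [IsArtinian (PS d k) M],
      Tors d k M → HasCorank d k r M → ∀ Φ : FrobMod p (PS d k) M, ACCOn Φ by
    intro M _ _ _ hT Φ
    obtain ⟨r, hr⟩ := exists_corank hT
    exact H r M hT hr Φ
  intro r
  induction r using Nat.strong_induction_on with
  | _ r IH =>
  intro M _ _ _ hT hr Φ N hN
  let U : Submodule (PS d k) M := ⨆ i, N i
  have hU : ∀ z, z ∈ U ↔ ∃ i, z ∈ N i := fun z => Submodule.mem_iSup_of_chain N z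
  have hst : ∀ z ∈ U, Φ.φ z ∈ U := by
    intro z hz
    obtain ⟨i, hi⟩ := (hU z).1 hz
    exact (hU _).2 ⟨i, (hN i z).2 hi⟩
  obtain ⟨c, hc, π, hπ⟩ := hr
  obtain ⟨n, hn⟩ := stab_step hTC r IH (hT.sub U) ⟨c, hc, π ∘ₗ U.subtype, fun z hz =>
      Subtype.ext (hπ z hz)⟩ (restr Φ U hst)
    ⟨fun i => (N i).comap U.subtype, fun a b hab => Submodule.comap_mono (N.2 hab)⟩
    (fun i z => hN i z) (fun z => (hU z).1 z.2)
  refine ⟨n, fun m hm => ?_⟩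
  have h2 : (N n).comap U.subtype = (N m).comap U.subtype := hn m hm
  refine le_antisymm (N.2 hm) fun z hz => ?_
  have h1 : (⟨z, (hU z).2 ⟨m, hz⟩⟩ : U) ∈ (N m).comap U.subtype := hz
  rw [← h2] at h1
  exact h1

end
end FPerf

namespace FPerf
open MvPowerSeries

section psmod
variable {d : ℕ} {k : Type} [Field k] {B M : Type} [CommRing B] [AddCommGroup M] [Module B M]

def PValid (ψ : MvPolynomial (Fin d) k →+* B) (n : ℕ) (z : M) : Prop :=
  ∀ P : MvPolynomial (Fin d) k, HO n (P : PS d k) → ψ P • z = 0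

lemma PValid.mono {ψ : MvPolynomial (Fin d) k →+* B} {m n : ℕ} (h : m ≤ n) {z : M}
    (hz : PValid ψ m z) : PValid ψ n z := fun P hP => hz P (hP.mono h)

lemma PValid.smul {ψ : MvPolynomial (Fin d) k →+* B} {n : ℕ} {z : M}
    (hz : PValid ψ n z) (b : B) : PValid ψ n (b • z) := fun P hP => by
  rw [smul_comm, hz P hP, smul_zero]

lemma PValid.add {ψ : MvPolynomial (Fin d) k →+* B} {n : ℕ} {z z' : M}
    (hz : PValid ψ n z) (hz' : PValid ψ n z') : PValid ψ n (z + z') := fun P hP => by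
  rw [smul_add, hz P hP, hz' P hP, add_zero]

variable (ψ : MvPolynomial (Fin d) k →+* B) (hT : ∀ z : M, ∃ n, PValid ψ n z)

noncomputable def psSmul (a : PS d k) (z : M) : M := ψ (truncTotal (hT z).choose a) • z

lemma psSmul_eq {n : ℕ} {z : M} (hn : PValid ψ n z) {a : PS d k} (P : MvPolynomial (Fin d) k)
    (h : HO n (a - (P : PS d k))) : psSmul ψ hT a z = ψ P • z := by
  have h0 := (hT z).choose_spec
  unfold psSmul
  set n0 := (hT z).choose
  rw [← sub_eq_zero, ← sub_smul, ← map_sub]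
  have h1 : PValid ψ (min n n0) z := by
    rcases min_choice n n0 with h | h <;> rw [h] <;> assumption
  apply h1
  have h2 : ((truncTotal n0 a - P : MvPolynomial (Fin d) k) : PS d k) =
      (a - (P : PS d k)) - (a - ((truncTotal n0 a).toMvPowerSeries : PS d k)) := by
    rw [sub_sub_sub_cancel_left]
    exact map_sub (MvPolynomial.coeToMvPowerSeries.ringHom (R := k) (σ := Fin d)) _ _
  rw [h2]
  exact (h.mono (min_le_left _ _)).sub ((HO_sub_trunc n0 a).mono (min_le_right _ _))

lemma HO_mul_sub {n : ℕ} {a b P Q : PS d k} (h : HO n (a - P)) (h' : HO n (b - Q)) :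
    HO n (a * b - P * Q) := by
  have : a * b - P * Q = (a - P) * b + P * (b - Q) := by ring
  rw [this]
  exact (h.mul_right b).add (h'.mul_left P)

lemma HO_pow_sub {n : ℕ} {a P : PS d k} (h : HO n (a - P)) (q : ℕ) : HO n (a ^ q - P ^ q) := by
  obtain ⟨c, hc⟩ := sub_dvd_pow_sub_pow a P q
  rw [hc]; exact h.mul_right c

@[reducible] noncomputable def psModule : Module (PS d k) M where
  smul := psSmul ψ hT
  one_smul z := by
    obtain ⟨n, hn⟩ := hT z
    refine (psSmul_eq ψ hT hn 1 ?_).trans (by simp)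
    rw [MvPolynomial.coe_one, sub_self, HO_iff]; simp
  mul_smul a b z := by
    obtain ⟨n, hn⟩ := hT z
    have hb := psSmul_eq ψ hT hn (truncTotal n b) (HO_sub_trunc n b)
    have ha := psSmul_eq ψ hT (hn.smul (ψ (truncTotal n b))) (truncTotal n a) (HO_sub_trunc n a)
    have hab := psSmul_eq ψ hT hn (truncTotal n a * truncTotal n b) (a := a * b) (by
      rw [MvPolynomial.coe_mul]
      exact HO_mul_sub (HO_sub_trunc n a) (HO_sub_trunc n b))
    change psSmul ψ hT (a * b) z = psSmul ψ hT a (psSmul ψ hT b z)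
    rw [hb, ha, hab, map_mul, mul_smul]
  smul_zero a := smul_zero _
  smul_add a z z' := by
    obtain ⟨n, hn⟩ := hT z
    obtain ⟨n', hn'⟩ := hT z'
    have h1 := hn.mono (show n ≤ n + n' by omega)
    have h2 := hn'.mono (show n' ≤ n + n' by omega)
    change psSmul ψ hT a (z + z') = psSmul ψ hT a z + psSmul ψ hT a z'
    rw [psSmul_eq ψ hT h1 _ (HO_sub_trunc _ a), psSmul_eq ψ hT h2 _ (HO_sub_trunc _ a),
      psSmul_eq ψ hT (h1.add h2) _ (HO_sub_trunc _ a), smul_add]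
  add_smul a b z := by
    obtain ⟨n, hn⟩ := hT z
    change psSmul ψ hT (a + b) z = psSmul ψ hT a z + psSmul ψ hT b z
    rw [psSmul_eq ψ hT hn _ (HO_sub_trunc _ a), psSmul_eq ψ hT hn _ (HO_sub_trunc _ b),
      psSmul_eq ψ hT hn _ (HO_sub_trunc _ (a + b)), map_add, map_add, add_smul]
  zero_smul z := by
    change psSmul ψ hT 0 z = 0
    simp [psSmul]

end psmod

lemma ps_tors {d : ℕ} {k : Type} [Field k] {B M : Type} [CommRing B] [AddCommGroup M] [Module B M]
    (ψ : MvPolynomial (Fin d) k →+* B) (hT : ∀ z : M, ∃ n, PValid ψ n z) :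
    @Tors d k _ M _ (psModule ψ hT) := by
  intro z
  obtain ⟨n, hn⟩ := hT z
  refine ⟨n, fun a ha => (psSmul_eq ψ hT hn 0 (by simpa using ha)).trans (by simp)⟩

lemma ps_semilinear {d : ℕ} {k : Type} [Field k] {B M : Type} [CommRing B] [AddCommGroup M] [Module B M]
    (ψ : MvPolynomial (Fin d) k →+* B) (hT : ∀ z : M, ∃ n, PValid ψ n z) (p : ℕ)
    (φ : M →+ M) (hφ : ∀ (b : B) z, φ (b • z) = b ^ p • φ z) (a : PS d k) (z : M) :
    φ (psSmul ψ hT a z) = psSmul ψ hT (a ^ p) (φ z) := by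
  obtain ⟨n, hn⟩ := hT z
  obtain ⟨n', hn'⟩ := hT (φ z)
  have h1 := hn.mono (show n ≤ n + n' by omega)
  have h2 := hn'.mono (show n' ≤ n + n' by omega)
  rw [psSmul_eq ψ hT h1 _ (HO_sub_trunc _ a), hφ, ← map_pow, psSmul_eq ψ hT h2 _ ?_]
  rw [MvPolynomial.coe_pow]
  exact HO_pow_sub (HO_sub_trunc _ a) p

section list
variable {S : Type} [CommRing S]

theorem isArtinian_of_list (l : List S) : ∀ {M : Type} [AddCommGroup M] [Module S M],
    (∀ x ∈ l, ∀ z : M, ∃ n : ℕ, x ^ n • z = 0) →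
    IsArtinian S (Submodule.torsionBySet S M {x | x ∈ l}) → IsArtinian S M := by
  induction l with
  | nil =>
    intro M _ _ _ h
    let f : M →ₗ[S] Submodule.torsionBySet S M {x | x ∈ ([] : List S)} :=
      LinearMap.codRestrict _ LinearMap.id (fun z => by simp [Submodule.mem_torsionBySet_iff])
    exact isArtinian_of_injective f (fun a b hab => congrArg Subtype.val hab)
  | cons x l ih =>
    intro M _ _ ht h
    have : IsArtinian S (Submodule.torsionBy S M x) := by
      apply ih
      · intro y hy z
        obtain ⟨n, hn⟩ := ht y (by simp [hy]) (z : M)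
        exact ⟨n, Subtype.ext hn⟩
      · let f : Submodule.torsionBySet S (Submodule.torsionBy S M x) {x | x ∈ l} →ₗ[S]
            Submodule.torsionBySet S M {y | y ∈ x :: l} :=
          LinearMap.codRestrict _ ((Submodule.torsionBy S M x).subtype ∘ₗ Submodule.subtype _)
            (fun z => by
              rw [Submodule.mem_torsionBySet_iff]
              rintro ⟨y, hy⟩
              simp only [Set.mem_ofPred_eq, List.mem_cons] at hy
              rcases hy with rfl | hy
              · exact z.1.2
              · exact congrArg Subtype.val
                  ((Submodule.mem_torsionBySet_iff _ _).1 z.2 ⟨y, hy⟩))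
        refine isArtinian_of_injective f (fun a b hab => ?_)
        have h3 : ((f a : Submodule.torsionBySet S M {y | y ∈ x :: l}) : M) = f b :=
          congrArg Subtype.val hab
        exact Subtype.ext (Subtype.ext h3)
    exact isArtinian_of_torsionBy x (ht x (by simp))

end list

lemma exists_weight (n : ℕ) : ∀ S : Set (Fin (n + 1) → ℕ), S.Nonempty →
    ∃ w : Fin (n + 1) → ℕ, w (Fin.last n) = 1 ∧ (∀ i, 1 ≤ w i) ∧ ∃ α ∈ S, ∀ β ∈ S, β ≠ α →
      ∑ i, w i * α i < ∑ i, w i * β i := by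
  induction n with
  | zero =>
    intro S hS
    obtain ⟨α, hα, hmin⟩ := WellFounded.has_min (measure fun f : Fin 1 → ℕ => f 0).wf S hS
    refine ⟨fun _ => 1, rfl, fun _ => le_rfl, α, hα, fun β hβ hne => ?_⟩
    have h1 : ¬ (β 0 < α 0) := hmin β hβ
    have h2 : β 0 ≠ α 0 := by
      intro h; apply hne; funext i; rw [show i = 0 from Fin.fin_one_eq_zero i, h]
    simp; omega
  | succ n ih =>
    intro S hS
    obtain ⟨γ, hγ, hmin⟩ := WellFounded.has_min (measure fun f : Fin (n + 2) → ℕ => f 0).wf S hS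
    obtain ⟨w, hw1, hw, α, hα, hlt⟩ := ih {t | Fin.cons (γ 0) t ∈ S}
      ⟨Fin.tail γ, by
        change Fin.cons (γ 0) (Fin.tail γ) ∈ S
        rw [Fin.cons_self_tail]; exact hγ⟩
    refine ⟨Fin.cons (∑ i, w i * α i + 1) w, ?_, ?_, Fin.cons (γ 0) α, hα, fun β hβ hne => ?_⟩
    · rw [← Fin.succ_last, Fin.cons_succ]; exact hw1
    · intro i
      refine Fin.cases ?_ (fun j => ?_) i
      · simp
      · simpa using hw j
    · have e1 : ∀ β : Fin (n + 2) → ℕ, ∑ i, (Fin.cons (∑ i, w i * α i + 1) w : Fin (n + 2) → ℕ) i * β i =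
          (∑ i, w i * α i + 1) * β 0 + ∑ i, w i * Fin.tail β i := fun β => by
        rw [Fin.sum_univ_succ]; rfl
      rw [e1, e1, Fin.tail_cons, Fin.cons_zero]
      have h1 : ¬ (β 0 < γ 0) := hmin β hβ
      by_cases h2 : β 0 = γ 0
      · have hb : Fin.cons (γ 0) (Fin.tail β) = β := by rw [← h2, Fin.cons_self_tail]
        have := hlt (Fin.tail β) (by
          change Fin.cons (γ 0) (Fin.tail β) ∈ S
          rw [hb]; exact hβ) (by
          rintro h; apply hne; rw [← h, hb])
        rw [h2]
        omega
      · have h3 : γ 0 + 1 ≤ β 0 := by omega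
        have h4 := Nat.mul_le_mul_left (∑ i, w i * α i + 1) h3
        rw [Nat.mul_add] at h4
        omega

end FPerf

namespace FPerf
open MvPowerSeries

section
variable {d : ℕ} {k : Type} [Field k]

lemma HO_prod {ι : Type} (s : Finset ι) (f : ι → PS d k) (m : ι → ℕ) (h : ∀ i ∈ s, HO (m i) (f i)) :
    HO (∑ i ∈ s, m i) (∏ i ∈ s, f i) := by
  classical
  induction s using Finset.induction_on with
  | empty => simpa using HO_zero _
  | insert a s ha ih =>
    rw [Finset.sum_insert ha, Finset.prod_insert ha]
    exact (h a (by simp)).mul (ih fun i hi => h i (by simp [hi]))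

lemma monomial_eq_prod (α : Fin d →₀ ℕ) (s : k) :
    (monomial α s : PS d k) = C s * ∏ i, X i ^ α i := by
  rw [MvPowerSeries.monomial_eq', Finsupp.prod_fintype _ _ (by simp)]

lemma HO_aeval {d' : ℕ} (y : Fin d' → PS d k) (hy : ∀ i, HO 1 (y i)) {n : ℕ}
    (P : MvPolynomial (Fin d') k) (hP : HO n (P : PS d' k)) : HO n (MvPolynomial.aeval y P) := by
  rw [HO_iff] at hP
  rw [P.as_sum, map_sum]
  refine Finset.sum_induction _ (HO n) (fun a b => HO.add) ?_ ?_
  · rw [HO_iff]; simp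
  · intro α hα
    have h1 : n ≤ α.degree := by
      by_contra h
      have := hP α (by omega)
      rw [MvPolynomial.coeff_coe] at this
      exact (MvPolynomial.mem_support_iff.1 hα) this
    rw [MvPolynomial.aeval_monomial]
    apply HO.mul_left
    rw [Finsupp.prod_fintype _ _ (by simp)]
    refine HO.mono h1 ?_
    rw [Finsupp.degree_eq_sum]
    refine HO_prod _ _ _ fun i _ => ?_
    simpa using (hy i).pow (α i)

variable {M : Type} [AddCommGroup M] [Module (PS d k) M]

lemma smul_eq_const (hT : Tors d k M) (z : M) (hz : ∀ i, (X i : PS d k) • z = 0) (a : PS d k) :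
    a • z = (C (coeff 0 a) : PS d k) • z := by
  obtain ⟨n, hn⟩ := hT z
  induction a using HO_induction (n + 1) with
  | hm α s =>
    by_cases hα : α = 0
    · subst hα
      rw [coeff_monomial_same, monomial_zero_eq_C_apply]
    · obtain ⟨i, hi⟩ : ∃ i, α i ≠ 0 := by
        by_contra! h; exact hα (Finsupp.ext h)
      rw [coeff_monomial_ne (Ne.symm hα), map_zero, zero_smul]
      have : (monomial α s : PS d k) = monomial (α - Finsupp.single i 1) s * X i := by
        rw [X_def, monomial_mul_monomial, mul_one, tsub_add_cancel_of_le]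
        rw [Finsupp.single_le_iff]; omega
      rw [this, mul_smul, hz, smul_zero]
  | hadd a b ha hb => rw [add_smul, ha, hb, map_add, map_add, add_smul]
  | hHO a ha =>
    rw [hn a (ha.mono (by omega)), HO_iff.1 ha 0 (by simp), map_zero, zero_smul]

lemma smul_monomial_V (T : PS d k) (w : Fin d → ℕ) (z : M) (hz : ∀ i, (X i : PS d k) • z = T ^ w i • z)
    (α : Fin d →₀ ℕ) (s : k) :
    (monomial α s : PS d k) • z = (C s * T ^ ∑ i, w i * α i : PS d k) • z := by
  classical
  rw [monomial_eq_prod, mul_smul, mul_smul]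
  congr 1
  have hpow : ∀ i (m : ℕ), (X i ^ m : PS d k) • z = T ^ (w i * m) • z := by
    intro i m
    induction m with
    | zero => simp
    | succ m ih => rw [pow_succ, mul_smul, hz, smul_comm, ih, smul_smul, ← pow_add, mul_add, mul_one,
        add_comm]
  have : ∀ s : Finset (Fin d), (∏ i ∈ s, X i ^ α i : PS d k) • z = T ^ (∑ i ∈ s, w i * α i) • z := by
    intro s
    induction s using Finset.induction_on with
    | empty => simp
    | insert a s ha ih =>
      rw [Finset.prod_insert ha, Finset.sum_insert ha, mul_smul, ih, smul_comm, hpow, smul_smul,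
        ← pow_add, add_comm]
  exact this _

lemma kill_V (hT : Tors d k M) (T : PS d k) (hTo : HO 1 T) (w : Fin d → ℕ) (c : PS d k) (α : Fin d →₀ ℕ)
    (hα : coeff α c ≠ 0)
    (hmin : ∀ β, coeff β c ≠ 0 → β ≠ α → ∑ i, w i * α i < ∑ i, w i * β i)
    (z : M) (hz : ∀ i, (X i : PS d k) • z = T ^ w i • z) (hcz : c • z = 0) :
    T ^ (∑ i, w i * α i) • z = 0 := by
  classical
  obtain ⟨n, hn⟩ := hT z
  set e := ∑ i, w i * α i with he
  have hex : ∃ m, T ^ m • z = 0 := ⟨n, hn _ (by simpa using hTo.pow n)⟩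
  set m := Nat.find hex with hm
  have hmz : T ^ m • z = 0 := Nat.find_spec hex
  have hbig : ∀ j, m ≤ j → T ^ j • z = 0 := by
    intro j hj
    rw [← Nat.sub_add_cancel hj, pow_add, mul_smul, hmz, smul_zero]
  by_contra hne
  have hlt : e < m := by
    by_contra h
    exact hne (hbig e (by omega))
  have hterm : ∀ β s, T ^ (m - 1 - e) • (monomial β s : PS d k) • z =
      (C s : PS d k) • T ^ (m - 1 - e + ∑ i, w i * β i) • z := by
    intro β s
    rw [smul_monomial_V T w z hz, mul_smul, smul_comm, pow_add, mul_smul]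
  set c' : PS d k := c - monomial α (coeff α c) with hc'
  have h1 : T ^ (m - 1 - e) • c' • z = 0 := by
    have h2 : c' • z = ((truncTotal n c').toMvPowerSeries : PS d k) • z := by
      rw [← sub_eq_zero, ← sub_smul]
      exact hn _ (HO_sub_trunc n c')
    rw [h2, (truncTotal n c').as_sum]
    have h3 : ((∑ v ∈ (truncTotal n c').support, MvPolynomial.monomial v (MvPolynomial.coeff v (truncTotal n c')) :
        MvPolynomial (Fin d) k) : PS d k) = ∑ v ∈ (truncTotal n c').support,
          monomial v (MvPolynomial.coeff v (truncTotal n c')) := by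
      have := map_sum (MvPolynomial.coeToMvPowerSeries.ringHom (R := k) (σ := Fin d))
        (fun v => MvPolynomial.monomial v (MvPolynomial.coeff v (truncTotal n c')))
        (truncTotal n c').support
      simpa using this
    rw [h3, Finset.sum_smul, Finset.smul_sum]
    refine Finset.sum_eq_zero fun β hβ => ?_
    rw [hterm, hbig, smul_zero]
    have hβ' : coeff β c' ≠ 0 := by
      intro h0
      rw [MvPolynomial.mem_support_iff, coeff_truncTotal_eq_ite, h0] at hβ
      simp at hβ
    have hβα : β ≠ α := by
      rintro rfl
      apply hβ'
      rw [hc', map_sub, coeff_monomial_same, sub_self]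
    have : coeff β c ≠ 0 := by
      rwa [hc', map_sub, coeff_monomial_ne hβα, sub_zero] at hβ'
    have := hmin β this hβα
    omega
  have h4 : T ^ (m - 1 - e) • (monomial α (coeff α c) : PS d k) • z = 0 := by
    have : c • z = c' • z + (monomial α (coeff α c) : PS d k) • z := by
      rw [← add_smul, hc', sub_add_cancel]
    rw [hcz] at this
    rw [eq_neg_of_add_eq_zero_right this.symm, smul_neg, h1, neg_zero]
  rw [hterm, ← he, show m - 1 - e + e = m - 1 by omega] at h4
  have h5 : T ^ (m - 1) • z = 0 := by
    have : (C (coeff α c)⁻¹ : PS d k) • (C (coeff α c) : PS d k) • T ^ (m - 1) • z = T ^ (m - 1) • z := by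
      rw [smul_smul, ← map_mul, inv_mul_cancel₀ hα, map_one, one_smul]
    rw [← this, h4, smul_zero]
  exact Nat.find_min hex (show m - 1 < Nat.find hex by omega) h5

end

lemma torsCase_zero (p : ℕ) (k : Type) [Field k] : TorsCase p 0 k := by
  intro M _ _ _ hT c hc hcM Φ N _
  have hs : ∀ z : M, z = 0 := by
    intro z
    obtain ⟨α, hα⟩ := (ne_zero_iff_exists_coeff_ne_zero c).1 hc
    rw [Subsingleton.elim α 0] at hα
    have h1 := smul_eq_const hT z (fun i => i.elim0) c
    rw [hcM] at h1
    have : (C (coeff 0 c)⁻¹ : PS 0 k) • (C (coeff 0 c) : PS 0 k) • z = z := by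
      rw [smul_smul, ← map_mul, inv_mul_cancel₀ hα, map_one, one_smul]
    rw [← this, ← h1, smul_zero]
  refine ⟨0, fun m _ => ?_⟩
  ext z
  simp [hs z]

lemma art_aux {d : ℕ} {k : Type} [Field k] {M : Type} [AddCommGroup M] [Module (PS (d + 1) k) M]
    [Module (PS d k) M] [IsArtinian (PS (d + 1) k) M] (hT : Tors (d + 1) k M) (hT' : Tors d k M)
    (c : PS (d + 1) k) (hcM : ∀ z : M, c • z = 0) (w : Fin (d + 1) → ℕ)
    (hw1 : w (Fin.last d) = 1) (hw : ∀ i, 1 ≤ w i) (α : Fin (d + 1) →₀ ℕ) (hα : coeff α c ≠ 0)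
    (hmin' : ∀ β, coeff β c ≠ 0 → β ≠ α → ∑ i, w i * α i < ∑ i, w i * β i)
    (T : PS (d + 1) k) (hTX : T = X (Fin.last d)) (hTo : HO 1 T) (y : Fin d → PS (d + 1) k)
    (hy : ∀ i, y i = X i.castSucc - T ^ w i.castSucc)
    (hsm : ∀ (a : PS d k) (z : M), ∃ b : PS (d + 1) k, a • z = b • z)
    (hX : ∀ i (z : M), (X i : PS d k) • z = y i • z)
    (hCs : ∀ s (z : M), (C s : PS d k) • z = (C s : PS (d + 1) k) • z)
    (hcomm : ∀ (a : PS d k) (b : PS (d + 1) k) (z : M), a • b • z = b • a • z) :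
    IsArtinian (PS d k) M := by
  let V : ℕ → Submodule (PS d k) M := fun m =>
    { carrier := {z | (∀ i, y i • z = 0) ∧ T ^ m • z = 0}
      add_mem' := by
        rintro a b ⟨h1, h2⟩ ⟨h3, h4⟩
        exact ⟨fun i => by rw [smul_add, h1, h3, add_zero], by rw [smul_add, h2, h4, add_zero]⟩
      zero_mem' := ⟨fun i => smul_zero _, smul_zero _⟩
      smul_mem' := by
        rintro a z ⟨h1, h2⟩
        obtain ⟨b, hb⟩ := hsm a z
        rw [hb]
        exact ⟨fun i => by rw [smul_comm, h1, smul_zero], by rw [smul_comm, h2, smul_zero]⟩ }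
  have hV : ∀ m (z : M), z ∈ V m ↔ (∀ i, y i • z = 0) ∧ T ^ m • z = 0 := fun m z => Iff.rfl
  clear_value V
  have hVX : ∀ z : M, (∀ i, y i • z = 0) → ∀ i, (X i : PS (d + 1) k) • z = T ^ w i • z := by
    intro z hz i
    refine Fin.lastCases ?_ (fun j => ?_) i
    · rw [hw1, pow_one, hTX]
    · rw [← sub_eq_zero, ← sub_smul, ← hy]; exact hz j
  have hV1X : ∀ z : M, z ∈ V 1 → ∀ i, (X i : PS (d + 1) k) • z = 0 := by
    intro z hzz i
    obtain ⟨h1, h2⟩ := (hV 1 z).1 hzz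
    rw [pow_one] at h2
    rw [hVX z h1, ← Nat.sub_add_cancel (hw i), pow_add, pow_one, mul_smul, h2, smul_zero]
  have hV1 : IsArtinian (PS d k) (V 1) := by
    let f : Submodule (PS d k) (V 1) → Submodule (PS (d + 1) k) M := fun Q =>
      { carrier := {z | ∃ h : z ∈ V 1, (⟨z, h⟩ : V 1) ∈ Q}
        add_mem' := by
          rintro a b ⟨ha, ha'⟩ ⟨hb, hb'⟩
          exact ⟨(V 1).add_mem ha hb, Q.add_mem ha' hb'⟩
        zero_mem' := ⟨(V 1).zero_mem, Q.zero_mem⟩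
        smul_mem' := by
          rintro a z ⟨h, h'⟩
          have := smul_eq_const hT z (hV1X z h) a
          rw [← hCs] at this
          rw [this]
          exact ⟨(V 1).smul_mem _ h, Q.smul_mem _ h'⟩ }
    have hf : StrictMono f := by
      intro Q Q' hlt
      rw [SetLike.lt_iff_le_and_exists] at hlt ⊢
      obtain ⟨hle, ⟨z, hz⟩, h1, h2⟩ := hlt
      refine ⟨?_, z, ⟨hz, h1⟩, ?_⟩
      · rintro x ⟨h, h'⟩
        exact ⟨h, hle h'⟩
      · rintro ⟨_, h'⟩
        exact h2 h'
    have := hf.wellFoundedLT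
    exact this
  have hVA : ∀ m, IsArtinian (PS d k) (V m) := by
    intro m
    induction m with
    | zero =>
      have : Subsingleton (V 0) := by
        refine ⟨fun a b => Subtype.ext ?_⟩
        have h1 := ((hV 0 _).1 a.2).2
        have h2 := ((hV 0 _).1 b.2).2
        rw [pow_zero, one_smul] at h1 h2
        rw [h1, h2]
      infer_instance
    | succ m ih =>
      have hle : V m ≤ V (m + 1) := fun z hz => (hV _ _).2
        ⟨((hV _ _).1 hz).1, by rw [pow_succ', mul_smul, ((hV _ _).1 hz).2, smul_zero]⟩
      let g : V (m + 1) →ₗ[PS d k] V 1 :=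
        { toFun := fun z => ⟨T ^ m • (z : M), (hV _ _).2
            ⟨fun i => by rw [smul_comm, ((hV _ _).1 z.2).1, smul_zero], by
              rw [smul_smul, pow_one, ← pow_succ']; exact ((hV _ _).1 z.2).2⟩⟩
          map_add' := fun a b => Subtype.ext (smul_add _ _ _)
          map_smul' := fun a z => Subtype.ext (hcomm a _ _).symm }
      refine isArtinian_of_range_eq_ker (Submodule.inclusion hle) g ?_
      ext z
      rw [LinearMap.mem_range, LinearMap.mem_ker]
      constructor
      · rintro ⟨x, rfl⟩
        exact Subtype.ext ((hV _ _).1 x.2).2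
      · intro h
        have h2 : T ^ m • (z : M) = 0 := congrArg Subtype.val h
        exact ⟨⟨z, (hV _ _).2 ⟨((hV _ _).1 z.2).1, h2⟩⟩, rfl⟩
  apply isArtinian_of_list (List.ofFn fun i : Fin d => (X i : PS d k))
  · intro x hx z
    obtain ⟨i, rfl⟩ := List.mem_ofFn.1 hx
    obtain ⟨n, hn⟩ := hT' z
    exact ⟨n, hn _ (by simpa using (show HO 1 (X i : PS d k) from HO_monomial (by simp) 1).pow n)⟩
  · have := hVA (∑ i, w i * α i)
    have hle : Submodule.torsionBySet (PS d k) M {x | x ∈ List.ofFn fun i : Fin d => (X i : PS d k)} ≤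
        V (∑ i, w i * α i) := by
      intro z hz
      rw [Submodule.mem_torsionBySet_iff] at hz
      have h1 : ∀ i, y i • z = 0 := by
        intro i
        rw [← hX]
        exact hz ⟨X i, List.mem_ofFn.2 ⟨i, rfl⟩⟩
      exact (hV _ _).2 ⟨h1, kill_V hT T (hTo) w c α hα hmin' z (hVX z h1) (hcM z)⟩
    exact isArtinian_of_injective (Submodule.inclusion hle) (Submodule.inclusion_injective hle)

theorem torsCase_succ (p d : ℕ) (k : Type) [Field k] (hC : Core p d k) : TorsCase p (d + 1) k := by
  intro M _ _ _ hT c hc hcM Φ N hN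
  obtain ⟨w, hw1, hw, α', ⟨α, hα, rfl⟩, hmin⟩ := exists_weight d
    ((fun α : Fin (d + 1) →₀ ℕ => (α : Fin (d + 1) → ℕ)) '' {α | coeff α c ≠ 0}) (by
      obtain ⟨α, hα⟩ := (ne_zero_iff_exists_coeff_ne_zero c).1 hc
      exact ⟨_, α, hα, rfl⟩)
  have hmin' : ∀ β, coeff β c ≠ 0 → β ≠ α → ∑ i, w i * α i < ∑ i, w i * β i := fun β hβ hne =>
    hmin β ⟨β, hβ, rfl⟩ fun h => hne (DFunLike.coe_injective h)
  set T : PS (d + 1) k := X (Fin.last d) with hTdef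
  have hTo : ∀ i, HO 1 (X i : PS (d + 1) k) := fun i => HO_monomial (by simp) 1
  set y : Fin d → PS (d + 1) k := fun i => X i.castSucc - T ^ w i.castSucc with hy
  have hyo : ∀ i, HO 1 (y i) := fun i => (hTo _).sub
    (((hTo (Fin.last d)).pow (w i.castSucc)).mono (by have := hw i.castSucc; omega))
  set ψ : MvPolynomial (Fin d) k →+* PS (d + 1) k := (MvPolynomial.aeval y).toRingHom with hψ
  have hψy : ∀ i, ψ (MvPolynomial.X i) = y i := fun i => MvPolynomial.aeval_X y i
  have hψC : ∀ s, ψ (MvPolynomial.C s) = C s := fun s => MvPolynomial.aeval_C y s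
  have hPT : ∀ z : M, ∃ n, PValid ψ n z := by
    intro z
    obtain ⟨n, hn⟩ := hT z
    exact ⟨n, fun P hP => hn _ (HO_aeval y hyo P hP)⟩
  letI inst : Module (PS d k) M := psModule ψ hPT
  have hsm : ∀ (a : PS d k) (z : M), ∃ b : PS (d + 1) k, a • z = b • z := fun a z => ⟨_, rfl⟩
  have hpoly : ∀ (P : MvPolynomial (Fin d) k) (z : M), (P : PS d k) • z = ψ P • z := by
    intro P z
    obtain ⟨n, hn⟩ := hPT z
    exact psSmul_eq ψ hPT hn P (by rw [sub_self, HO_iff]; simp)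
  have hX : ∀ i (z : M), (X i : PS d k) • z = y i • z := by
    intro i z; rw [← hψy, ← hpoly, MvPolynomial.coe_X]
  have hCs : ∀ s (z : M), (C s : PS d k) • z = (C s : PS (d + 1) k) • z := by
    intro i z; rw [← hψC, ← hpoly, MvPolynomial.coe_C]
  have hT' : Tors d k M := ps_tors ψ hPT
  -- mult by elements is linear
  have hcomm : ∀ (a : PS d k) (b : PS (d + 1) k) (z : M), a • b • z = b • a • z := by
    intro a b z
    obtain ⟨n, hn⟩ := hPT z
    have h1 : a • z = _ := psSmul_eq ψ hPT hn _ (HO_sub_trunc n a)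
    have h2 : a • b • z = _ := psSmul_eq ψ hPT (hn.smul b) _ (HO_sub_trunc n a)
    rw [h1, h2, smul_comm]
  let res : Submodule (PS (d + 1) k) M → Submodule (PS d k) M := fun Q =>
    { carrier := Q, add_mem' := Q.add_mem, zero_mem' := Q.zero_mem
      smul_mem' := fun a z hz => by
        obtain ⟨b, hb⟩ := hsm a z
        rw [hb]; exact Q.smul_mem b hz }
  have hres : ∀ Q z, z ∈ res Q ↔ z ∈ Q := fun Q z => Iff.rfl
  have hArt : IsArtinian (PS d k) M :=
    art_aux hT hT' c hcM w hw1 hw α hα hmin' T rfl (hTo _) y (fun _ => rfl) hsm hX hCs hcomm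
  let Φ' : FrobMod p (PS d k) M :=
    { φ := Φ.φ
      semilinear := ps_semilinear ψ hPT p Φ.φ Φ.semilinear }
  obtain ⟨n, hn⟩ := hC M hT' Φ' ⟨fun i => res (N i), fun a b hab => N.2 hab⟩ (fun i z => hN i z)
  refine ⟨n, fun m hm => ?_⟩
  have : res (N n) = res (N m) := hn m hm
  ext z
  rw [← hres, this, hres]

theorem core (p d : ℕ) [hp : Fact p.Prime] (k : Type) [Field k] [CharP k p] : Core p d k := by
  induction d with
  | zero => exact core_of_torsCase (torsCase_zero p k)
  | succ d ih => exact core_of_torsCase (torsCase_succ p d k ih)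

end FPerf

namespace FPerf
open MvPolynomial

lemma cotangent_repr {R A : Type} [CommRing R] [CommRing A] [Algebra R A]
    (x : (Algebra.Generators.self R A).toExtension.ker) (i : A) :
    (Algebra.Generators.self R A).cotangentSpaceBasis.repr
      ((Algebra.Generators.self R A).toExtension.cotangentComplex (.mk x)) i =
      aeval (id : A → A) (pderiv i (x.1 : MvPolynomial A R)) := by
  rw [Algebra.Extension.cotangentComplex_mk]
  exact Algebra.Generators.cotangentSpaceBasis_repr_one_tmul (Algebra.Generators.self R A) x.1 i

lemma h1_iff (R A : Type) [CommRing R] [CommRing A] [Algebra R A] :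
    Subsingleton (Algebra.H1Cotangent R A) ↔
    ∀ f : MvPolynomial A R, aeval (id : A → A) f = 0 →
      (∀ i, aeval (id : A → A) (pderiv i f) = 0) →
      f ∈ (RingHom.ker (aeval (R := R) (id : A → A))) ^ 2 := by
  have : Algebra.FormallySmooth R (Algebra.Generators.self R A).toExtension.Ring :=
    inferInstanceAs (Algebra.FormallySmooth R (MvPolynomial A R))
  rw [← Algebra.Extension.cotangentComplex_injective_iff
    (Algebra.Generators.self R A).toExtension, injective_iff_map_eq_zero]
  constructor
  · intro h f hf hd
    have h1 := h (.mk ⟨f, hf⟩) ?_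
    · exact (Algebra.Extension.Cotangent.mk_eq_zero_iff _).1 h1
    · apply (Algebra.Generators.self R A).cotangentSpaceBasis.repr.injective
      ext i
      rw [cotangent_repr, map_zero]
      exact hd i
  · intro h x hx
    obtain ⟨y, rfl⟩ := Algebra.Extension.Cotangent.mk_surjective x
    rw [Algebra.Extension.Cotangent.mk_eq_zero_iff]
    refine h y.1 y.2 fun i => ?_
    rw [← cotangent_repr, hx, map_zero]; rfl

lemma formallySmooth_field (p : ℕ) [Fact p.Prime] (k : Type) [Field k] [Algebra (ZMod p) k] :
    Algebra.FormallySmooth (ZMod p) k := by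
  have h1 : Subsingleton (Algebra.H1Cotangent (ZMod p) k) := by
    rw [h1_iff]
    intro f hf hd
    let L := IntermediateField.adjoin (ZMod p) (f.vars : Set k)
    have hL : Algebra.EssFiniteType (ZMod p) L :=
      IntermediateField.essFiniteType_iff.2 (IntermediateField.fg_adjoin_finset f.vars)
    have hS : Algebra.FormallySmooth (ZMod p) L := inferInstance
    have h2 := (h1_iff (ZMod p) L).1 hS.subsingleton_h1Cotangent
    have hinj : Function.Injective (Subtype.val : L → k) := Subtype.val_injective
    obtain ⟨q, hq⟩ := exists_rename_eq_of_vars_subset_range f (Subtype.val : L → k) hinj (by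
      intro x hx
      exact ⟨⟨x, IntermediateField.subset_adjoin _ _ hx⟩, rfl⟩)
    have key : ∀ g : MvPolynomial L (ZMod p), aeval (id : k → k) (rename (Subtype.val : L → k) g) =
        L.val (aeval (id : L → L) g) := by
      intro g
      rw [aeval_rename, ← AlgHom.comp_apply, MvPolynomial.comp_aeval]
      rfl
    have h3 := h2 q (hinj (by rw [← hq, key] at hf; exact hf)) (fun i => hinj (by
      have := hd i
      rw [← hq, pderiv_rename hinj, key] at this
      exact this))
    have h4 : RingHom.ker (aeval (R := ZMod p) (id : L → L)) ≤
        (RingHom.ker (aeval (R := ZMod p) (id : k → k))).comap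
          (rename (R := ZMod p) (Subtype.val : L → k)) := by
      intro g hg
      rw [Ideal.mem_comap, RingHom.mem_ker, key, (RingHom.mem_ker).1 hg, map_zero]
    rw [← hq]
    exact Ideal.le_comap_pow _ 2 (Ideal.pow_right_mono h4 2 h3)
  exact ⟨inferInstance, h1⟩

end FPerf

namespace FPerf

lemma exists_pow_smul_eq_zero {R M : Type} [CommRing R] [IsLocalRing R]
    [IsNoetherianRing R] [AddCommGroup M] [Module R M] [IsArtinian R M] (z : M) :
    ∃ n, ∀ r ∈ IsLocalRing.maximalIdeal R ^ n, r • z = 0 := by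
  let I := IsLocalRing.maximalIdeal R
  let f : ℕ →o (Submodule R M)ᵒᵈ :=
    ⟨fun n => OrderDual.toDual (I ^ n • (Submodule.span R {z})), fun a b hab =>
      OrderDual.toDual_le_toDual.2 (Submodule.smul_mono_left (Ideal.pow_le_pow_right hab))⟩
  obtain ⟨n, hn⟩ := IsArtinian.monotone_stabilizes f
  have h1 : I ^ n • (Submodule.span R {z}) = I ^ (n + 1) • (Submodule.span R {z}) :=
    hn (n + 1) (Nat.le_succ n)
  have h2 : I ^ n • (Submodule.span R {z}) = ⊥ := by
    apply Submodule.eq_bot_of_le_smul_of_le_jacobson_bot I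
    · exact (Submodule.fg_span_singleton z).smul (IsNoetherian.noetherian (I ^ n))
    · rw [← Submodule.mul_smul, ← pow_succ', ← h1]
    · rw [IsLocalRing.jacobson_eq_maximalIdeal ⊥ bot_ne_top]
  refine ⟨n, fun r hr => ?_⟩
  rw [← Submodule.mem_bot R, ← h2]
  exact Submodule.smul_mem_smul hr (Submodule.mem_span_singleton_self z)

section ac
variable {R : Type} [CommRing R] (I : Ideal R)

def Appr (n : ℕ) (a : AdicCompletion I R) (r : R) : Prop :=
  AdicCompletion.evalₐ I n a = Ideal.Quotient.mk (I ^ n) r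

variable {I}

lemma appr_exists (n : ℕ) (a : AdicCompletion I R) : ∃ r, Appr I n a r :=
  (Ideal.Quotient.mk_surjective (AdicCompletion.evalₐ I n a)).imp fun _ h => h.symm

lemma Appr.mono {m n : ℕ} (h : m ≤ n) {a : AdicCompletion I R} {r : R} (hr : Appr I n a r) :
    Appr I m a r := by
  induction a using AdicCompletion.induction_on with
  | h f =>
    unfold Appr at *
    rw [AdicCompletion.evalₐ_mk] at *
    rw [← AdicCompletion.Ideal.mk_eq_mk I h]
    rw [Ideal.Quotient.eq] at *
    exact Ideal.pow_le_pow_right h hr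

lemma Appr.sub_mem {n : ℕ} {a : AdicCompletion I R} {r s : R} (h : Appr I n a r)
    (h' : Appr I n a s) : r - s ∈ I ^ n := by
  rw [← Ideal.Quotient.eq]; exact h.symm.trans h'

lemma Appr.of_sub_mem {n : ℕ} {a : AdicCompletion I R} {r s : R} (h : Appr I n a r)
    (h' : r - s ∈ I ^ n) : Appr I n a s := by
  rw [← Ideal.Quotient.eq] at h'; exact h.trans h'

lemma Appr.add {n : ℕ} {a b : AdicCompletion I R} {r s : R} (h : Appr I n a r)
    (h' : Appr I n b s) : Appr I n (a + b) (r + s) := by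
  unfold Appr at *; rw [map_add, map_add, h, h']

lemma Appr.mul {n : ℕ} {a b : AdicCompletion I R} {r s : R} (h : Appr I n a r)
    (h' : Appr I n b s) : Appr I n (a * b) (r * s) := by
  unfold Appr at *; rw [map_mul, map_mul, h, h']

lemma Appr.pow {n : ℕ} {a : AdicCompletion I R} {r : R} (h : Appr I n a r) (q : ℕ) :
    Appr I n (a ^ q) (r ^ q) := by
  unfold Appr at *; rw [map_pow, map_pow, h]

lemma appr_algebraMap (n : ℕ) (r : R) : Appr I n (algebraMap R (AdicCompletion I R) r) r := by
  unfold Appr; rw [AlgHom.commutes]; rfl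

lemma appr_sum {ι : Type} (s : Finset ι) {n : ℕ} {a : ι → AdicCompletion I R} {r : ι → R}
    (h : ∀ i, Appr I n (a i) (r i)) : Appr I n (∑ i ∈ s, a i) (∑ i ∈ s, r i) := by
  unfold Appr at *; rw [map_sum, map_sum]; exact Finset.sum_congr rfl fun i _ => h i

variable {M : Type} [AddCommGroup M] [Module R M]

def Kills (I : Ideal R) (n : ℕ) (z : M) : Prop := ∀ r ∈ I ^ n, r • z = 0

lemma Kills.mono {m n : ℕ} (h : m ≤ n) {z : M} (hz : Kills I m z) : Kills I n z :=
  fun r hr => hz r (Ideal.pow_le_pow_right h hr)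

lemma Kills.smul {n : ℕ} {z : M} (hz : Kills I n z) (b : R) : Kills I n (b • z) := fun r hr => by
  rw [smul_comm, hz r hr, smul_zero]

lemma Kills.add {n : ℕ} {z z' : M} (hz : Kills I n z) (hz' : Kills I n z') : Kills I n (z + z') :=
  fun r hr => by rw [smul_add, hz r hr, hz' r hr, add_zero]

variable (hT : ∀ z : M, ∃ n, Kills I n z)

noncomputable def acSmul (a : AdicCompletion I R) (z : M) : M :=
  (appr_exists (hT z).choose a).choose • z

lemma acSmul_eq {n : ℕ} {z : M} (hn : Kills I n z) {a : AdicCompletion I R} {r : R}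
    (h : Appr I n a r) : acSmul hT a z = r • z := by
  have h0 := (hT z).choose_spec
  unfold acSmul
  set n0 := (hT z).choose
  have h1 := (appr_exists n0 a).choose_spec
  set r0 := (appr_exists n0 a).choose
  rw [← sub_eq_zero, ← sub_smul]
  rcases le_total n n0 with hle | hle
  · exact hn _ ((h1.mono hle).sub_mem h)
  · exact h0 _ (h1.sub_mem (h.mono hle))

@[reducible] noncomputable def acModule : Module (AdicCompletion I R) M where
  smul := acSmul hT
  one_smul z := by
    obtain ⟨n, hn⟩ := hT z
    refine (acSmul_eq hT hn (r := 1) ?_).trans (one_smul _ _)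
    unfold Appr; rw [map_one, map_one]
  mul_smul a b z := by
    obtain ⟨n, hn⟩ := hT z
    obtain ⟨r, hr⟩ := appr_exists n a
    obtain ⟨s, hs⟩ := appr_exists n b
    change acSmul hT (a * b) z = acSmul hT a (acSmul hT b z)
    rw [acSmul_eq hT hn hs, acSmul_eq hT (hn.smul s) hr, acSmul_eq hT hn (hr.mul hs), mul_smul]
  smul_zero a := smul_zero _
  smul_add a z z' := by
    obtain ⟨n, hn⟩ := hT z
    obtain ⟨n', hn'⟩ := hT z'
    have h1 := hn.mono (show n ≤ n + n' by omega)
    have h2 := hn'.mono (show n' ≤ n + n' by omega)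
    obtain ⟨r, hr⟩ := appr_exists (n + n') a
    change acSmul hT a (z + z') = acSmul hT a z + acSmul hT a z'
    rw [acSmul_eq hT h1 hr, acSmul_eq hT h2 hr, acSmul_eq hT (h1.add h2) hr, smul_add]
  add_smul a b z := by
    obtain ⟨n, hn⟩ := hT z
    obtain ⟨r, hr⟩ := appr_exists n a
    obtain ⟨s, hs⟩ := appr_exists n b
    change acSmul hT (a + b) z = acSmul hT a z + acSmul hT b z
    rw [acSmul_eq hT hn hs, acSmul_eq hT hn hr, acSmul_eq hT hn (hr.add hs), add_smul]
  zero_smul z := by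
    obtain ⟨n, hn⟩ := hT z
    refine (acSmul_eq hT hn (r := 0) ?_).trans (zero_smul _ _)
    unfold Appr; rw [map_zero, map_zero]

lemma ac_semilinear (p : ℕ) (φ : M →+ M) (hφ : ∀ (b : R) z, φ (b • z) = b ^ p • φ z)
    (a : AdicCompletion I R) (z : M) : φ (acSmul hT a z) = acSmul hT (a ^ p) (φ z) := by
  obtain ⟨n, hn⟩ := hT z
  obtain ⟨n', hn'⟩ := hT (φ z)
  have h1 := hn.mono (show n ≤ n + n' by omega)
  have h2 := hn'.mono (show n' ≤ n + n' by omega)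
  obtain ⟨r, hr⟩ := appr_exists (n + n') a
  rw [acSmul_eq hT h1 hr, hφ, acSmul_eq hT h2 (hr.pow p)]

end ac

lemma exists_coeff_field (p : ℕ) [Fact p.Prime] (R : Type) [CommRing R] [CharP R p]
    [IsLocalRing R] : ∃ c : IsLocalRing.ResidueField R →+*
      AdicCompletion (IsLocalRing.maximalIdeal R) R,
      ∀ r s, Appr (IsLocalRing.maximalIdeal R) 1 (c (IsLocalRing.residue R r)) s →
        r - s ∈ IsLocalRing.maximalIdeal R := by
  letI : Algebra (ZMod p) R := ZMod.algebra R p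
  have := formallySmooth_field p (IsLocalRing.ResidueField R)
  obtain ⟨c, hc⟩ := Algebra.FormallySmooth.exists_adicCompletionEvalOneₐ_comp_eq
    (R := ZMod p) (I := IsLocalRing.maximalIdeal R)
    (AlgHom.id (ZMod p) (IsLocalRing.ResidueField R) :
      IsLocalRing.ResidueField R →ₐ[ZMod p] (R ⧸ IsLocalRing.maximalIdeal R))
  refine ⟨c.toRingHom, fun r s h => ?_⟩
  have h1 := DFunLike.congr_fun hc (IsLocalRing.residue R r)
  have h2 : AdicCompletion.evalOneₐ (IsLocalRing.maximalIdeal R) (c (IsLocalRing.residue R r)) =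
    Ideal.Quotient.mk _ r := h1
  rw [← AdicCompletion.factorₐ_evalₐ_one] at h2
  unfold Appr at h
  erw [h] at h2
  rw [Ideal.Quotient.factor_mk, eq_comm, Ideal.Quotient.eq] at h2
  exact h2

end FPerf

namespace FPerf
open MvPowerSeries

section approx
variable {R : Type} [CommRing R] {I : Ideal R} {d : ℕ} {k : Type} [Field k]
  (ψ : MvPolynomial (Fin d) k →+* AdicCompletion I R) (x : Fin d → R)

lemma appr_poly (hX : ∀ i, ψ (MvPolynomial.X i) = algebraMap R _ (x i))
    (hx : Ideal.span (Set.range x) = I)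
    (hc : ∀ r, ∃ s : k, ∀ t, Appr I 1 (ψ (MvPolynomial.C s)) t → r - t ∈ I)
    (n : ℕ) : ∀ r, ∃ P, Appr I n (ψ P) r := by
  induction n with
  | zero =>
    intro r
    refine ⟨0, ?_⟩
    obtain ⟨t, ht⟩ := appr_exists 0 (ψ 0)
    exact ht.of_sub_mem (by simp)
  | succ n ih =>
    intro r
    obtain ⟨s, hs⟩ := hc r
    obtain ⟨t, ht⟩ := appr_exists (n + 1) (ψ (MvPolynomial.C s))
    have h1 := hs t (ht.mono (by omega))
    rw [← hx, Ideal.mem_span_range_iff_exists_fun] at h1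
    obtain ⟨a, ha⟩ := h1
    choose P hP using fun i => ih (a i)
    choose b hb using fun i => appr_exists (n + 1) (ψ (P i))
    refine ⟨MvPolynomial.C s + ∑ i, P i * MvPolynomial.X i, ?_⟩
    have h2 : Appr I (n + 1) (ψ (MvPolynomial.C s + ∑ i, P i * MvPolynomial.X i))
        (t + ∑ i, b i * x i) := by
      rw [map_add, map_sum]
      refine ht.add (appr_sum _ fun i => ?_)
      rw [map_mul, hX]
      exact (hb i).mul (appr_algebraMap _ _)
    refine h2.of_sub_mem ?_
    have h3 : t + ∑ i, b i * x i - r = ∑ i, (b i - a i) * x i := by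
      simp only [sub_mul, Finset.sum_sub_distrib, ha]; ring
    rw [h3]
    refine Ideal.sum_mem _ fun i _ => ?_
    rw [pow_succ]
    refine Ideal.mul_mem_mul (((hb i).mono (by omega)).sub_mem (hP i)) ?_
    rw [← hx]; exact Ideal.subset_span ⟨i, rfl⟩

lemma pvalid_of_kills {M : Type} [AddCommGroup M] [Module R M] [Module (AdicCompletion I R) M]
    (halg : ∀ (r : R) (z : M), algebraMap R (AdicCompletion I R) r • z = r • z)
    (hX : ∀ i, ψ (MvPolynomial.X i) = algebraMap R _ (x i)) (hx : ∀ i, x i ∈ I) {n : ℕ} {z : M}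
    (hz : Kills I n z) : PValid ψ n z := by
  intro P hP
  rw [P.as_sum, map_sum, Finset.sum_smul]
  refine Finset.sum_eq_zero fun α hα => ?_
  have h1 : n ≤ α.degree := by
    by_contra hlt
    rw [HO_iff] at hP
    rw [MvPolynomial.mem_support_iff] at hα
    apply hα
    have := hP α (by omega)
    simpa using this
  rw [MvPolynomial.monomial_eq, map_mul, mul_smul, Finsupp.prod, map_prod]
  simp only [map_pow, hX]
  simp only [← map_pow, ← map_prod]
  rw [halg, hz, smul_zero]
  refine Ideal.pow_le_pow_right h1 ?_
  have h2 : ∏ i ∈ α.support, x i ^ α i ∈ ∏ i ∈ α.support, I ^ α i :=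
    Ideal.prod_mem_prod fun i _ => Ideal.pow_mem_pow (hx i) _
  rw [Finset.prod_pow_eq_pow_sum] at h2
  exact h2

end approx

theorem accOn_of_artinian {p : ℕ} [Fact p.Prime] {R₀ : Type} [CommRing R₀] [CharP R₀ p]
    [IsNoetherianRing R₀] [IsLocalRing R₀] {M₀ : Type} [AddCommGroup M₀] [Module R₀ M₀]
    [IsArtinian R₀ M₀] (F₀ : FrobMod p R₀ M₀) : ACCOn F₀ := by
  set I := IsLocalRing.maximalIdeal R₀ with hI
  have hT : ∀ z : M₀, ∃ n, Kills I n z := exists_pow_smul_eq_zero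
  let inst1 : Module (AdicCompletion I R₀) M₀ := acModule hT
  have hB : ∀ (b : AdicCompletion I R₀) (z : M₀), ∃ r : R₀, b • z = r • z := fun b z => ⟨_, rfl⟩
  have hBeq : ∀ {n : ℕ} {z : M₀} (_ : Kills I n z) {a : AdicCompletion I R₀} {r : R₀}
    (_ : Appr I n a r), a • z = r • z := fun hn _ _ h => acSmul_eq hT hn h
  have hBs : ∀ (b : AdicCompletion I R₀) (z : M₀), F₀.φ (b • z) = b ^ p • F₀.φ z :=
    ac_semilinear hT p F₀.φ F₀.semilinear
  clear_value inst1
  have halg : ∀ (r : R₀) (z : M₀), algebraMap R₀ (AdicCompletion I R₀) r • z = r • z := by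
    intro r z
    obtain ⟨n, hn⟩ := hT z
    exact hBeq hn (appr_algebraMap n r)
  obtain ⟨c, hc⟩ := exists_coeff_field p R₀
  obtain ⟨d, x, hx⟩ := Submodule.fg_iff_exists_fin_generating_family.1 (IsNoetherian.noetherian I)
  have hxI : ∀ i, x i ∈ I := fun i => by rw [← hx]; exact Submodule.subset_span ⟨i, rfl⟩
  let k := IsLocalRing.ResidueField R₀
  letI : Algebra (ZMod p) R₀ := ZMod.algebra R₀ p
  have hchar : CharP k p := charP_of_injective_algebraMap (algebraMap (ZMod p) k).injective p
  let ψ : MvPolynomial (Fin d) k →+* AdicCompletion I R₀ :=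
    MvPolynomial.eval₂Hom c (fun i => algebraMap R₀ _ (x i))
  have hψX : ∀ i, ψ (MvPolynomial.X i) = algebraMap R₀ _ (x i) := fun i =>
    MvPolynomial.eval₂Hom_X' _ _ i
  have hψC : ∀ s, ψ (MvPolynomial.C s) = c s := fun s => MvPolynomial.eval₂Hom_C _ _ s
  clear_value ψ
  have hPV : ∀ z : M₀, ∃ n, PValid ψ n z := fun z =>
    (hT z).imp fun n hn => pvalid_of_kills ψ x halg hψX hxI hn
  have hap := appr_poly ψ x hψX hx (fun r => ⟨IsLocalRing.residue R₀ r, fun t ht =>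
    hc r t (by rw [← hψC]; exact ht)⟩)
  let inst2 : Module (PS d k) M₀ := psModule ψ hPV
  have hPb : ∀ (a : PS d k) (z : M₀), ∃ b : AdicCompletion I R₀, a • z = b • z :=
    fun a z => ⟨_, rfl⟩
  have hPoly : ∀ (P : MvPolynomial (Fin d) k) (z : M₀), (P : PS d k) • z = ψ P • z := by
    intro P z
    obtain ⟨n, hn⟩ := hPV z
    exact psSmul_eq ψ hPV hn P (by rw [sub_self, HO_iff]; simp)
  have hTors : Tors d k M₀ := ps_tors ψ hPV
  have hPs : ∀ (a : PS d k) (z : M₀), F₀.φ (a • z) = a ^ p • F₀.φ z :=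
    ps_semilinear ψ hPV p F₀.φ hBs
  clear_value inst2
  have h1 : ∀ (a : PS d k) (z : M₀), ∃ r : R₀, a • z = r • z := by
    intro a z
    obtain ⟨b, hb⟩ := hPb a z
    rw [hb]; exact hB b z
  have h2 : ∀ (r : R₀) (z : M₀), ∃ a : PS d k, r • z = a • z := by
    intro r z
    obtain ⟨n, hn⟩ := hT z
    obtain ⟨P, hP⟩ := hap n r
    exact ⟨P, by rw [hPoly, hBeq hn hP]⟩
  let f : Submodule (PS d k) M₀ → Submodule R₀ M₀ := fun Q =>
    { carrier := Q, add_mem' := Q.add_mem, zero_mem' := Q.zero_mem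
      smul_mem' := fun r z hz => by
        obtain ⟨a, ha⟩ := h2 r z
        rw [ha]; exact Q.smul_mem a hz }
  let g : Submodule R₀ M₀ → Submodule (PS d k) M₀ := fun Q =>
    { carrier := Q, add_mem' := Q.add_mem, zero_mem' := Q.zero_mem
      smul_mem' := fun r z hz => by
        obtain ⟨a, ha⟩ := h1 r z
        rw [ha]; exact Q.smul_mem a hz }
  have hf : StrictMono f := by
    intro Q Q' hlt
    rw [SetLike.lt_iff_le_and_exists] at hlt ⊢
    exact hlt
  have hArt : IsArtinian (PS d k) M₀ := hf.wellFoundedLT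
  intro N hN
  obtain ⟨n, hn⟩ := core p d k M₀ hTors ⟨F₀.φ, hPs⟩ ⟨fun i => g (N i), fun a b hab => N.2 hab⟩
    (fun i z => hN i z)
  refine ⟨n, fun m hm => ?_⟩
  have h3 : g (N n) = g (N m) := hn m hm
  ext z
  exact (SetLike.ext_iff.1 h3 z)

end FPerf

namespace FPerf

lemma frob_iter_smul {p : ℕ} {R P : Type} [CommRing R] [AddCommGroup P] [Module R P]
    (F : FrobMod p R P) (e : ℕ) (b : R) (x : P) :
    F.φ^[e] (b • x) = b ^ p ^ e • F.φ^[e] x := by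
  induction e with
  | zero => simp
  | succ e ih =>
    rw [Function.iterate_succ_apply', ih, F.semilinear, Function.iterate_succ_apply', ← pow_mul,
      pow_succ]

section perf
variable {p : ℕ} {R₀ R : Type} [CommRing R₀] [CommRing R]
  {g : R₀ →+* R} {M₀ : Type} [AddCommGroup M₀] [Module R₀ M₀]
  {F₀ : FrobMod p R₀ M₀} {P : Type} [AddCommGroup P] [Module R P] {F : FrobMod p R P}
  {ι : M₀ →+ P}

lemma exists_pow_root (hg : IsRingPerfection p g) (e : ℕ) (a : R) : ∃ b : R, b ^ p ^ e = a := by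
  induction e with
  | zero => exact ⟨a, by simp⟩
  | succ e ih =>
    obtain ⟨b, hb⟩ := ih
    obtain ⟨c, hc⟩ := hg.perfect.2 b
    exact ⟨c, by rw [pow_succ', pow_mul, ← hb]; exact congrArg (· ^ p ^ e) hc⟩

lemma iter_comm (hperf : IsModPerfection p g F₀ F ι) (e : ℕ) (m : M₀) : ι (F₀.φ^[e] m) = F.φ^[e] (ι m) := by
  induction e with
  | zero => rfl
  | succ e ih => rw [Function.iterate_succ_apply', hperf.comm, ih, Function.iterate_succ_apply']

lemma mem_of_phi_mem (hg : IsRingPerfection p g) (hperf : IsModPerfection p g F₀ F ι) [IsArtinian R₀ M₀]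
    (N : Submodule R P) (hN : F.IsStable N) (x : P)
    (hx : F.φ x ∈ N) : x ∈ N := by
  let A : ℕ → Submodule R₀ M₀ := fun e =>
    { carrier := {m | ∃ y ∈ N, F.φ^[e] y = ι m}
      add_mem' := by
        rintro a b ⟨y, hy, h1⟩ ⟨z, hz, h2⟩
        exact ⟨y + z, N.add_mem hy hz, by rw [iterate_map_add, h1, h2, map_add]⟩
      zero_mem' := ⟨0, N.zero_mem, by rw [iterate_map_zero, map_zero]⟩
      smul_mem' := by
        rintro a m ⟨y, hy, h1⟩
        obtain ⟨b, hb⟩ := exists_pow_root hg e (g a)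
        exact ⟨b • y, N.smul_mem b hy, by rw [frob_iter_smul, h1, hb, hperf.semilinear]⟩ }
  have hA : Antitone A := by
    refine antitone_nat_of_succ_le fun e => ?_
    rintro m ⟨y, hy, h1⟩
    exact ⟨F.φ y, hN y hy, h1⟩
  obtain ⟨n, hn⟩ := IsArtinian.monotone_stabilizes (R := R₀) (M := M₀)
    ⟨fun e => OrderDual.toDual (A e), fun a b hab => OrderDual.toDual_le_toDual.2 (hA hab)⟩
  have hn' : ∀ m, n ≤ m → A n = A m := hn
  obtain ⟨j, m, hj⟩ := hperf.surj x
  have h1 : F.φ^[(n + 1) + j] x = ι (F₀.φ^[n + 1] m) := by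
    rw [iter_comm hperf, ← hj, Function.iterate_add_apply]
  have h2 : F₀.φ^[n + 1] m ∈ A (n + j) := by
    refine ⟨F.φ x, hx, ?_⟩
    rw [← h1, ← Function.iterate_succ_apply]
    congr 2
    omega
  rw [← hn' (n + j) (by omega), hn' (n + 1 + j) (by omega)] at h2
  obtain ⟨y, hy, h3⟩ := h2
  have h4 : y = x := (hperf.bijective.1.iterate (n + 1 + j)) (h3.trans h1.symm)
  exact h4 ▸ hy

theorem finite_length_aux (hg : IsRingPerfection p g) (hperf : IsModPerfection p g F₀ F ι) [IsArtinian R₀ M₀]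
    (hacc : ACCOn F₀) : F.HasFiniteLength := by
  let S : Subring (AddMonoid.End P) := Subring.closure
    (Set.range (fun r : R => (Module.toAddMonoidEnd R P r)) ∪ {(F.φ : AddMonoid.End P)})
  have hS1 : ∀ r : R, Module.toAddMonoidEnd R P r ∈ S := fun r =>
    Subring.subset_closure (Or.inl ⟨r, rfl⟩)
  have hS2 : (F.φ : AddMonoid.End P) ∈ S := Subring.subset_closure (Or.inr rfl)
  let toR : Submodule S P → Submodule R P := fun Q =>
    { carrier := Q, add_mem' := Q.add_mem, zero_mem' := Q.zero_mem
      smul_mem' := fun r z hz => Q.smul_mem (⟨_, hS1 r⟩ : S) hz }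
  have hst : ∀ Q, F.IsStable (toR Q) := fun Q z hz => Q.smul_mem (⟨_, hS2⟩ : S) hz
  have hmem : ∀ N : Submodule R P, F.IsStable N → ∀ s ∈ S, ∀ z ∈ N, s z ∈ N := by
    intro N hN s hs
    induction hs using Subring.closure_induction with
    | mem s hs =>
      rcases hs with ⟨r, rfl⟩ | rfl
      · exact fun z hz => N.smul_mem r hz
      · exact hN
    | zero => exact fun z _ => N.zero_mem
    | one => exact fun z hz => hz
    | add a b _ _ ha hb => exact fun z hz => N.add_mem (ha z hz) (hb z hz)
    | neg a _ ha => exact fun z hz => N.neg_mem (ha z hz)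
    | mul a b _ _ ha hb => exact fun z hz => ha _ (hb z hz)
  let pull : Submodule S P → Submodule R₀ M₀ := fun Q =>
    { carrier := {m | ι m ∈ Q}
      add_mem' := fun {a b} ha hb => by
        change ι (a + b) ∈ Q
        rw [map_add]; exact Q.add_mem ha hb
      zero_mem' := by
        change ι 0 ∈ Q
        rw [map_zero]; exact Q.zero_mem
      smul_mem' := fun r z hz => by
        change ι (r • z) ∈ Q
        rw [hperf.semilinear]; exact (toR Q).smul_mem _ hz }
  have hpull : ∀ Q m, m ∈ pull Q ↔ ι m ∈ Q := fun Q m => Iff.rfl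
  have hcl : ∀ Q : Submodule S P, ∀ x, F.φ x ∈ Q ↔ x ∈ Q := fun Q x =>
    ⟨mem_of_phi_mem hg hperf (toR Q) (hst Q) x, hst Q x⟩
  have hcl' : ∀ (Q : Submodule S P) e, ∀ x, F.φ^[e] x ∈ Q ↔ x ∈ Q := by
    intro Q e x
    induction e with
    | zero => rfl
    | succ e ih => rw [Function.iterate_succ_apply', hcl, ih]
  have hrefl : ∀ Q Q', pull Q ≤ pull Q' → Q ≤ Q' := by
    intro Q Q' h x hx
    obtain ⟨e, m, hm⟩ := hperf.surj x
    rw [← hcl' Q' e, hm]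
    apply h
    rw [hpull, ← hm, hcl']
    exact hx
  have hmono : Monotone pull := fun Q Q' h m hm => h hm
  have hstrict : StrictMono pull := fun Q Q' h =>
    lt_of_le_not_ge (hmono h.le) fun h' => h.not_ge (hrefl _ _ h')
  have hart : IsArtinian S P := hstrict.wellFoundedLT
  have hnoe : IsNoetherian S P := by
    rw [← monotone_stabilizes_iff_noetherian]
    intro f
    obtain ⟨n, hn⟩ := hacc ⟨fun i => pull (f i), fun a b hab => hmono (f.2 hab)⟩ (fun i m => by
      change ι (F₀.φ m) ∈ f i ↔ ι m ∈ f i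
      rw [hperf.comm, hcl])
    refine ⟨n, fun m hm => ?_⟩
    have h1 : pull (f n) = pull (f m) := hn m hm
    exact le_antisymm (hrefl _ _ h1.le) (hrefl _ _ h1.ge)
  have hfin : IsFiniteLength S P := isFiniteLength_iff_isNoetherian_isArtinian.2 ⟨hnoe, hart⟩
  have hlen : Module.length S P ≠ ⊤ := Module.length_ne_top_iff.2 hfin
  obtain ⟨n, hn⟩ := ENat.ne_top_iff_exists.1 hlen
  refine ⟨n + 1, fun m c hc hmc => ?_⟩
  rcases m with _ | m
  · omega
  let c' : Fin (m + 1) → Submodule S P := fun i =>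
    { carrier := c i, add_mem' := (c i).add_mem, zero_mem' := (c i).zero_mem
      smul_mem' := fun s z hz => hmem (c i) (hc i) s.1 s.2 z hz }
  have hc' : StrictMono c' := by
    intro i j hij
    have := hmc hij
    rw [SetLike.lt_iff_le_and_exists] at this ⊢
    exact this
  let q : LTSeries (Submodule S P) := LTSeries.mk m c' hc'
  have h1 : ((q.length : ℕ∞) : WithBot ℕ∞) ≤ Order.krullDim (Submodule S P) := Order.LTSeries.length_le_krullDim q
  rw [← Module.coe_length S P, ← hn] at h1
  have h2 : m ≤ n := by
    exact_mod_cast h1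
  omega

end perf

end FPerf

/-- Let `(R, m)` be the perfection of a noetherian local `𝔽_p`-algebra
`(R₀, m₀)` and `M₀` a co-finite (i.e. Artinian) `R₀[φ]`-module. Then the Frobenius
perfection `M₀^perf` has finite length as an `R[φ]`-module. -/
theorem frobPerfection_hasFiniteLength
    {p : ℕ} [Fact p.Prime] {R₀ R : Type} [CommRing R₀] [CommRing R]
    [CharP R₀ p] [CharP R p] [IsNoetherianRing R₀] [IsLocalRing R₀]
    (g : R₀ →+* R) (hg : IsRingPerfection p g)
    {M₀ : Type} [AddCommGroup M₀] [Module R₀ M₀] [IsArtinian R₀ M₀]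
    (F₀ : FrobMod p R₀ M₀)
    {P : Type} [AddCommGroup P] [Module R P] (F : FrobMod p R P) (ι : M₀ →+ P)
    (hperf : IsModPerfection p g F₀ F ι) :
    F.HasFiniteLength := by
  exact FPerf.finite_length_aux hg hperf (FPerf.accOn_of_artinian F₀)
end

section
/- Let (R₀, m₀) be a noetherian local F_p-algebra and M a co-finite (Artinian) R₀[φ]-module. Then some power of φ annihilates the submodule {x ∈ M : φ^e(x) = 0 for some e > 0} of φ-nilpotent elements of M. -/
section
open IsLocalRing

open CategoryTheory in
theorem hsl_exists_injective_embedding (B : Type) [CommRing B] (k : Type) [AddCommGroup k] [Module B k] :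
    ∃ (I : Type) (_ : AddCommGroup I) (_ : Module B I), Module.Injective B I ∧
      ∃ ι : k →ₗ[B] I, Function.Injective ι := by
  let X := ModuleCat.of B k
  refine ⟨(Injective.under X : ModuleCat.{0} B), inferInstance, inferInstance, ?_, (Injective.ι X).hom, ?_⟩
  · have : Injective (ModuleCat.of B (Injective.under X : ModuleCat.{0} B)) :=
      inferInstanceAs (Injective (Injective.under X))
    exact Module.injective_module_of_injective_object _ _
  · exact (ModuleCat.mono_iff_injective _).1 inferInstance

/-- Essential extension inside a module. -/
def HslEss {B I : Type} [CommRing B] [AddCommGroup I] [Module B I] (L E : Submodule B I) : Prop :=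
  ∀ x ∈ E, x ≠ 0 → ∃ b : B, b • x ≠ 0 ∧ b • x ∈ L

theorem hsl_exists_hull (B : Type) [CommRing B] (k : Type) [AddCommGroup k] [Module B k] :
    ∃ (E : Type) (_ : AddCommGroup E) (_ : Module B E), Module.Injective B E ∧
      ∃ ι : k →ₗ[B] E, Function.Injective ι ∧
        ∀ x : E, x ≠ 0 → ∃ b : B, b • x ≠ 0 ∧ b • x ∈ LinearMap.range ι := by
  obtain ⟨I, _, _, hI, ι, hι⟩ := hsl_exists_injective_embedding B k
  set L := LinearMap.range ι with hL
  -- maximal essential extension of `L` in `I`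
  obtain ⟨E, hLE, hE⟩ := zorn_le_nonempty₀ {E : Submodule B I | L ≤ E ∧ HslEss L E} (by
    intro c hc hchain y hy
    refine ⟨sSup c, ⟨?_, ?_⟩, fun z hz => le_sSup hz⟩
    · exact (hc hy).1.trans (le_sSup hy)
    · intro x hx hx0
      obtain ⟨z, hz, hxz⟩ := (Submodule.mem_sSup_of_directed ⟨y, hy⟩ hchain.directedOn).1 hx
      exact (hc hz).2 x hxz hx0) L ⟨le_rfl, fun x hx hx0 => ⟨1, by simpa using hx0, by simpa using hx⟩⟩
  have hEess : HslEss L E := hE.prop.2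
  -- complement
  obtain ⟨H, -, hH⟩ := zorn_le_nonempty₀ {H : Submodule B I | Disjoint H E} (by
    intro c hc hchain y hy
    refine ⟨sSup c, ?_, fun z hz => le_sSup hz⟩
    rw [Set.mem_setOf_eq, Submodule.disjoint_def]
    intro x hx hxE
    obtain ⟨z, hz, hxz⟩ := (Submodule.mem_sSup_of_directed ⟨y, hy⟩ hchain.directedOn).1 hx
    exact Submodule.disjoint_def.1 (hc hz) x hxz hxE) ⊥ disjoint_bot_left
  have hHd : Disjoint H E := hH.prop
  let j : E →ₗ[B] I ⧸ H := H.mkQ ∘ₗ E.subtype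
  have hj : Function.Injective j := by
    rw [← LinearMap.ker_eq_bot, LinearMap.ker_eq_bot']
    intro x hx
    have : (x : I) ∈ H := by simpa [j] using hx
    exact Subtype.ext (Submodule.disjoint_def.1 hHd x this x.2)
  obtain ⟨g, hg⟩ := Module.Injective.extension_property B I E (I ⧸ H) j hj E.subtype
  have hgE : ∀ x : I, x ∈ E → g (H.mkQ x) = x := fun x hx => by
    simpa [j] using LinearMap.congr_fun hg ⟨x, hx⟩
  -- E is essential in I/H
  have hess : ∀ y : I, y ∉ H → ∃ b : B, ∃ h ∈ H, b • y - h ∈ E ∧ b • y - h ≠ 0 := by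
    intro y hy
    by_contra hcon
    push Not at hcon
    have : H ⊔ Submodule.span B {y} ≤ H := by
      apply hH.le_of_ge _ le_sup_left
      rw [Set.mem_setOf_eq, Submodule.disjoint_def]
      intro x hx hxE
      obtain ⟨h, hh, z, hz, rfl⟩ := Submodule.mem_sup.1 hx
      obtain ⟨b, rfl⟩ := Submodule.mem_span_singleton.1 hz
      have := hcon b (-h) (H.neg_mem hh)
      rw [sub_neg_eq_add, add_comm] at this
      exact this hxE
    exact hy (this (Submodule.mem_sup_right (Submodule.mem_span_singleton_self y)))
  have hrange : LinearMap.range g ≤ E := by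
    apply hE.le_of_ge
    · refine ⟨?_, ?_⟩
      · intro x hx
        exact ⟨H.mkQ x, hgE x (hE.prop.1 hx)⟩
      · rintro _ ⟨y, rfl⟩ hy0
        obtain ⟨y, rfl⟩ := H.mkQ_surjective y
        have hyH : y ∉ H := fun h => hy0 (by
          rw [show H.mkQ y = 0 by simpa using h, map_zero])
        obtain ⟨b, h, hh, hE1, hE0⟩ := hess y hyH
        have e1 : b • g (H.mkQ y) = b • y - h := by
          rw [← hgE _ hE1, map_sub, map_smul, show H.mkQ h = 0 by simpa using hh, sub_zero, map_smul]
        obtain ⟨b', h1, h2⟩ := hEess _ hE1 hE0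
        exact ⟨b' * b, by rw [mul_smul, e1]; exact h1, by rw [mul_smul, e1]; exact h2⟩
    · intro x hx
      exact ⟨H.mkQ x, hgE x hx⟩
  let r : I →ₗ[B] E := (g ∘ₗ H.mkQ).codRestrict E (fun x => hrange ⟨_, rfl⟩)
  have hr : ∀ x : E, r x = x := fun x => Subtype.ext (hgE x x.2)
  refine ⟨E, inferInstance, inferInstance, ?_, ι.codRestrict E (fun x => hE.prop.1 ⟨x, rfl⟩), ?_, ?_⟩
  · constructor
    intro X Y _ _ _ _ f hf φ
    obtain ⟨h, hh⟩ := Module.Injective.extension_property B I X Y f hf (E.subtype ∘ₗ φ)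
    refine ⟨r ∘ₗ h, fun x => ?_⟩
    have := LinearMap.congr_fun hh x
    simp only [LinearMap.comp_apply, Submodule.subtype_apply] at this ⊢
    rw [this, hr]
  · intro a b hab
    exact hι (congrArg Subtype.val hab)
  · rintro ⟨x, hx⟩ hx0
    obtain ⟨b, h1, y, hy⟩ := hEess x hx (fun h => hx0 (Subtype.ext h))
    exact ⟨b, fun h => h1 (congrArg Subtype.val h), y, Subtype.ext hy⟩

theorem hsl_evalA_transition {S : Type} [CommRing S] (J : Ideal S) {a b : ℕ} (hle : a ≤ b)
    (x : AdicCompletion J S) :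
    Ideal.Quotient.factorPow J hle (AdicCompletion.evalₐ J b x) = AdicCompletion.evalₐ J a x := by
  obtain ⟨c, rfl⟩ := AdicCompletion.mk_surjective J S x
  rw [AdicCompletion.evalₐ_mk, AdicCompletion.evalₐ_mk]
  change Ideal.Quotient.mk (J ^ a) (c.val b) = _
  rw [eq_comm, Ideal.Quotient.eq]
  have h := c.2 hle
  rw [SModEq.sub_mem] at h
  simpa using h

theorem hsl_completion_noetherian (R : Type) [CommRing R] [IsNoetherianRing R] (m : Ideal R) :
    IsNoetherianRing (AdicCompletion m R) := by
  classical
  obtain ⟨s, hs⟩ := m.fg_of_isNoetherianRing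
  let S := MvPolynomial s R
  let J : Ideal S := MvPolynomial.idealOfVars s R
  let B := AdicCompletion J S
  have hB : IsNoetherianRing B :=
    isNoetherianRing_of_ringEquiv _ (MvPowerSeries.toAdicCompletionAlgEquiv s R).toRingEquiv
  have hS : IsNoetherianRing S := inferInstanceAs (IsNoetherianRing (MvPolynomial s R))
  let θ : S →+* R := MvPolynomial.eval (fun i : s => (i : R))
  have hJ : J.map θ = m := by
    rw [← hs]
    simp only [J, MvPolynomial.idealOfVars, Ideal.map_span, ← Set.range_comp]
    congr 1
    ext x
    constructor
    · rintro ⟨i, rfl⟩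
      simp [θ, S]
    · intro hx
      exact ⟨⟨x, hx⟩, by simp [θ, S]⟩
  have hJn : ∀ n, J ^ n ≤ (m ^ n).comap θ := fun n => by
    rw [← Ideal.map_le_iff_le_comap, Ideal.map_pow, hJ]
  let f : (n : ℕ) → B →+* R ⧸ m ^ n := fun n =>
    (Ideal.quotientMap (m ^ n) θ (hJn n)).comp (AdicCompletion.evalₐ J n).toRingHom
  have hf : ∀ {a b : ℕ} (hle : a ≤ b), (Ideal.Quotient.factorPow m hle).comp (f b) = f a := by
    intro a b hle
    refine RingHom.ext fun x => ?_
    have h1 : Ideal.Quotient.factorPow J hle (AdicCompletion.evalₐ J b x)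
        = AdicCompletion.evalₐ J a x := hsl_evalA_transition J hle x
    obtain ⟨y, hy⟩ := Ideal.Quotient.mk_surjective (AdicCompletion.evalₐ J b x)
    have h2 : AdicCompletion.evalₐ J a x = Ideal.Quotient.mk _ y := by
      rw [← h1, ← hy]; rfl
    change Ideal.Quotient.factorPow m hle (Ideal.quotientMap (m ^ b) θ (hJn b) (AdicCompletion.evalₐ J b x)) =
      Ideal.quotientMap (m ^ a) θ (hJn a) (AdicCompletion.evalₐ J a x)
    rw [h2, ← hy, Ideal.quotientMap_mk, Ideal.quotientMap_mk]
    rfl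
  let F : B →+* AdicCompletion m R := AdicCompletion.liftRingHom m f hf
  have hFc : ∀ x : S, F (algebraMap S B x) = algebraMap R (AdicCompletion m R) (θ x) := by
    intro x
    apply AdicCompletion.ext_evalₐ
    intro n
    rw [AdicCompletion.evalₐ_liftRingHom]
    change Ideal.quotientMap (m ^ n) θ (hJn n) (AdicCompletion.evalₐ J n (algebraMap S B x)) = _
    rw [AlgHom.commutes, AlgHom.commutes]
    rfl
  have hmap : (J.map (algebraMap S B)).map F = m.map (algebraMap R (AdicCompletion m R)) := by
    have e1 : F.comp (algebraMap S B) = (algebraMap R (AdicCompletion m R)).comp θ :=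
      RingHom.ext hFc
    rw [Ideal.map_map, e1, ← Ideal.map_map, hJ]
  have c1 : IsAdicComplete (J.map (algebraMap S B)) B :=
    AdicCompletion.isAdicComplete_self J J.fg_of_isNoetherianRing
  have c2 : IsAdicComplete ((J.map (algebraMap S B)).map F) (AdicCompletion m R) := by
    rw [hmap]
    exact AdicCompletion.isAdicComplete_self m m.fg_of_isNoetherianRing
  have hF : Function.Surjective F := by
    apply surjective_of_mk_map_comp_surjective (I := J.map (algebraMap S B)) F
    intro y
    obtain ⟨y, rfl⟩ := Ideal.Quotient.mk_surjective y
    obtain ⟨r, hr⟩ := Ideal.Quotient.mk_surjective (AdicCompletion.evalOneₐ m y)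
    refine ⟨algebraMap S B (MvPolynomial.C r), ?_⟩
    rw [RingHom.comp_apply, Ideal.Quotient.eq, hmap, hFc, ← AdicCompletion.ker_evalOneₐ_eq_map _ m.fg_of_isNoetherianRing,
      RingHom.mem_ker]
    change AdicCompletion.evalOneₐ m _ = 0
    rw [map_sub, ← hr, AlgHom.commutes]
    simp [θ, S]
  exact isNoetherianRing_of_surjective _ _ F hF


/-- every element of an Artinian module over a Noetherian local ring is killed by a power of
the maximal ideal. -/
theorem hsl_torsion {B : Type} [CommRing B] [IsNoetherianRing B] [IsLocalRing B]
    {M : Type} [AddCommGroup M] [Module B M] [IsArtinian B M] (x : M) :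
    ∃ n : ℕ, ∀ b ∈ maximalIdeal B ^ n, b • x = 0 := by
  let N : Submodule B M := Submodule.span B {x}
  let f : ℕ →o (Submodule B M)ᵒᵈ :=
    ⟨fun n => OrderDual.toDual (maximalIdeal B ^ n • N), fun a b hab =>
      Submodule.smul_mono_left (Ideal.pow_le_pow_right hab)⟩
  obtain ⟨n, hn⟩ := IsArtinian.monotone_stabilizes f
  have h1 : maximalIdeal B ^ n • N = maximalIdeal B ^ (n + 1) • N := hn (n + 1) (Nat.le_succ n)
  have hfg : (maximalIdeal B ^ n • N).FG := 
    Submodule.FG.smul (Ideal.fg_of_isNoetherianRing _) (Submodule.fg_span_singleton x)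
  have h0 : maximalIdeal B ^ n • N = ⊥ := by
    apply Submodule.eq_bot_of_le_smul_of_le_jacobson_bot (maximalIdeal B) _ hfg
    · rw [← mul_smul, ← pow_succ', ← h1]
    · exact maximalIdeal_le_jacobson _
  refine ⟨n, fun b hb => ?_⟩
  have : b • x ∈ maximalIdeal B ^ n • N :=
    Submodule.smul_mem_smul hb (Submodule.mem_span_singleton_self x)
  rw [h0] at this
  simpa using this

/-- cogenerator property -/
theorem hsl_cogen {B : Type} [CommRing B] [IsLocalRing B]
    {E : Type} [AddCommGroup E] [Module B E] [Module.Injective B E]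
    (ι : ResidueField B →ₗ[B] E) (hι : Function.Injective ι)
    {V : Type} [AddCommGroup V] [Module B V] (v : V) (hv : v ≠ 0) :
    ∃ f : V →ₗ[B] E, f v ≠ 0 := by
  let τ : B →ₗ[B] V := LinearMap.toSpanSingleton B V v
  let j : (B ⧸ LinearMap.ker τ) →ₗ[B] V := (LinearMap.ker τ).liftQ τ le_rfl
  have hj : Function.Injective j := by
    rw [← LinearMap.ker_eq_bot]
    exact Submodule.ker_liftQ_eq_bot _ _ _ le_rfl
  have hle : LinearMap.ker τ ≤ maximalIdeal B := by
    apply le_maximalIdeal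
    intro h
    have : (1 : B) ∈ LinearMap.ker τ := by rw [h]; trivial
    exact hv (by simpa [τ] using this)
  let q : B →ₗ[B] ResidueField B := (maximalIdeal B).mkQ
  let g : (B ⧸ LinearMap.ker τ) →ₗ[B] ResidueField B := (LinearMap.ker τ).liftQ q (by
    intro b hb
    have := hle hb
    exact (Submodule.Quotient.mk_eq_zero _).2 this)
  obtain ⟨h, hh⟩ := Module.Injective.extension_property B E _ V j hj (ι ∘ₗ g)
  refine ⟨h, fun h0 => ?_⟩
  have h1 := LinearMap.congr_fun hh (Submodule.Quotient.mk 1)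
  have h2 : j (Submodule.Quotient.mk 1) = v := one_smul B v
  rw [LinearMap.comp_apply, h2, h0, LinearMap.comp_apply, eq_comm] at h1
  have h3 := hι (h1.trans (map_zero ι).symm)
  have h4 : g (Submodule.Quotient.mk 1) = (1 : ResidueField B) := rfl
  rw [h4] at h3
  exact one_ne_zero h3

theorem hsl_hom_finite {B : Type} [CommRing B] [IsNoetherianRing B]
    {V W : Type} [AddCommGroup V] [Module B V] [AddCommGroup W] [Module B W]
    [Module.Finite B V] [Module.Finite B W] : Module.Finite B (V →ₗ[B] W) := by
  obtain ⟨n, p, hp⟩ := Module.Finite.exists_fin' B V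
  exact Module.Finite.of_injective (LinearMap.lcomp B W p) (LinearMap.lcomp_injective_of_surjective p hp)

theorem hsl_precomplete_pi {B : Type} [CommRing B] (m : Ideal B) [IsPrecomplete m B] (n : ℕ) :
    IsPrecomplete m (Fin n → B) := by
  constructor
  intro f hf
  have h1 : ∀ i : Fin n, ∃ L : B, ∀ k, f k i ≡ L [SMOD (m ^ k • ⊤ : Submodule B B)] := by
    intro i
    apply IsPrecomplete.prec (I := m) inferInstance (f := fun k => f k i)
    intro a b hab
    have h := hf hab
    rw [SModEq.sub_mem] at h ⊢
    have h2 := Submodule.mem_map_of_mem (f := (LinearMap.proj i : (Fin n → B) →ₗ[B] B)) h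
    rw [Submodule.map_smul''] at h2
    exact Submodule.smul_mono le_rfl le_top h2
  choose L hL using h1
  refine ⟨L, fun k => ?_⟩
  rw [SModEq.sub_mem, pi_eq_sum_univ (f k - L)]
  refine Submodule.sum_mem _ fun i _ => Submodule.smul_mem_smul ?_ trivial
  have := hL i k
  rw [SModEq.sub_mem] at this
  simpa using this

/-- The Matlis-type dual of an Artinian module over a complete local ring is finite. -/
theorem hsl_dual_finite {B : Type} [CommRing B] [IsNoetherianRing B] [IsLocalRing B]
    [IsAdicComplete (maximalIdeal B) B]
    {E : Type} [AddCommGroup E] [Module B E] [Module.Injective B E]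
    (ι : ResidueField B →ₗ[B] E)
    (hess : ∀ x : E, x ≠ 0 → ∃ b : B, b • x ≠ 0 ∧ b • x ∈ LinearMap.range ι)
    {M : Type} [AddCommGroup M] [Module B M] [IsArtinian B M] :
    Module.Finite B (M →ₗ[B] E) := by
  classical
  set m := maximalIdeal B with hm
  -- socle of E
  have hsocE : ∀ x : E, (∀ b ∈ m, b • x = 0) → x ∈ LinearMap.range ι := by
    intro x hx
    by_cases hx0 : x = 0
    · subst hx0; exact zero_mem _
    obtain ⟨b, hb, hbr⟩ := hess x hx0
    have hbu : IsUnit b := by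
      by_contra hcon
      exact hb (hx b ((mem_maximalIdeal b).2 hcon))
    obtain ⟨u, rfl⟩ := hbu
    have := (LinearMap.range ι).smul_mem (↑u⁻¹ : B) hbr
    simpa [smul_smul] using this
  obtain ⟨s, hs⟩ := m.fg_of_isNoetherianRing
  -- the socle of M
  let Ψ : M →ₗ[B] (s → M) := LinearMap.pi fun i => LinearMap.lsmul B M (i : B)
  let T : Submodule B M := LinearMap.ker Ψ
  have hT : ∀ x ∈ T, ∀ b ∈ m, b • x = 0 := by
    intro x hx b hb
    have : m ≤ LinearMap.ker (LinearMap.toSpanSingleton B M x) := by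
      rw [← hs, Ideal.span_le]
      intro c hc
      have := congrFun (LinearMap.mem_ker.1 hx) ⟨c, hc⟩
      simpa [Ψ] using this
    simpa using this hb
  have hTfin : Module.Finite B T := by
    have htor : Module.IsTorsionBySet B T (m : Set B) := by
      rintro x ⟨b, hb⟩
      exact Subtype.ext (hT x x.2 b hb)
    let _ : Module (B ⧸ m) T := htor.module
    have : IsScalarTower B (B ⧸ m) T := htor.isScalarTower
    let _ : Field (B ⧸ m) := Ideal.Quotient.field m
    have : IsArtinian (B ⧸ m) T := isArtinian_of_tower B inferInstance
    have : IsNoetherian (B ⧸ m) T := IsSemiprimaryRing.isNoetherian_iff_isArtinian.2 inferInstance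
    have : Module.Finite (B ⧸ m) T := inferInstance
    exact Module.Finite.trans (B ⧸ m) T
  have hrfin : Module.Finite B (LinearMap.range ι) := by
    have : Module.Finite B (ResidueField B) := inferInstance
    infer_instance
  have hDT : Module.Finite B (T →ₗ[B] E) := by
    have := hsl_hom_finite (B := B) (V := T) (W := LinearMap.range ι)
    refine Module.Finite.of_surjective (LinearMap.compRight B (M := T) (LinearMap.range ι).subtype) ?_
    intro f
    refine ⟨f.codRestrict _ (fun x => hsocE _ fun b hb => ?_), ?_⟩
    · rw [← map_smul, show b • x = 0 from Subtype.ext (hT x x.2 b hb), map_zero]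
    · ext x; rfl
  -- restriction
  have hker : ∀ f : M →ₗ[B] E, (∀ x ∈ T, f x = 0) → f ∈ m • (⊤ : Submodule B (M →ₗ[B] E)) := by
    intro f hf
    let j : (M ⧸ T) →ₗ[B] (s → M) := T.liftQ Ψ le_rfl
    have hj : Function.Injective j := by
      rw [← LinearMap.ker_eq_bot]
      exact Submodule.ker_liftQ_eq_bot _ _ _ le_rfl
    obtain ⟨g, hg⟩ := Module.Injective.extension_property B E _ _ j hj (T.liftQ f hf)
    have : f = ∑ i : s, (i : B) • (g ∘ₗ LinearMap.single B (fun _ => M) i) := by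
      ext x
      have h1 := LinearMap.congr_fun hg (T.mkQ x)
      have h2 : j (T.mkQ x) = ∑ i : s, Pi.single i ((i : B) • x) := by
        ext i
        simp [j, Ψ]
      rw [LinearMap.comp_apply, h2, map_sum] at h1
      simp only [LinearMap.sum_apply, LinearMap.smul_apply, LinearMap.comp_apply]
      simp only [← map_smul]
      exact h1.symm
    rw [this]
    refine Submodule.sum_mem _ fun i _ => Submodule.smul_mem_smul ?_ trivial
    rw [← hs]
    exact Ideal.subset_span i.2
  have hsurj : Function.Surjective (LinearMap.lcomp B E T.subtype) := by
    intro f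
    exact Module.Injective.extension_property B E _ _ T.subtype T.injective_subtype f
  have hhaus : IsHausdorff m (M →ₗ[B] E) := by
    constructor
    intro f hf
    ext x
    obtain ⟨n, hn⟩ := hsl_torsion (B := B) x
    have h1 := hf n
    rw [SModEq.zero] at h1
    have h2 : (m ^ n • (⊤ : Submodule B (M →ₗ[B] E))) ≤ LinearMap.ker (LinearMap.applyₗ (R := B) x : (M →ₗ[B] E) →ₗ[B] E) := by
      rw [Submodule.smul_le]
      intro b hb g _
      simp only [LinearMap.mem_ker, LinearMap.applyₗ_apply_apply, LinearMap.smul_apply]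
      rw [← map_smul, hn b hb, map_zero]
    simpa using h2 h1
  obtain ⟨n, p, hp⟩ := Module.Finite.exists_fin' B (T →ₗ[B] E)
  -- lift
  choose w hw using hsurj
  let P : (Fin n → B) →ₗ[B] (M →ₗ[B] E) := Fintype.linearCombination B (fun i => w (p (Pi.single i 1)))
  have hP : ∀ a, LinearMap.lcomp B E T.subtype (P a) = p a := by
    intro a
    suffices h : (LinearMap.lcomp B E T.subtype) ∘ₗ P = p from LinearMap.congr_fun h a
    apply LinearMap.pi_ext'
    intro i
    ext1
    simp only [LinearMap.comp_apply, LinearMap.single_apply, P, Fintype.linearCombination_apply_single, one_smul]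
    exact hw _
  have : IsPrecomplete m (Fin n → B) := hsl_precomplete_pi m n
  refine Module.Finite.of_surjective P (surjective_of_mkQ_comp_surjective (I := m) ?_)
  intro f
  obtain ⟨f, rfl⟩ := Submodule.mkQ_surjective _ f
  obtain ⟨a, ha⟩ := hp (LinearMap.lcomp B E T.subtype f)
  refine ⟨a, ?_⟩
  rw [LinearMap.comp_apply, ← sub_eq_zero, ← map_sub]
  refine (Submodule.Quotient.mk_eq_zero _).2 (hker _ ?_)
  intro x hx
  have := LinearMap.congr_fun ((hP a).trans ha) ⟨x, hx⟩
  simpa [sub_eq_zero] using this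

theorem hsl_rank_domain {D : Type} [CommRing D] [IsDomain D] {N : Type} [AddCommGroup N] [Module D N]
    [IsNoetherian D N] (K : ℕ → Submodule D N) (hK : Antitone K)
    (h : ∀ i, ∀ b : D, b ≠ 0 → ∃ f ∈ K i, b • f ∉ K (i + 1)) : False := by
  have key : ∀ i, Module.finrank D (K (i + 1)) < Module.finrank D (K i) := by
    intro i
    have e1 := Submodule.finrank_quotient_add_finrank ((K (i + 1)).submoduleOf (K i))
    have e2 := (Submodule.submoduleOfEquivOfLe (hK (Nat.le_succ i))).finrank_eq
    have e3 : Module.finrank D (K i ⧸ (K (i + 1)).submoduleOf (K i)) ≠ 0 := by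
      intro h0
      rw [Module.finrank_eq_zero_iff_isTorsion] at h0
      obtain ⟨b, hb, hb0⟩ := Submodule.annihilator_top_inter_nonZeroDivisors h0
      obtain ⟨f, hf, hbf⟩ := h i b (nonZeroDivisors.ne_zero hb0)
      apply hbf
      have := (Submodule.mem_annihilator.1 hb) (Submodule.Quotient.mk ⟨f, hf⟩) trivial
      rw [← Submodule.Quotient.mk_smul, Submodule.Quotient.mk_eq_zero] at this
      exact this
    change Module.finrank D (K (i+1)) < _
    simp only [Nat.succ_eq_add_one] at e2
    omega
  have : ∀ i, Module.finrank D (K i) + i ≤ Module.finrank D (K 0) := by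
    intro i
    induction i with
    | zero => simp
    | succ i ih => have := key i; omega
  have := this (Module.finrank D (K 0) + 1)
  omega

theorem hsl_rank_prime {B : Type} [CommRing B] (P : Ideal B) [P.IsPrime] {N : Type}
    [AddCommGroup N] [Module B N] [IsNoetherian B N] (hP : ∀ b ∈ P, ∀ x : N, b • x = 0)
    (K : ℕ → Submodule B N) (hK : Antitone K)
    (h : ∀ i, ∀ b : B, b ∉ P → ∃ f ∈ K i, b • f ∉ K (i + 1)) : False := by
  have htor : Module.IsTorsionBySet B N (P : Set B) := by
    rintro x ⟨b, hb⟩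
    exact hP b hb x
  let _ : Module (B ⧸ P) N := htor.module
  have : IsScalarTower B (B ⧸ P) N := htor.isScalarTower
  have : IsNoetherian (B ⧸ P) N := isNoetherian_of_tower B inferInstance
  let K' : ℕ → Submodule (B ⧸ P) N := fun i =>
    { (K i).toAddSubmonoid with
      smul_mem' := by
        intro c x hx
        obtain ⟨b, rfl⟩ := Ideal.Quotient.mk_surjective c
        exact (K i).smul_mem b hx }
  refine hsl_rank_domain K' (fun a b hab x hx => hK hab hx) ?_
  intro i c hc
  obtain ⟨b, rfl⟩ := Ideal.Quotient.mk_surjective c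
  exact h i b (fun hb => hc (Ideal.Quotient.eq_zero_iff_mem.2 hb))

/-- restriction to a stable submodule -/
def HslSub {p : ℕ} {B M : Type} [CommRing B] [AddCommGroup M] [Module B M] (F : FrobMod p B M)
    (N : Submodule B M) (hN : F.IsStable N) : FrobMod p B N where
  φ := (F.φ.comp N.toAddSubgroup.subtype).codRestrict N.toAddSubgroup (fun x => hN x x.2)
  semilinear a m := Subtype.ext (F.semilinear a m)

theorem hsl_sub_iterate {p : ℕ} {B M : Type} [CommRing B] [AddCommGroup M] [Module B M]
    (F : FrobMod p B M) (N : Submodule B M) (hN : F.IsStable N) (e : ℕ) (x : N) :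
    (((HslSub F N hN).φ^[e] x : N) : M) = F.φ^[e] x := by
  induction e generalizing x with
  | zero => rfl
  | succ e ih => rw [Function.iterate_succ_apply, Function.iterate_succ_apply, ih]; rfl

/-- quotient by a stable submodule -/
def HslQuot {p : ℕ} {B M : Type} [CommRing B] [AddCommGroup M] [Module B M] (F : FrobMod p B M)
    (N : Submodule B M) (hN : F.IsStable N) : FrobMod p B (M ⧸ N) where
  φ := QuotientAddGroup.map N.toAddSubgroup N.toAddSubgroup F.φ (fun x hx => hN x hx)
  semilinear a m := by
    obtain ⟨m, rfl⟩ := N.mkQ_surjective m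
    exact congrArg N.mkQ (F.semilinear a m)

theorem hsl_quot_iterate {p : ℕ} {B M : Type} [CommRing B] [AddCommGroup M] [Module B M]
    (F : FrobMod p B M) (N : Submodule B M) (hN : F.IsStable N) (e : ℕ) (x : M) :
    (HslQuot F N hN).φ^[e] (N.mkQ x) = N.mkQ (F.φ^[e] x) := by
  induction e generalizing x with
  | zero => rfl
  | succ e ih => rw [Function.iterate_succ_apply, Function.iterate_succ_apply, ← ih]; rfl

theorem hsl_iterate_smul {p : ℕ} {B M : Type} [CommRing B] [AddCommGroup M] [Module B M]
    (F : FrobMod p B M) (e : ℕ) (b : B) (x : M) :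
    F.φ^[e] (b • x) = b ^ p ^ e • F.φ^[e] x := by
  induction e generalizing b x with
  | zero => simp
  | succ e ih =>
    rw [Function.iterate_succ_apply, Function.iterate_succ_apply, F.semilinear, ih, ← pow_mul,
      pow_succ']

/-- kernel of `φ^e` -/
def HslK {p : ℕ} {B M : Type} [CommRing B] [AddCommGroup M] [Module B M]
    (F : FrobMod p B M) (e : ℕ) : Submodule B M where
  carrier := {x | F.φ^[e] x = 0}
  zero_mem' := iterate_map_zero F.φ e
  add_mem' := by
    intro x y hx hy
    have hx : F.φ^[e] x = 0 := hx
    have hy : F.φ^[e] y = 0 := hy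
    change F.φ^[e] (x + y) = 0
    rw [iterate_map_add, hx, hy, add_zero]
  smul_mem' := by
    intro b x hx
    have hx : F.φ^[e] x = 0 := hx
    change F.φ^[e] (b • x) = 0
    rw [hsl_iterate_smul, hx, smul_zero]

theorem hsl_mem_K {p : ℕ} {B M : Type} [CommRing B] [AddCommGroup M] [Module B M]
    (F : FrobMod p B M) (e : ℕ) (x : M) : x ∈ HslK F e ↔ F.φ^[e] x = 0 := Iff.rfl

theorem hsl_mem_K_succ {p : ℕ} {B M : Type} [CommRing B] [AddCommGroup M] [Module B M]
    (F : FrobMod p B M) (e : ℕ) (x : M) : x ∈ HslK F (e + 1) ↔ F.φ x ∈ HslK F e := by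
  rw [hsl_mem_K, hsl_mem_K, Function.iterate_succ_apply]

theorem hsl_K_mono {p : ℕ} {B M : Type} [CommRing B] [AddCommGroup M] [Module B M]
    (F : FrobMod p B M) : Monotone (HslK F) := by
  apply monotone_nat_of_le_succ
  intro e x hx
  rw [hsl_mem_K] at *
  rw [Function.iterate_succ_apply', hx, map_zero]

theorem hsl_K_stable {p : ℕ} {B M : Type} [CommRing B] [AddCommGroup M] [Module B M]
    (F : FrobMod p B M) (e : ℕ) : F.IsStable (HslK F e) := by
  intro x hx
  exact (hsl_mem_K_succ F e x).1 (hsl_K_mono F (Nat.le_succ e) hx)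

/-- annihilator of successive quotients -/
def HslA {p : ℕ} {B M : Type} [CommRing B] [AddCommGroup M] [Module B M]
    (F : FrobMod p B M) (e : ℕ) : Ideal B where
  carrier := {b | ∀ x ∈ HslK F (e + 1), b • x ∈ HslK F e}
  zero_mem' := by intro x _; rw [zero_smul]; exact zero_mem _
  add_mem' := by
    intro b c hb hc x hx
    rw [add_smul]
    exact add_mem (hb x hx) (hc x hx)
  smul_mem' := by
    intro c b hb x hx
    rw [smul_eq_mul, mul_smul]
    exact (HslK F e).smul_mem c (hb x hx)

theorem hsl_A_mono {p : ℕ} (hp : 2 ≤ p) {B M : Type} [CommRing B] [AddCommGroup M] [Module B M]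
    (F : FrobMod p B M) : Monotone (HslA F) := by
  apply monotone_nat_of_le_succ
  intro e b hb x hx
  rw [hsl_mem_K_succ] at hx ⊢
  have hbp : b ^ p = b ^ (p - 1) * b := by
    rw [← pow_succ, Nat.sub_add_cancel (show 1 ≤ p by omega)]
  rw [F.semilinear, hbp, mul_smul]
  exact (HslK F e).smul_mem _ (hb _ hx)

theorem hsl_gabber {p : ℕ} (hp : 2 ≤ p) {B M : Type} [CommRing B] [AddCommGroup M] [Module B M]
    (F : FrobMod p B M) (n₀ : ℕ) (b : B) (hb : b ∈ HslA F n₀) (t : ℕ) :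
    ∀ n, ∀ x ∈ HslK F (n₀ + n), b • x ∈ HslK F (n₀ + ((n - t) + 1)) := by
  induction t with
  | zero =>
    intro n x hx
    exact (HslK F _).smul_mem b (hsl_K_mono F (by omega) hx)
  | succ t ih =>
    intro n x hx
    cases n with
    | zero => exact (HslK F _).smul_mem b (hsl_K_mono F (by omega) hx)
    | succ n =>
      have h1 : F.φ x ∈ HslK F (n₀ + n) := (hsl_mem_K_succ F _ x).1 hx
      have h2 := ih n _ h1
      have h3 : b • b • F.φ x ∈ HslK F (n₀ + (n - t)) :=
        hsl_A_mono hp F (Nat.le_add_right n₀ (n - t)) hb _ h2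
      have hbp : b ^ p = b ^ (p - 2) * (b * b) := by
        rw [← pow_two, ← pow_add, Nat.sub_add_cancel hp]
      rw [show n + 1 - (t + 1) = n - t by omega, ← add_assoc, hsl_mem_K_succ, F.semilinear,
        hbp, mul_smul, mul_smul]
      exact (HslK F _).smul_mem _ h3

theorem hsl_ext {p : ℕ} {B M : Type} [CommRing B] [AddCommGroup M] [Module B M]
    (F : FrobMod p B M) (N : Submodule B M) (hN : F.IsStable N)
    (h1 : ∃ e : ℕ, ∀ x, (HslSub F N hN).φ^[e] x = 0)
    (h2 : ∃ e : ℕ, ∀ x, (HslQuot F N hN).φ^[e] x = 0) :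
    ∃ e : ℕ, ∀ x, F.φ^[e] x = 0 := by
  obtain ⟨e1, h1⟩ := h1
  obtain ⟨e2, h2⟩ := h2
  refine ⟨e1 + e2, fun x => ?_⟩
  have hx : F.φ^[e2] x ∈ N := by
    have := h2 (N.mkQ x)
    rw [hsl_quot_iterate] at this
    simpa using this
  rw [Function.iterate_add_apply]
  have := congrArg Subtype.val (h1 ⟨_, hx⟩)
  rw [hsl_sub_iterate] at this
  exact this


theorem hsl_nil {p : ℕ} (hp : 2 ≤ p) {B : Type} [CommRing B] [IsNoetherianRing B] [IsLocalRing B]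
    [IsAdicComplete (maximalIdeal B) B]
    {E : Type} [AddCommGroup E] [Module B E] [Module.Injective B E]
    (ι : ResidueField B →ₗ[B] E) (hι : Function.Injective ι)
    (hess : ∀ x : E, x ≠ 0 → ∃ b : B, b • x ≠ 0 ∧ b • x ∈ LinearMap.range ι)
    (I : Ideal B) :
    ∀ (M : Type) [AddCommGroup M] [Module B M] [IsArtinian B M] (F : FrobMod p B M),
      (∀ x, ∃ e : ℕ, F.φ^[e] x = 0) → (∀ b ∈ I, ∀ x : M, b • x = 0) →
      ∃ e : ℕ, ∀ x, F.φ^[e] x = 0 := by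
  induction I using IsNoetherian.induction with
  | hgt I IH =>
  intro M _ _ _ F hF hI
  have hsubnil : ∀ (N : Submodule B M) (hN : F.IsStable N),
      ∀ x, ∃ e : ℕ, (HslSub F N hN).φ^[e] x = 0 := by
    intro N hN x
    obtain ⟨e, he⟩ := hF x
    exact ⟨e, Subtype.ext (by rw [hsl_sub_iterate, he]; rfl)⟩
  have hquotnil : ∀ (N : Submodule B M) (hN : F.IsStable N),
      ∀ x, ∃ e : ℕ, (HslQuot F N hN).φ^[e] x = 0 := by
    intro N hN x
    obtain ⟨x, rfl⟩ := N.mkQ_surjective x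
    obtain ⟨e, he⟩ := hF x
    exact ⟨e, by rw [hsl_quot_iterate, he, map_zero]⟩
  by_cases htop : I = ⊤
  · refine ⟨0, fun x => ?_⟩
    have := hI 1 (by rw [htop]; trivial) x
    simpa using this
  by_cases hprime : Ideal.IsPrime I
  · -- prime case
    obtain ⟨n₀, hn₀⟩ := monotone_stabilizes_iff_noetherian.2 (inferInstance : IsNoetherian B B)
      ⟨HslA F, hsl_A_mono hp F⟩
    have hstab : ∀ i, HslA F (n₀ + i) = HslA F n₀ := fun i => (hn₀ (n₀ + i) (by omega)).symm
    have hIa : I ≤ HslA F n₀ := by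
      intro b hb x _
      rw [hI b hb x]
      exact zero_mem _
    rcases hIa.lt_or_eq with hlt | heq
    · have hkill : ∀ b ∈ HslA F n₀, ∀ x : M, b • x ∈ HslK F (n₀ + 1) := by
        intro b hb x
        obtain ⟨e, he⟩ := hF x
        have hx : x ∈ HslK F (n₀ + e) :=
          hsl_K_mono F (Nat.le_add_left e n₀) ((hsl_mem_K F e x).2 he)
        have := hsl_gabber hp F n₀ b hb e e x hx
        simpa using this
      refine hsl_ext F (HslK F (n₀ + 1)) (hsl_K_stable F _) ⟨n₀ + 1, fun x => ?_⟩ ?_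
      · apply Subtype.ext
        rw [hsl_sub_iterate]
        exact x.2
      · refine IH _ hlt _ _ (hquotnil _ _) ?_
        intro b hb x
        obtain ⟨x, rfl⟩ := Submodule.mkQ_surjective _ x
        rw [← map_smul]
        exact (Submodule.Quotient.mk_eq_zero _).2 (hkill b hb x)
    · exfalso
      have hfin : Module.Finite B (M →ₗ[B] E) := hsl_dual_finite ι hess
      let K : ℕ → Submodule B (M →ₗ[B] E) := fun i =>
        { carrier := {f | ∀ x ∈ HslK F (n₀ + i), f x = 0}
          zero_mem' := fun x _ => rfl
          add_mem' := by
            intro f g hf hg x hx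
            rw [LinearMap.add_apply, hf x hx, hg x hx, add_zero]
          smul_mem' := by
            intro b f hf x hx
            rw [LinearMap.smul_apply, hf x hx, smul_zero] }
      refine hsl_rank_prime I (N := M →ₗ[B] E) ?_ K ?_ ?_
      · intro b hb f
        ext x
        rw [LinearMap.smul_apply, ← map_smul, hI b hb, map_zero, LinearMap.zero_apply]
      · intro i j hij f hf x hx
        exact hf x (hsl_K_mono F (by omega) hx)
      · intro i b hb
        rw [heq, ← hstab i] at hb
        have hb' : ¬ ∀ x ∈ HslK F (n₀ + i + 1), b • x ∈ HslK F (n₀ + i) := hb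
        push Not at hb'
        obtain ⟨x, hx, hbx⟩ := hb'
        have hne : (HslK F (n₀ + i)).mkQ (b • x) ≠ 0 := by
          intro h0
          exact hbx ((Submodule.Quotient.mk_eq_zero _).1 h0)
        obtain ⟨f, hf⟩ := hsl_cogen ι hι _ hne
        refine ⟨f ∘ₗ (HslK F (n₀ + i)).mkQ, ?_, ?_⟩
        · intro y hy
          have : (HslK F (n₀ + i)).mkQ y = 0 := (Submodule.Quotient.mk_eq_zero _).2 hy
          rw [LinearMap.comp_apply, this, map_zero]
        · intro hmem
          apply hf
          have := hmem x hx
          rw [LinearMap.smul_apply, ← map_smul] at this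
          exact this
  · rw [Ideal.isPrime_iff] at hprime
    push Not at hprime
    obtain ⟨x, y, hxy, hx, hy⟩ := hprime htop
    let N : Submodule B M := LinearMap.range (LinearMap.lsmul B M x)
    have hN : F.IsStable N := by
      rintro _ ⟨m, rfl⟩
      refine ⟨x ^ (p - 1) • F.φ m, ?_⟩
      simp only [LinearMap.lsmul_apply]
      rw [F.semilinear, smul_smul, ← pow_succ', Nat.sub_add_cancel (by omega)]
    have hlt : ∀ z, z ∉ I → I < I ⊔ Ideal.span {z} := by
      intro z hz
      refine lt_of_le_of_ne le_sup_left fun h => hz ?_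
      rw [h]
      exact Ideal.mem_sup_right (Ideal.mem_span_singleton_self z)
    refine hsl_ext F N hN ?_ ?_
    · refine IH _ (hlt y hy) _ _ (hsubnil _ _) ?_
      rintro b hb ⟨_, m, rfl⟩
      apply Subtype.ext
      change b • x • m = 0
      obtain ⟨c, hc, d, hd, rfl⟩ := Submodule.mem_sup.1 hb
      obtain ⟨d, rfl⟩ := Ideal.mem_span_singleton'.1 hd
      rw [add_smul, hI c hc, zero_add, smul_smul, mul_assoc, mul_comm y x]
      exact hI _ (Ideal.mul_mem_left I d hxy) m
    · refine IH _ (hlt x hx) _ _ (hquotnil _ _) ?_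
      intro b hb m
      obtain ⟨m, rfl⟩ := Submodule.mkQ_surjective _ m
      rw [← map_smul]
      refine (Submodule.Quotient.mk_eq_zero _).2 ?_
      obtain ⟨c, hc, d, hd, rfl⟩ := Submodule.mem_sup.1 hb
      obtain ⟨d, rfl⟩ := Ideal.mem_span_singleton'.1 hd
      rw [add_smul, hI c hc, zero_add]
      exact ⟨d • m, by rw [LinearMap.lsmul_apply, smul_smul, mul_comm]⟩

/-- The action of the completion on a torsion module. -/
noncomputable def HslSmul {R : Type} [CommRing R] (m : Ideal R) {M : Type} [AddCommGroup M]
    [Module R M] (htor : ∀ x : M, ∃ n : ℕ, ∀ b ∈ m ^ n, b • x = 0) (b : AdicCompletion m R)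
    (x : M) : M :=
  Classical.choose (Ideal.Quotient.mk_surjective
    (AdicCompletion.evalₐ m (Classical.choose (htor x)) b)) • x

theorem hsl_smul_eq {R : Type} [CommRing R] (m : Ideal R) {M : Type} [AddCommGroup M]
    [Module R M] (htor : ∀ x : M, ∃ n : ℕ, ∀ b ∈ m ^ n, b • x = 0) (b : AdicCompletion m R)
    (x : M) (n : ℕ) (r : R) (hn : ∀ b ∈ m ^ n, b • x = 0)
    (hr : Ideal.Quotient.mk (m ^ n) r = AdicCompletion.evalₐ m n b) :
    HslSmul m htor b x = r • x := by
  have hk := Classical.choose_spec (htor x)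
  have hs := Classical.choose_spec (Ideal.Quotient.mk_surjective
    (AdicCompletion.evalₐ m (Classical.choose (htor x)) b))
  unfold HslSmul
  generalize Classical.choose (Ideal.Quotient.mk_surjective
    (AdicCompletion.evalₐ m (Classical.choose (htor x)) b)) = s at hs
  generalize Classical.choose (htor x) = k at hs hk
  rw [← sub_eq_zero, ← sub_smul]
  rcases le_total k n with h | h
  · apply hk
    rw [← Ideal.Quotient.eq, hs, ← hsl_evalA_transition m h, ← hr]
    rfl
  · apply hn
    rw [← Ideal.Quotient.eq, hr, ← hsl_evalA_transition m h, ← hs]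
    rfl

/-- common lift -/
theorem hsl_lift {R : Type} [CommRing R] (m : Ideal R) (n : ℕ) (b : AdicCompletion m R) :
    ∃ r : R, Ideal.Quotient.mk (m ^ n) r = AdicCompletion.evalₐ m n b :=
  Ideal.Quotient.mk_surjective _

theorem hsl_tor_mono {R : Type} [CommRing R] (m : Ideal R) {M : Type} [AddCommGroup M]
    [Module R M] (x : M) {n k : ℕ} (h : n ≤ k) (hn : ∀ b ∈ m ^ n, b • x = 0) :
    ∀ b ∈ m ^ k, b • x = 0 := fun b hb => hn b (Ideal.pow_le_pow_right h hb)

/-- Module structure over the completion. -/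
@[reducible] noncomputable def HslModule {R : Type} [CommRing R] (m : Ideal R) {M : Type}
    [AddCommGroup M]
    [Module R M] (htor : ∀ x : M, ∃ n : ℕ, ∀ b ∈ m ^ n, b • x = 0) :
    Module (AdicCompletion m R) M where
  smul := HslSmul m htor
  one_smul x := by
    obtain ⟨n, hn⟩ := htor x
    change HslSmul m htor 1 x = x
    rw [hsl_smul_eq m htor 1 x n 1 hn (by rw [map_one, map_one]), one_smul]
  mul_smul b c x := by
    obtain ⟨n, hn⟩ := htor x
    obtain ⟨r, hr⟩ := hsl_lift m n b
    obtain ⟨s, hs⟩ := hsl_lift m n c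
    change HslSmul m htor (b * c) x = HslSmul m htor b (HslSmul m htor c x)
    rw [hsl_smul_eq m htor (b * c) x n (r * s) hn (by rw [map_mul, map_mul, hr, hs]),
      hsl_smul_eq m htor c x n s hn hs, hsl_smul_eq m htor b (s • x) n r (fun d hd => by
        rw [smul_comm, hn d hd, smul_zero]) hr, mul_smul]
  smul_zero b := by
    obtain ⟨r, hr⟩ := hsl_lift m 0 b
    change HslSmul m htor b 0 = 0
    rw [hsl_smul_eq m htor b 0 0 r (fun d _ => smul_zero d) hr, smul_zero]
  smul_add b x y := by
    obtain ⟨n, hn⟩ := htor x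
    obtain ⟨k, hk⟩ := htor y
    have hn := hsl_tor_mono m x (le_max_left n k) hn
    have hk := hsl_tor_mono m y (le_max_right n k) hk
    obtain ⟨r, hr⟩ := hsl_lift m (max n k) b
    change HslSmul m htor b (x + y) = HslSmul m htor b x + HslSmul m htor b y
    rw [hsl_smul_eq m htor b x _ r hn hr, hsl_smul_eq m htor b y _ r hk hr,
      hsl_smul_eq m htor b (x + y) _ r (fun d hd => by
        rw [smul_add, hn d hd, hk d hd, add_zero]) hr, smul_add]
  add_smul b c x := by
    obtain ⟨n, hn⟩ := htor x
    obtain ⟨r, hr⟩ := hsl_lift m n b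
    obtain ⟨s, hs⟩ := hsl_lift m n c
    change HslSmul m htor (b + c) x = HslSmul m htor b x + HslSmul m htor c x
    rw [hsl_smul_eq m htor (b + c) x n (r + s) hn (by rw [map_add, map_add, hr, hs]),
      hsl_smul_eq m htor c x n s hn hs, hsl_smul_eq m htor b x n r hn hr, add_smul]
  zero_smul x := by
    obtain ⟨n, hn⟩ := htor x
    change HslSmul m htor 0 x = 0
    rw [hsl_smul_eq m htor 0 x n 0 hn (by rw [map_zero, map_zero]), zero_smul]

theorem hsl_nil_local {p : ℕ} (hp : 2 ≤ p) {R : Type} [CommRing R] [IsNoetherianRing R]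
    [IsLocalRing R] {M : Type} [AddCommGroup M] [Module R M] [IsArtinian R M]
    (F : FrobMod p R M) (hF : ∀ x, ∃ e : ℕ, F.φ^[e] x = 0) :
    ∃ e : ℕ, ∀ x, F.φ^[e] x = 0 := by
  have htor : ∀ x : M, ∃ n : ℕ, ∀ b ∈ maximalIdeal R ^ n, b • x = 0 := hsl_torsion
  let B := AdicCompletion (maximalIdeal R) R
  have : IsNoetherianRing B := hsl_completion_noetherian R (maximalIdeal R)
  let instM : Module B M := HslModule (maximalIdeal R) htor
  have hsm : ∀ (b : B) (x : M), b • x = HslSmul (maximalIdeal R) htor b x := fun _ _ => rfl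
  have halg : ∀ (r : R) (x : M), algebraMap R B r • x = r • x := by
    intro r x
    obtain ⟨n, hn⟩ := htor x
    rw [hsm]
    exact hsl_smul_eq _ htor _ x n r hn rfl
  have : IsScalarTower R B M := IsScalarTower.of_algebraMap_smul halg
  have : IsArtinian B M := isArtinian_of_tower R inferInstance
  let F' : FrobMod p B M :=
    { φ := F.φ
      semilinear := by
        intro b x
        obtain ⟨n, hn⟩ := htor x
        obtain ⟨k, hk⟩ := htor (F.φ x)
        have hn := hsl_tor_mono _ x (le_max_left n k) hn
        have hk := hsl_tor_mono _ (F.φ x) (le_max_right n k) hk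
        obtain ⟨r, hr⟩ := hsl_lift (maximalIdeal R) (max n k) b
        rw [hsm, hsm, hsl_smul_eq _ htor b x _ r hn hr,
          hsl_smul_eq _ htor (b ^ p) _ _ (r ^ p) hk (by rw [map_pow, map_pow, hr]),
          F.semilinear] }
  obtain ⟨E, _, _, _, ι, hι, hess⟩ := hsl_exists_hull B (ResidueField B)
  exact hsl_nil hp ι hι hess ⊥ M F' hF (by
    intro b hb x
    rw [(Submodule.mem_bot B).1 hb, zero_smul])


end

/-- Hartshorne–Speiser–Lyubeznik. Let `(R₀, m₀)` be a noetherian local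
`𝔽_p`-algebra and `M` a co-finite (Artinian) `R₀[φ]`-module. Then some single power of `φ`
annihilates all `φ`-nilpotent elements of `M`. -/
theorem hartshorne_speiser_lyubeznik
    {p : ℕ} [Fact p.Prime] {R₀ : Type} [CommRing R₀] [CharP R₀ p]
    [IsNoetherianRing R₀] [IsLocalRing R₀]
    {M : Type} [AddCommGroup M] [Module R₀ M] [IsArtinian R₀ M]
    (F : FrobMod p R₀ M) :
    ∃ e : ℕ, ∀ x : M, (∃ e' : ℕ, 0 < e' ∧ F.φ^[e'] x = 0) → F.φ^[e] x = 0 := by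
  have hnil : ∀ (x : M), x ∈ (⨆ e, HslK F e) ↔ ∃ e, F.φ^[e] x = 0 := by
    intro x
    rw [Submodule.mem_iSup_of_directed _ (hsl_K_mono F).directed_le]
    rfl
  have hst : F.IsStable (⨆ e, HslK F e) := by
    intro x hx
    rw [hnil] at hx ⊢
    obtain ⟨e, he⟩ := hx
    exact ⟨e, hsl_K_stable F e x he⟩
  obtain ⟨e, he⟩ := hsl_nil_local (Fact.out : p.Prime).two_le (HslSub F _ hst) (by
    rintro ⟨x, hx⟩
    obtain ⟨e, he⟩ := (hnil x).1 hx
    exact ⟨e, Subtype.ext (by rw [hsl_sub_iterate]; exact he)⟩)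
  refine ⟨e, ?_⟩
  rintro x ⟨e', _, hx⟩
  have := congrArg Subtype.val (he ⟨x, (hnil x).2 ⟨e', hx⟩⟩)
  rw [hsl_sub_iterate] at this
  exact this
end

section
/- Let (R, m) be a noetherian local ring which is equidimensional and universally catenary. Let R → S be an étale ring map and q a prime of S lying over m. Then the localization S_q is equidimensional of dimension equal to dim R. -/
/-- A commutative ring is equidimensional if every minimal prime has quotient of full
Krull dimension. -/
def IsEquidimensionalRing (R : Type) [CommRing R] : Prop :=
  ∀ P ∈ minimalPrimes R, ringKrullDim (R ⧸ P) = ringKrullDim R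

/-- A strictly increasing chain of primes is saturated if no prime can be inserted between
consecutive terms. -/
def IsSaturatedChain {R : Type} [CommRing R] (c : LTSeries (PrimeSpectrum R)) : Prop :=
  ∀ i : Fin c.length, ¬ ∃ x, c.toFun i.castSucc < x ∧ x < c.toFun i.succ

/-- A ring is catenary if any two saturated chains of primes with the same endpoints have the
same length. -/
def IsCatenaryRing (R : Type) [CommRing R] : Prop :=
  ∀ c₁ c₂ : LTSeries (PrimeSpectrum R), c₁.head = c₂.head → c₁.last = c₂.last →
    IsSaturatedChain c₁ → IsSaturatedChain c₂ → c₁.length = c₂.length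

/-- A ring is universally catenary if every finite type algebra over it is catenary. -/
def IsUniversallyCatenaryRing (R : Type) [CommRing R] : Prop :=
  ∀ (S : Type) (_ : CommRing S) (_ : Algebra R S), Algebra.FiniteType R S → IsCatenaryRing S

open Polynomial

lemma head_insertNth' {α : Type} [Preorder α] (c : LTSeries α) (i : Fin c.length) (x : α)
    (h1 : c.toFun i.castSucc < x) (h2 : x < c.toFun i.succ) :
    RelSeries.head (RelSeries.insertNth c i x h1 h2) = RelSeries.head c := by
  change (Fin.castSucc i.succ).insertNth (α := fun _ ↦ α) x c.toFun 0 = c.toFun 0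
  have h : (Fin.castSucc i.succ).succAbove 0 = 0 :=
    Fin.succAbove_ne_zero_zero (by simp [Fin.ext_iff])
  conv_lhs => rw [← h]
  rw [Fin.insertNth_apply_succAbove]

lemma last_insertNth' {α : Type} [Preorder α] (c : LTSeries α) (i : Fin c.length) (x : α)
    (h1 : c.toFun i.castSucc < x) (h2 : x < c.toFun i.succ) :
    RelSeries.last (RelSeries.insertNth c i x h1 h2) = RelSeries.last c := by
  change (Fin.castSucc i.succ).insertNth (α := fun _ ↦ α) x c.toFun (Fin.last _) =
    c.toFun (Fin.last _)
  have h : (Fin.castSucc i.succ).succAbove (Fin.last _) = Fin.last _ :=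
    Fin.succAbove_ne_last_last (by have := i.2; simp [Fin.ext_iff]; omega)
  conv_lhs => rw [← h]
  rw [Fin.insertNth_apply_succAbove]

/-- Every chain between `a` and `b` (with `b` of finite height) is dominated in length by a
saturated chain from `a` to `b`. -/
lemma exists_saturated_aux {A : Type} [CommRing A] {a b : PrimeSpectrum A} (N : ℕ)
    (hN : ∀ c : LTSeries (PrimeSpectrum A), c.last = b → c.length ≤ N) (k : ℕ) :
    ∀ c : LTSeries (PrimeSpectrum A), c.head = a → c.last = b → N ≤ c.length + k →
    ∃ c' : LTSeries (PrimeSpectrum A), c'.head = a ∧ c'.last = b ∧ IsSaturatedChain c' ∧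
      c.length ≤ c'.length := by
  induction k with
  | zero =>
    intro c ha hb hk
    refine ⟨c, ha, hb, ?_, le_rfl⟩
    rintro i ⟨x, hx1, hx2⟩
    have := hN (c.insertNth i x hx1 hx2) ?_
    · simp at this
      omega
    · rw [← hb]
      exact last_insertNth' c i x hx1 hx2
  | succ k ih =>
    intro c ha hb hk
    by_cases hc : IsSaturatedChain c
    · exact ⟨c, ha, hb, hc, le_rfl⟩
    · simp only [IsSaturatedChain, not_forall, not_not] at hc
      obtain ⟨i, x, hx1, hx2⟩ := hc
      obtain ⟨c', h1, h2, h3, h4⟩ := ih (c.insertNth i x hx1 hx2) ((head_insertNth' c i x hx1 hx2).trans ha)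
        ((last_insertNth' c i x hx1 hx2).trans hb) (by simp; omega)
      refine ⟨c', h1, h2, h3, ?_⟩
      simp at h4
      omega

lemma exists_saturated {A : Type} [CommRing A] [IsNoetherianRing A] {a b : PrimeSpectrum A}
    (c : LTSeries (PrimeSpectrum A)) (ha : a ≤ c.head) (hb : c.last ≤ b) :
    ∃ c' : LTSeries (PrimeSpectrum A), c'.head = a ∧ c'.last = b ∧ IsSaturatedChain c' ∧
      c.length ≤ c'.length := by
  have hfin : b.asIdeal.height ≠ ⊤ := Ideal.height_ne_top_of_isPrime
  obtain ⟨N, hN⟩ := ENat.ne_top_iff_exists.mp hfin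
  have key : ∀ c : LTSeries (PrimeSpectrum A), c.last = b → c.length ≤ N := by
    intro c hc
    have h1 : (c.length : ℕ∞) ≤ Order.height b := Order.length_le_height hc.le
    rw [← PrimeSpectrum.height_eq_orderHeight, ← hN] at h1
    exact_mod_cast h1
  obtain ⟨c1, h1, h1', h1l⟩ : ∃ c1 : LTSeries (PrimeSpectrum A), c1.head = a ∧ c1.last ≤ b ∧
      c.length ≤ c1.length := by
    rcases ha.eq_or_lt with h | h
    · exact ⟨c, h.symm, hb, le_rfl⟩
    · exact ⟨c.cons a h, by simp, by simpa using hb, by simp⟩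
  obtain ⟨c2, h2, h2', h2l⟩ : ∃ c2 : LTSeries (PrimeSpectrum A), c2.head = a ∧ c2.last = b ∧
      c.length ≤ c2.length := by
    rcases h1'.eq_or_lt with h | h
    · exact ⟨c1, h1, h, h1l⟩
    · exact ⟨c1.snoc b h, by simpa using h1, by simp, by simp; omega⟩
  obtain ⟨c3, a3, b3, s3, l3⟩ := exists_saturated_aux N key N c2 h2 h2' (by omega)
  exact ⟨c3, a3, b3, s3, h2l.trans l3⟩

/-- In a catenary noetherian ring, if `a ⋖ a' ≤ b` and there is a chain of length `d + 1` between
`a` and `b`, there is one of length at least `d` between `a'` and `b`. -/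
lemma IsCatenaryRing.exists_chain {A : Type} [CommRing A] [IsNoetherianRing A]
    (hA : IsCatenaryRing A) {a a' b : PrimeSpectrum A} (h : a ⋖ a') (hb : a' ≤ b)
    (c : LTSeries (PrimeSpectrum A)) (hac : a ≤ c.head) (hcb : c.last ≤ b) :
    ∃ c' : LTSeries (PrimeSpectrum A), c'.head = a' ∧ c'.last = b ∧ c.length ≤ c'.length + 1 := by
  obtain ⟨c1, a1, b1, s1, l1⟩ := exists_saturated c hac hcb
  obtain ⟨c2, a2, b2, s2, l2⟩ := exists_saturated (a := a') (b := b)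
    (RelSeries.singleton _ a') le_rfl hb
  have h2 : a < c2.head := a2 ▸ h.1
  have := hA c1 (c2.cons a h2) (by simpa using a1) (by simpa [b2] using b1) s1 ?_
  · refine ⟨c2, a2, b2, l1.trans ?_⟩
    rw [this]
    simp
  · intro i
    obtain ⟨i, hi⟩ := i
    rcases i with _ | i
    · have e1 : (c2.cons a h2).toFun (Fin.castSucc ⟨0, hi⟩) = a := rfl
      have e2 : (c2.cons a h2).toFun (Fin.succ ⟨0, hi⟩) = a' := a2 ▸ rfl
      rw [e1, e2]
      rintro ⟨x, h1, h2⟩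
      exact h.2 h1 h2
    · have hi' : i < c2.length := by simp at hi; omega
      have e1 := RelSeries.cons_cast_succ c2 a h2 ⟨i, by omega⟩
      have e2 := RelSeries.cons_cast_succ c2 a h2 ⟨i + 1, by omega⟩
      have := s2 ⟨i, hi'⟩
      change ¬∃ x, c2 ⟨i, by omega⟩ < x ∧ x < c2 ⟨i + 1, by omega⟩ at this
      rw [← e1, ← e2] at this
      exact this

/-- A prime of `R[X]` lying over `p` and strictly larger than `p R[X]` covers it. -/
lemma covBy_of_fiber {R : Type} [CommRing R] (a b : PrimeSpectrum R[X]) (h : a < b)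
    (hab : PrimeSpectrum.comap (algebraMap R R[X]) a = PrimeSpectrum.comap (algebraMap R R[X]) b) :
    a ⋖ b := by
  refine ⟨h, fun x hax hxb ↦ ?_⟩
  set p := PrimeSpectrum.comap (algebraMap R R[X]) b with hp
  have hx : PrimeSpectrum.comap (algebraMap R R[X]) x = p := by
    apply le_antisymm
    · exact Ideal.comap_mono hxb.le
    · rw [← hab]
      exact Ideal.comap_mono hax.le
  have hdim : Order.krullDim (PrimeSpectrum.comap (algebraMap R R[X]) ⁻¹' {p}) ≤ 1 := by
    rw [Order.krullDim_eq_of_orderIso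
      (PrimeSpectrum.preimageOrderIsoFiber R (Polynomial R) p), ← ringKrullDim,
      ← ringKrullDim_eq_of_ringEquiv (polyEquivTensor R (p.asIdeal.ResidueField)).toRingEquiv]
    exact (Ring.krullDimLE_iff (n := 1)).mp inferInstance
  let a' : PrimeSpectrum.comap (algebraMap R R[X]) ⁻¹' {p} := ⟨a, hab⟩
  let x' : PrimeSpectrum.comap (algebraMap R R[X]) ⁻¹' {p} := ⟨x, hx⟩
  let b' : PrimeSpectrum.comap (algebraMap R R[X]) ⁻¹' {p} := ⟨b, rfl⟩
  have hxb' : x' < b' := hxb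
  have hax' : a' < x' := hax
  let s1 : LTSeries (PrimeSpectrum.comap (algebraMap R R[X]) ⁻¹' {p}) :=
    RelSeries.cons (RelSeries.singleton _ b') x' hxb'
  have hs1 : a' < RelSeries.head s1 := hax'.trans_eq (RelSeries.head_cons _ _ _).symm
  let s : LTSeries (PrimeSpectrum.comap (algebraMap R R[X]) ⁻¹' {p}) := RelSeries.cons s1 a' hs1
  have h2 := (Order.LTSeries.length_le_krullDim s).trans hdim
  have h3 : s.length = 2 := rfl
  rw [h3] at h2
  have h4 : (2 : ℕ) ≤ 1 := by exact_mod_cast h2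
  omega

lemma le_of_comap_le {A L : Type} [CommRing A] [CommRing L] (φ : A →+* L)
    (hφ : ∀ y : L, ∃ a b : A, IsUnit (φ b) ∧ y * φ b = φ a)
    {I J : Ideal L} (h : I.comap φ ≤ J.comap φ) : I ≤ J := by
  intro y hy
  obtain ⟨a, b, hb, e⟩ := hφ y
  have : a ∈ I.comap φ := by
    rw [Ideal.mem_comap, ← e]
    exact I.mul_mem_right _ hy
  have h2 := h this
  rw [Ideal.mem_comap, ← e] at h2
  exact (Ideal.mul_unit_mem_iff_mem J hb).mp h2

lemma exists_prime_comap {A L : Type} [CommRing A] [CommRing L] (φ : A →+* L)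
    (hφ : ∀ y : L, ∃ a b : A, IsUnit (φ b) ∧ y * φ b = φ a)
    {I : Ideal L} {Q M : Ideal A} [Q.IsPrime] (hI : I.comap φ ≤ Q)
    (hQM : Q ≤ M) (hM : ∀ b ∈ M, ¬ IsUnit (φ b)) :
    ∃ P : Ideal L, P.IsPrime ∧ P.comap φ = Q := by
  rw [← Ideal.comap_map_eq_self_iff_of_isPrime]
  refine le_antisymm ?_ Ideal.le_comap_map
  have key : ∀ y ∈ Q.map φ, ∃ c, IsUnit (φ c) ∧ ∃ a ∈ Q, y * φ c = φ a := by
    intro y hy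
    induction hy using Submodule.span_induction with
    | mem y hy =>
      obtain ⟨a, ha, rfl⟩ := hy
      exact ⟨1, by simp, a, ha, by simp⟩
    | zero => exact ⟨1, by simp, 0, Q.zero_mem, by simp⟩
    | add x y _ _ hx hy =>
      obtain ⟨c, hc, a, ha, e⟩ := hx
      obtain ⟨c', hc', a', ha', e'⟩ := hy
      refine ⟨c * c', by simpa using ⟨hc, hc'⟩, a * c' + a' * c,
        Q.add_mem (Q.mul_mem_right _ ha) (Q.mul_mem_right _ ha'), ?_⟩
      simp only [map_mul, map_add, ← e, ← e']
      ring
    | smul r x _ hx =>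
      obtain ⟨c, hc, a, ha, e⟩ := hx
      obtain ⟨a', c', hc', e'⟩ := hφ r
      refine ⟨c * c', by simpa using ⟨hc, hc'⟩, a' * a, Q.mul_mem_left _ ha, ?_⟩
      simp only [map_mul, smul_eq_mul, ← e, ← e']
      ring
  intro a ha
  obtain ⟨c, hc, a', ha', e⟩ := key _ ha
  have h1 : a * c - a' ∈ Q := by
    apply hI
    rw [Ideal.mem_comap, map_sub, map_mul, e, sub_self]
    exact I.zero_mem
  have h2 : a * c ∈ Q := by simpa using Q.add_mem h1 ha'
  exact (Ideal.IsPrime.mem_or_mem ‹_› h2).resolve_right fun h ↦ hM _ (hQM h) hc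

/-- Chains of primes above the contraction of `P` lift. -/
lemma length_le_dim_quotient {A L : Type} [CommRing A] [CommRing L] (φ : A →+* L)
    (hφ : ∀ y : L, ∃ a b : A, IsUnit (φ b) ∧ y * φ b = φ a)
    [IsLocalRing L] (P : Ideal L)
    (c : LTSeries (PrimeSpectrum A)) (hP : P.comap φ ≤ c.head.asIdeal)
    (hl : c.last.asIdeal ≤ (IsLocalRing.maximalIdeal L).comap φ) :
    (c.length : WithBot ℕ∞) ≤ ringKrullDim (L ⧸ P) := by
  have hi : ∀ i, ∃ P' : Ideal L, P'.IsPrime ∧ P'.comap φ = (c i).asIdeal := fun i ↦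
    exists_prime_comap φ hφ (I := P) (Q := (c i).asIdeal) (M := c.last.asIdeal)
      (hP.trans (c.head_le i)) (LTSeries.monotone c (Fin.le_last i))
      (fun b hb ↦ (IsLocalRing.mem_maximalIdeal _).mp (hl hb))
  choose σ hσ hσc using hi
  rw [ringKrullDim_quotient]
  let s : LTSeries (PrimeSpectrum.zeroLocus (R := L) P) :=
    LTSeries.mk c.length (fun i ↦ ⟨⟨σ i, hσ i⟩, by
      change P ≤ σ i
      apply le_of_comap_le φ hφ
      rw [hσc]
      exact hP.trans (c.head_le i)⟩) (by
      intro i j hij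
      have hlt : (c i).asIdeal < (c j).asIdeal := c.strictMono hij
      change σ i < σ j
      rw [← hσc, ← hσc] at hlt
      refine lt_of_le_not_ge (le_of_comap_le φ hφ hlt.le) fun h ↦ hlt.not_ge ?_
      exact Ideal.comap_mono h)
  exact Order.LTSeries.length_le_krullDim s

lemma exists_poly_map {R S : Type} [CommRing R] [CommRing S] [Algebra R S] [Algebra.Etale R S]
    (q : Ideal S) [q.IsPrime] :
    ∃ φ : R[X] →ₐ[R] Localization.AtPrime q, (∃ f : R[X], f.Monic ∧ φ f = 0) ∧
      ∀ y, ∃ a b : R[X], IsUnit (φ b) ∧ y * φ b = φ a := by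
  obtain ⟨h, hq, ⟨⟨P⟩⟩⟩ := Algebra.IsEtaleAt.exists_isStandardEtale (R := R) q
  let ψ : Localization.Away h →ₐ[S] Localization.AtPrime q :=
    IsLocalization.liftAlgHom (M := Submonoid.powers h) (f := Algebra.ofId S _) (by
      rintro ⟨_, n, rfl⟩
      exact IsLocalization.map_units (M := q.primeCompl) _
        ⟨h ^ n, fun hh ↦ hq (Ideal.IsPrime.mem_of_pow_mem ‹_› _ hh)⟩)
  let φ : R[X] →ₐ[R] Localization.AtPrime q := (ψ.restrictScalars R).comp (aeval P.x)
  have hg : IsUnit (φ P.g) := P.hasMap.2.map ψ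
  have hs : ∀ s : S, ∃ (p : R[X]) (n : ℕ),
      algebraMap S (Localization.AtPrime q) s * φ P.g ^ n = φ p := by
    intro s
    obtain ⟨p, n, e⟩ := P.exists_mul_aeval_x_g_pow_eq_aeval_x (algebraMap S _ s)
    refine ⟨p, n, ?_⟩
    have := congrArg ψ e
    simpa [φ] using this
  refine ⟨φ, ⟨P.f, P.monic_f, ?_⟩, ?_⟩
  · have := congrArg ψ P.hasMap.1
    simpa [φ] using this
  · intro y
    obtain ⟨s, t, rfl⟩ := IsLocalization.exists_mk'_eq q.primeCompl y
    obtain ⟨p, n, e⟩ := hs s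
    obtain ⟨p', n', e'⟩ := hs t
    refine ⟨p * P.g ^ n', p' * P.g ^ n, ?_, ?_⟩
    · rw [map_mul, map_pow, ← e']
      exact ((IsLocalization.map_units _ t).mul (hg.pow _)).mul (hg.pow _)
    · rw [map_mul, map_mul, map_pow, map_pow, ← e', ← e]
      have := IsLocalization.mk'_spec (Localization.AtPrime q) s t
      linear_combination φ P.g ^ n * φ P.g ^ n' * this

/-- `p ↦ p R[X]` as a map of spectra. -/
noncomputable def extC {R : Type} [CommRing R] (p : PrimeSpectrum R) : PrimeSpectrum R[X] :=
  ⟨p.asIdeal.map C, Ideal.isPrime_map_C_of_isPrime⟩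

lemma comap_extC {R : Type} [CommRing R] (p : PrimeSpectrum R) :
    (extC p).asIdeal.comap C = p.asIdeal := by
  ext x
  simp only [extC, Ideal.mem_comap, Ideal.mem_map_C_iff]
  refine ⟨fun h ↦ by simpa using h 0, fun h n ↦ ?_⟩
  rw [coeff_C]
  split_ifs
  · exact h
  · exact zero_mem _

lemma extC_strictMono {R : Type} [CommRing R] : StrictMono (extC (R := R)) := by
  intro p p' h
  refine lt_of_le_not_ge (Ideal.map_mono h.le) fun h' ↦ h.not_ge ?_
  have : (extC p').asIdeal.comap C ≤ (extC p).asIdeal.comap C := Ideal.comap_mono h'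
  rwa [comap_extC, comap_extC] at this

lemma extC_lt {R : Type} [CommRing R] (p : PrimeSpectrum R) (Q : PrimeSpectrum R[X])
    (h : Q.asIdeal.comap C = p.asIdeal) (f : R[X]) (hf : f.Monic) (hfQ : f ∈ Q.asIdeal) :
    extC p < Q := by
  refine lt_of_le_not_ge (Ideal.map_le_iff_le_comap.mpr h.ge) fun h' ↦ ?_
  have h1 : f ∈ p.asIdeal.map C := h' hfQ
  rw [Ideal.mem_map_C_iff] at h1
  have h2 := h1 f.natDegree
  rw [hf.coeff_natDegree] at h2
  exact p.isPrime.ne_top ((Ideal.eq_top_iff_one _).mpr h2)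

lemma ringKrullDim_etale_localization
    {R S : Type} [CommRing R] [CommRing S] [IsNoetherianRing R] [IsLocalRing R]
    [Algebra R S] [Algebra.Etale R S] (q : Ideal S) [q.IsPrime]
    (hq : q.comap (algebraMap R S) = IsLocalRing.maximalIdeal R) :
    ringKrullDim (Localization.AtPrime q) = ringKrullDim R := by
  have : IsNoetherianRing S := Algebra.FiniteType.isNoetherianRing R S
  have : IsNoetherianRing (Localization.AtPrime q) :=
    IsLocalization.isNoetherianRing q.primeCompl _ inferInstance
  have : Module.Flat R (Localization.AtPrime q) := Module.Flat.trans R S _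
  have hover : (IsLocalRing.maximalIdeal (Localization.AtPrime q)).comap
      (algebraMap R (Localization.AtPrime q)) = IsLocalRing.maximalIdeal R := by
    rw [IsScalarTower.algebraMap_eq R S, ← Ideal.comap_comap, ← hq]
    exact congrArg _ Localization.AtPrime.under_maximalIdeal
  have : (IsLocalRing.maximalIdeal (Localization.AtPrime q)).LiesOver
    (IsLocalRing.maximalIdeal R) := ⟨hover.symm⟩
  have : IsLocalHom (algebraMap R (Localization.AtPrime q)) :=
    ((IsLocalRing.local_hom_TFAE _).out 0 4).mpr hover
  have : Algebra.EssFiniteType R (Localization.AtPrime q) := Algebra.EssFiniteType.comp R S _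
  have : Algebra.FormallyUnramified S (Localization.AtPrime q) :=
    Algebra.FormallyUnramified.of_isLocalization q.primeCompl
  have : Algebra.FormallyUnramified R (Localization.AtPrime q) :=
    Algebra.FormallyUnramified.comp R S _
  rw [← IsLocalRing.maximalIdeal_height_eq_ringKrullDim,
    ← IsLocalRing.maximalIdeal_height_eq_ringKrullDim,
    Ideal.height_eq_height_add_of_liesOver_of_hasGoingDown (IsLocalRing.maximalIdeal R)
      (IsLocalRing.maximalIdeal (Localization.AtPrime q))]
  have : ((IsLocalRing.maximalIdeal (Localization.AtPrime q)).map (Ideal.Quotient.mk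
      ((IsLocalRing.maximalIdeal R).map (algebraMap R (Localization.AtPrime q))))).height = 0 := by
    rw [Algebra.FormallyUnramified.map_maximalIdeal, Ideal.map_quotient_self]
    exact Ideal.height_bot
  rw [this, add_zero]

/-- Let `(R, m)` be a noetherian local ring which is equidimensional and
universally catenary, `R → S` an étale ring map and `q` a prime of `S` lying over `m`.
Then `S_q` is equidimensional with `dim S_q = dim R`. -/
theorem etale_localization_equidimensional
    {R S : Type} [CommRing R] [CommRing S] [IsNoetherianRing R] [IsLocalRing R]
    (hEq : IsEquidimensionalRing R) (hCat : IsUniversallyCatenaryRing R)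
    [Algebra R S] [Algebra.Etale R S]
    (q : Ideal S) [q.IsPrime]
    (hq : q.comap (algebraMap R S) = IsLocalRing.maximalIdeal R) :
    IsEquidimensionalRing (Localization.AtPrime q) ∧
      ringKrullDim (Localization.AtPrime q) = ringKrullDim R := by
  have hdim := ringKrullDim_etale_localization q hq
  refine ⟨fun P hP ↦ le_antisymm (ringKrullDim_quotient_le P) ?_, hdim⟩
  rw [hdim]
  have hPp : P.IsPrime := hP.1.1
  have : Module.Flat R (Localization.AtPrime q) := Module.Flat.trans R S _
  have hover : (IsLocalRing.maximalIdeal (Localization.AtPrime q)).comap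
      (algebraMap R (Localization.AtPrime q)) = IsLocalRing.maximalIdeal R := by
    rw [IsScalarTower.algebraMap_eq R S, ← Ideal.comap_comap, ← hq]
    exact congrArg _ Localization.AtPrime.under_maximalIdeal
  -- the contraction of `P` is minimal
  obtain ⟨p, hp⟩ : ∃ p : PrimeSpectrum R,
      p.asIdeal = P.comap (algebraMap R (Localization.AtPrime q)) := 
    ⟨⟨P.comap (algebraMap R (Localization.AtPrime q)), Ideal.comap_isPrime _ _⟩, rfl⟩
  have hpmin : p.asIdeal ∈ minimalPrimes R := by
    refine ⟨⟨p.isPrime, bot_le⟩, fun p0 hp0 hle ↦ ?_⟩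
    have := hp0.1
    have : P.LiesOver p.asIdeal := ⟨hp⟩
    obtain ⟨P0, hle0, hP0, hP0o⟩ := Ideal.exists_ideal_le_liesOver_of_le (p := p0)
      (q := p.asIdeal) P hle
    have h1 : P ≤ P0 := hP.2 ⟨hP0, bot_le⟩ hle0
    rw [hP0o.over, hp]
    exact Ideal.comap_mono h1
  obtain ⟨φ, ⟨f, hf, hf0⟩, hφ⟩ := exists_poly_map (R := R) q
  have hφC : φ.toRingHom.comp C = algebraMap R (Localization.AtPrime q) := φ.comp_algebraMap
  let Q : PrimeSpectrum R[X] := ⟨P.comap φ.toRingHom, inferInstance⟩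
  let M : PrimeSpectrum R[X] :=
    ⟨(IsLocalRing.maximalIdeal (Localization.AtPrime q)).comap φ.toRingHom, inferInstance⟩
  let m : PrimeSpectrum R := ⟨IsLocalRing.maximalIdeal R, inferInstance⟩
  have hQp : Q.asIdeal.comap C = p.asIdeal := by
    rw [Ideal.comap_comap, hφC, hp]
  have hMm : M.asIdeal.comap C = m.asIdeal := by
    rw [Ideal.comap_comap, hφC, hover]
  have hfI : ∀ I : Ideal (Localization.AtPrime q), f ∈ I.comap φ.toRingHom := fun I ↦ by
    rw [Ideal.mem_comap]
    change φ f ∈ I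
    rw [hf0]
    exact I.zero_mem
  have hpQ : extC p ⋖ Q := by
    refine covBy_of_fiber _ _ (extC_lt p Q hQp f hf (hfI P)) ?_
    ext1
    exact (comap_extC p).trans hQp.symm
  have hmM : extC m < M := extC_lt m M hMm f hf (hfI _)
  have hQM : Q ≤ M := Ideal.comap_mono (IsLocalRing.le_maximalIdeal hPp.ne_top)
  have hcatA : IsCatenaryRing R[X] := hCat R[X] _ _ inferInstance
  -- a longest chain in `R / p`
  rw [← hEq _ hpmin, ringKrullDim_quotient p.asIdeal]
  refine iSup_le fun c ↦ ?_
  let c1 : LTSeries (PrimeSpectrum R[X]) := c.map (fun x ↦ extC x.1)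
    (extC_strictMono.comp (Subtype.strictMono_coe _))
  have hlast : c1.last < M := by
    refine lt_of_le_of_lt (extC_strictMono.monotone ?_) hmM
    exact IsLocalRing.le_maximalIdeal c.last.1.isPrime.ne_top
  have hhead : extC p ≤ (c1.snoc M hlast).head := by
    rw [RelSeries.head_snoc]
    exact extC_strictMono.monotone c.head.2
  obtain ⟨c2, a2, b2, l2⟩ := hcatA.exists_chain hpQ hQM (c1.snoc M hlast) hhead (by simp)
  have hlen : c.length ≤ c2.length := by
    have : c1.length = c.length := rfl
    simp at l2
    omega
  refine le_trans ?_ (length_le_dim_quotient φ.toRingHom hφ P c2 (by rw [a2]) (by rw [b2]))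
  exact_mod_cast hlen
end
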